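/- Given a graph F and integers r, ℓ ≥ 1, there exists a graph G together with a system 𝒢 of induced copies of F in G such that (i) for every r-colouring of the edges of G some copy in 𝒢 is monochromatic, and (ii) for every subset 𝒻 ⊆ 𝒢 with 2 ≤ |𝒻| ≤ ℓ there exists a set 𝒳 ⊆ 𝒢 with |𝒳| ≤ |𝒻| − 2 such that 𝒻 ∪ 𝒳 is a forest of copies. -/

import Mathlib

open SimpleGraph

/-- The condition that an enumeration `F 0, F 1, …` of graphs (given as subgraphs of an
ambient graph `G`) forms a forest of copies: for every `j ≥ 1` the intersection of the
vertex set of `F j` with the union of the vertex sets of the earlier members is either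
empty, a single vertex, or the two endpoints of an edge belonging both to `F j` and to
some earlier member. -/
def ForestCond {V : Type*} {G : SimpleGraph V} {m : ℕ} (F : Fin m → G.Subgraph) : Prop :=
  ∀ j : Fin m, (j : ℕ) ≠ 0 →
    ((F j).verts ∩ ⋃ (i : Fin m) (_ : i < j), (F i).verts) = ∅ ∨
    (∃ v, ((F j).verts ∩ ⋃ (i : Fin m) (_ : i < j), (F i).verts) = {v}) ∨
    (∃ x y, (F j).Adj x y ∧ (∃ i : Fin m, i < j ∧ (F i).Adj x y) ∧
      ((F j).verts ∩ ⋃ (i : Fin m) (_ : i < j), (F i).verts) = {x, y})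

/-- A set of graphs (given as subgraphs of an ambient graph) is a *forest of copies*
if it admits an enumeration satisfying `ForestCond`. -/
def IsForestOfCopies {V : Type*} {G : SimpleGraph V} (𝒻 : Set G.Subgraph) : Prop :=
  ∃ (m : ℕ) (F : Fin m → G.Subgraph), Function.Injective F ∧
    (∀ H, H ∈ 𝒻 ↔ ∃ i, F i = H) ∧ ForestCond F

namespace GirthRamsey

/-! ### Ears in walks through a family of blocks -/

/-- Two points lie in a common block. -/
def Co2 {V : Type} (B : Set (Set V)) (x y : V) : Prop := ∃ b ∈ B, x ∈ b ∧ y ∈ b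

/-- Three points lie in a common block. -/
def Co3 {V : Type} (B : Set (Set V)) (x y z : V) : Prop := ∃ b ∈ B, x ∈ b ∧ y ∈ b ∧ z ∈ b

lemma Co2.symm {V : Type} {B : Set (Set V)} {x y : V} (h : Co2 B x y) : Co2 B y x := by
  obtain ⟨b, hb, hx, hy⟩ := h
  exact ⟨b, hb, hy, hx⟩

lemma Co2.refl_left {V : Type} {B : Set (Set V)} {x y : V} (h : Co2 B x y) : Co2 B x x := by
  obtain ⟨b, hb, hx, hy⟩ := h
  exact ⟨b, hb, hx, hx⟩

lemma Co2.co3 {V : Type} {B : Set (Set V)} {x y : V} (h : Co2 B x y) : Co3 B x y x := by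
  obtain ⟨b, hb, hx, hy⟩ := h
  exact ⟨b, hb, hx, hy, hx⟩

lemma Co2.co3_left {V : Type} {B : Set (Set V)} {x y : V} (h : Co2 B x y) : Co3 B x x y := by
  obtain ⟨b, hb, hx, hy⟩ := h
  exact ⟨b, hb, hx, hx, hy⟩

lemma Co2.co3_right {V : Type} {B : Set (Set V)} {x y : V} (h : Co2 B x y) : Co3 B x y y := by
  obtain ⟨b, hb, hx, hy⟩ := h
  exact ⟨b, hb, hx, hy, hy⟩

/-- Every closed walk of length at most `M` whose steps lie in blocks has an ear: three
consecutive points in a common block. -/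
def Cyc {V : Type} (B : Set (Set V)) (M : ℕ) : Prop :=
  ∀ (n : ℕ) (x : ℕ → V), 1 ≤ n → n ≤ M → (∀ i, x (i + n) = x i) →
    (∀ i, Co2 B (x i) (x (i + 1))) → ∃ i, Co3 B (x i) (x (i + 1)) (x (i + 2))

/-- Every walk with at most `M` points whose steps lie in blocks and whose ends lie in a common
block has an interior ear. -/
def PathEar {V : Type} (B : Set (Set V)) (M : ℕ) : Prop :=
  ∀ (n : ℕ) (x : ℕ → V), 2 ≤ n → n + 1 ≤ M → (∀ i < n, Co2 B (x i) (x (i + 1))) →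
    Co2 B (x 0) (x n) → ∃ i, i + 2 ≤ n ∧ Co3 B (x i) (x (i + 1)) (x (i + 2))

lemma Co3.rotate {V : Type} {B : Set (Set V)} {x y z : V} (h : Co3 B x y z) : Co3 B y z x := by
  obtain ⟨b, hb, hx, hy, hz⟩ := h
  exact ⟨b, hb, hy, hz, hx⟩

lemma Cyc.pathEar {V : Type} {B : Set (Set V)} {M : ℕ} (h : Cyc B M) : PathEar B M := by
  intro n
  induction n with
  | zero => intro x h2; omega
  | succ n ih =>
    intro x h2 hM hs hc
    have hmod : ∀ i, ((i + 1) % (n + 2) = i % (n + 2) + 1 ∧ i % (n + 2) < n + 1) ∨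
        (i % (n + 2) = n + 1 ∧ (i + 1) % (n + 2) = 0) := by
      intro i
      have h1 : i % (n + 2) < n + 2 := Nat.mod_lt _ (by omega)
      have h3 : (i + 1) % (n + 2) = (i % (n + 2) + 1) % (n + 2) := by simp [Nat.add_mod]
      rcases Nat.lt_or_ge (i % (n + 2)) (n + 1) with h4 | h4
      · left
        rw [h3, Nat.mod_eq_of_lt (by omega)]
        exact ⟨rfl, h4⟩
      · right
        have h5 : i % (n + 2) = n + 1 := by omega
        refine ⟨h5, ?_⟩
        rw [h3, h5]
        exact Nat.mod_self _
    obtain ⟨i, hi⟩ := h (n + 2) (fun i => x (i % (n + 2))) (by omega) (by omega) (by simp) (by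
      intro i
      rcases hmod i with ⟨h1, h3⟩ | ⟨h1, h3⟩
      · simp only [h1]; exact hs _ h3
      · simp only [h1, h3]; exact hc.symm)
    have h1 := hmod i
    have h3 := hmod (i + 1)
    have e2 : i + 1 + 1 = i + 2 := rfl
    rw [e2] at h3
    generalize i % (n + 2) = p at *
    rcases h1 with ⟨h1, h4⟩ | ⟨h1, h4⟩
    · rcases h3 with ⟨h3, h5⟩ | ⟨h3, h5⟩
      · exact ⟨p, by omega, by rw [h3, h1] at hi; exact hi⟩
      · have hp : p = n := by omega
        rw [h5, h3, hp] at hi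
        rcases Nat.lt_or_ge n 2 with h6 | h6
        · have : n = 1 := by omega
          subst this
          exact ⟨0, by omega, hi.rotate.rotate⟩
        · obtain ⟨j, hj, hj'⟩ := ih x h6 (by omega) (fun i hi => hs i (by omega)) (by
            obtain ⟨b, hb, hx, hy, hz⟩ := hi
            exact ⟨b, hb, hz, hx⟩)
          exact ⟨j, by omega, hj'⟩
    · have h6 : (i + 2) % (n + 2) = 1 := by omega
      rw [h6, h4, h1] at hi
      rcases Nat.lt_or_ge n 2 with h6 | h6
      · have : n = 1 := by omega
        subst this
        exact ⟨0, by omega, hi.rotate⟩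
      · obtain ⟨j, hj, hj'⟩ := ih (fun i => x (i + 1)) h6 (by omega)
          (fun i hi => hs (i + 1) (by omega)) (by
            obtain ⟨b, hb, hx, hy, hz⟩ := hi
            exact ⟨b, hb, hz, hx⟩)
        exact ⟨j + 1, by omega, hj'⟩

lemma PathEar.cyc {V : Type} {B : Set (Set V)} {M : ℕ} (h : PathEar B M) : Cyc B M := by
  intro n x h1 hM hp hs
  rcases Nat.lt_or_ge n 3 with h3 | h3
  · refine ⟨0, ?_⟩
    have h2 : x 2 = x 0 := by
      interval_cases n
      · rw [← hp 0, ← hp (0 + 1)]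
      · exact hp 0
    show Co3 B (x 0) (x 1) (x 2)
    rw [h2]
    exact (hs 0).co3
  · obtain ⟨m, rfl⟩ : ∃ m, n = m + 1 := ⟨n - 1, by omega⟩
    obtain ⟨i, -, hi⟩ := h m x (by omega) hM (fun i _ => hs i) (by
      have := hs m
      rw [← Nat.zero_add (m + 1), ← add_assoc, Nat.zero_add] at this
      have h4 := hp 0
      rw [Nat.zero_add] at h4
      rw [h4] at this
      exact this.symm)
    exact ⟨i, hi⟩

lemma PathEar.mono {V : Type} {B : Set (Set V)} {M M' : ℕ} (h : PathEar B M) (hM : M' ≤ M) :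
    PathEar B M' :=
  fun n x h2 hn hs hc => h n x h2 (hn.trans hM) hs hc

/-! ### Decomposing walks into runs -/

/-- A labelled sequence splits into runs of constant label such that no two adjacent runs can be
merged. -/
lemma exists_min_runs {Q : Type*} (R : ℕ → Q → Prop) (n : ℕ) (hn : 1 ≤ n)
    (h : ∀ i < n, ∃ q, R i q) :
    ∃ (q : ℕ) (k : ℕ → ℕ) (w : ℕ → Q), 1 ≤ q ∧ k 0 = 0 ∧ k q = n ∧ (∀ j < q, k j < k (j + 1)) ∧
      (∀ j < q, ∀ i, k j ≤ i → i < k (j + 1) → R i (w j)) ∧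
      (∀ j, j + 1 < q → ∀ w', ∃ i, k j ≤ i ∧ i < k (j + 2) ∧ ¬ R i w') := by
  classical
  have hQ : Nonempty Q := ⟨(h 0 hn).choose⟩
  have hex : ∃ q : ℕ, ∃ (k : ℕ → ℕ) (w : ℕ → Q), 1 ≤ q ∧ k 0 = 0 ∧ k q = n ∧
      (∀ j < q, k j < k (j + 1)) ∧
      (∀ j < q, ∀ i, k j ≤ i → i < k (j + 1) → R i (w j)) := by
    refine ⟨n, id, fun i => if hi : i < n then (h i hi).choose else Classical.arbitrary Q, hn,
      rfl, rfl, fun j _ => Nat.lt_succ_self j, ?_⟩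
    intro j hj i hi hi'
    simp only [id] at hi hi'
    obtain rfl : i = j := by omega
    beta_reduce
    rw [dif_pos hj]
    exact (h i hj).choose_spec
  obtain ⟨k, w, h1, h2, h3, h4, h5⟩ := Nat.find_spec hex
  have hmin := fun m => @Nat.find_min _ _ hex m
  generalize Nat.find hex = q at *
  refine ⟨q, k, w, h1, h2, h3, h4, h5, ?_⟩
  intro j hj w'
  by_contra hcon
  push Not at hcon
  refine hmin (q - 1) (by omega) ⟨fun i => if i ≤ j then k i else k (i + 1),
    fun i => if i < j then w i else if i = j then w' else w (i + 1), by omega, ?_, ?_, ?_, ?_⟩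
  · simpa using h2
  · beta_reduce
    rw [if_neg (by omega), ← h3]; congr 1; omega
  · intro i hi
    have a1 := h4 i (by omega)
    have a2 := h4 (i + 1) (by omega)
    beta_reduce
    split_ifs <;> omega
  · intro i hi t ht ht'
    beta_reduce at ht ht' ⊢
    rcases lt_trichotomy i j with hij | hij | hij
    · rw [if_pos hij]
      rw [if_pos (by omega)] at ht ht'
      exact h5 i (by omega) t ht ht'
    · subst hij
      rw [if_neg (by omega), if_pos rfl]
      rw [if_pos le_rfl] at ht
      rw [if_neg (by omega)] at ht'
      exact hcon t ht ht'
    · rw [if_neg (by omega), if_neg (by omega)]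
      rw [if_neg (by omega)] at ht ht'
      exact h5 (i + 1) (by omega) t ht ht'

lemma runs_mono {q : ℕ} {k : ℕ → ℕ} (h : ∀ j < q, k j < k (j + 1)) {i j : ℕ} (hij : i < j)
    (hj : j ≤ q) : k i < k j := by
  induction j with
  | zero => omega
  | succ j ih =>
    rcases Nat.lt_or_ge i j with h1 | h1
    · exact (ih h1 (by omega)).trans (h j (by omega))
    · obtain rfl : i = j := by omega
      exact h i (by omega)

lemma runs_mono_le {q : ℕ} {k : ℕ → ℕ} (h : ∀ j < q, k j < k (j + 1)) {i j : ℕ} (hij : i ≤ j)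
    (hj : j ≤ q) : k i ≤ k j := by
  rcases hij.eq_or_lt with rfl | h1
  · exact le_rfl
  · exact (runs_mono h h1 hj).le

/-- A criterion for all steps of a walk to carry a common label. -/
lemma exists_common_label {Q : Type*} {V : Type} (St : Q → V → V → Prop) (X : Q → Set V)
    (n : ℕ) (hn : 1 ≤ n) (x : ℕ → V) (hst : ∀ i < n, ∃ q, St q (x i) (x (i + 1)))
    (hne : ∀ i < n, x i ≠ x (i + 1))
    (inner : ∀ i j q, i + 2 ≤ j → j ≤ n → j < i + n →
      (∀ t, i ≤ t → t < j → St q (x t) (x (t + 1))) →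
      x i ≠ x j ∧ ∀ q', x i ∈ X q' → x j ∈ X q' → q' = q)
    (single : ∀ q q' i, i < n → St q (x i) (x (i + 1)) → x i ∈ X q' → x (i + 1) ∈ X q' →
      St q' (x i) (x (i + 1)))
    (big : ∀ (q : ℕ) (k : ℕ → ℕ) (w : ℕ → Q), 2 ≤ q → k 0 = 0 → k q = n →
      (∀ j < q, k j < k (j + 1)) →
      (∀ j < q, ∀ i, k j ≤ i → i < k (j + 1) → St (w j) (x i) (x (i + 1))) →
      (∀ j < q, x (k j) ≠ x (k (j + 1))) →
      ∃ j g, j + 2 ≤ q ∧ x (k j) ∈ X g ∧ x (k (j + 1)) ∈ X g ∧ x (k (j + 2)) ∈ X g) :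
    ∃ q, ∀ i < n, St q (x i) (x (i + 1)) := by
  obtain ⟨q, k, w, h1, h2, h3, h4, h5, h6⟩ :=
    exists_min_runs (fun i q => St q (x i) (x (i + 1))) n hn hst
  rcases Nat.lt_or_ge q 2 with hq | hq
  · obtain rfl : q = 1 := by omega
    refine ⟨w 0, fun i hi => h5 0 (by omega) i (by omega) ?_⟩
    simpa [h3] using hi
  exfalso
  have hlt : ∀ j < q, k (j + 1) < k j + n := by
    intro j hj
    rcases Nat.lt_or_ge 0 j with hj0 | hj0
    · have a1 : k 0 < k j := runs_mono h4 hj0 hj.le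
      have a2 : k (j + 1) ≤ k q := runs_mono_le h4 hj le_rfl
      omega
    · obtain rfl : j = 0 := by omega
      have a2 : k (0 + 1) < k q := runs_mono h4 (by omega) le_rfl
      omega
  have hle : ∀ j < q, k (j + 1) ≤ n := by
    intro j hj
    have a2 : k (j + 1) ≤ k q := runs_mono_le h4 hj le_rfl
    omega
  have hdist : ∀ j < q, x (k j) ≠ x (k (j + 1)) := by
    intro j hj
    have a0 := h4 j hj
    rcases Nat.lt_or_ge (k j + 1) (k (j + 1)) with hl | hl
    · exact (inner (k j) (k (j + 1)) (w j) hl (hle j hj) (hlt j hj) (h5 j hj)).1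
    · have e : k (j + 1) = k j + 1 := by omega
      rw [e]
      exact hne _ (by have := hle j hj; omega)
  have hrun : ∀ j < q, ∀ g, x (k j) ∈ X g → x (k (j + 1)) ∈ X g →
      ∀ i, k j ≤ i → i < k (j + 1) → St g (x i) (x (i + 1)) := by
    intro j hj g hg hg' i hi hi'
    rcases Nat.lt_or_ge (k j + 1) (k (j + 1)) with hl | hl
    · have := (inner (k j) (k (j + 1)) (w j) hl (hle j hj) (hlt j hj) (h5 j hj)).2 g hg hg'
      rw [this]
      exact h5 j hj i hi hi'
    · have e : k (j + 1) = k j + 1 := by omega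
      obtain rfl : i = k j := by omega
      rw [e] at hg'
      exact single (w j) g _ (by have := hle j hj; omega) (h5 j hj _ hi hi') hg hg'
  obtain ⟨j, g, hj, g0, g1, g2⟩ := big q k w hq h2 h3 h4 h5 hdist
  obtain ⟨i, hi, hi', hi''⟩ := h6 j (by omega) g
  apply hi''
  rcases Nat.lt_or_ge i (k (j + 1)) with hl | hl
  · exact hrun j (by omega) g g0 g1 i hi hl
  · exact hrun (j + 1) (by omega) g g1 g2 i hl hi'

/-! ### Injective orderings refining a given one -/

lemma exists_injective_rank {U : Type} [Finite U] {L : Type*} [LinearOrder L] (key : U → L) :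
    ∃ ρ : U → ℕ, Function.Injective ρ ∧ ∀ x y, key x < key y → ρ x < ρ y := by
  classical
  have := Fintype.ofFinite U
  let e := Fintype.equivFin U
  let K : U → L ×ₗ Fin (Fintype.card U) := fun u => toLex (key u, e u)
  have hK : Function.Injective K := by
    intro a b hab
    have := congrArg (fun p => (ofLex p).2) hab
    exact e.injective this
  let ρ : U → ℕ := fun u => (Finset.univ.filter (fun v => K v < K u)).card
  have hlt : ∀ x y, K x < K y → ρ x < ρ y := by
    intro x y hxy
    apply Finset.card_lt_card
    rw [Finset.ssubset_iff_of_subset]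
    · exact ⟨x, by simpa using hxy, by simp⟩
    · intro z hz
      simp only [Finset.mem_filter, Finset.mem_univ, true_and] at hz ⊢
      exact hz.trans hxy
  refine ⟨ρ, ?_, ?_⟩
  · intro a b hab
    by_contra hne
    rcases lt_or_gt_of_ne (fun h => hne (hK h)) with h | h
    · exact absurd hab (hlt _ _ h).ne
    · exact absurd hab (hlt _ _ h).ne'
  · intro x y hxy
    apply hlt
    rw [Prod.Lex.toLex_lt_toLex]
    exact Or.inl hxy

/-! ### Permutation representations of free groups -/

lemma lift_apply_mem {S X : Type} (σ : S → Equiv.Perm X) {Z : Set X}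
    (τ : S → Equiv.Perm Z)
    (hτ : ∀ s z, ((τ s z : Z) : X) = σ s z) (w : FreeGroup S) :
    ∀ z : Z, ((FreeGroup.lift τ w z : Z) : X) = FreeGroup.lift σ w z := by
  induction w using FreeGroup.induction_on with
  | C1 => intro z; simp
  | of s => intro z; simpa using hτ s z
  | inv_of s _ =>
    intro z
    simp only [map_inv, FreeGroup.lift_apply_of]
    rw [Equiv.Perm.eq_inv_iff_eq, ← hτ]
    simp
  | mul x y hx hy =>
    intro z
    simp only [map_mul, Equiv.Perm.mul_apply]
    rw [hx, hy]

/-- An action of a free group restricted to a finite invariant set can be transported to a set of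
prescribed size. -/
lemma exists_restrict {S X : Type} (σ : S → Equiv.Perm X) (Z : Set X) (hf : Z.Finite) (K : ℕ)
    (hK : Z.ncard ≤ K) (hZ : ∀ s, ∀ z ∈ Z, σ s z ∈ Z) :
    ∃ σ' : S → Equiv.Perm (Fin K), ∀ w : FreeGroup S,
      FreeGroup.lift σ' w = 1 ↔ ∀ z ∈ Z, FreeGroup.lift σ w z = z := by
  classical
  have hiff : ∀ s, ∀ z, z ∈ Z ↔ σ s z ∈ Z := by
    intro s z
    refine ⟨hZ s z, fun h => ?_⟩
    have hs : σ s '' Z = Z := Set.eq_of_subset_of_ncard_le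
      (Set.image_subset_iff.2 (hZ s)) (Set.ncard_image_of_injective _ (σ s).injective).ge hf
    rw [← hs] at h
    obtain ⟨a, ha, h'⟩ := h
    rwa [← (σ s).injective h']
  let τ : S → Equiv.Perm Z := fun s => (σ s).subtypePerm (fun z => (hiff s z).symm)
  have hτ : ∀ s z, ((τ s z : Z) : X) = σ s z := fun s z => rfl
  have := hf.to_subtype
  have : Fintype Z := Fintype.ofFinite Z
  have hc : Fintype.card Z ≤ Fintype.card (Fin K) := by
    rw [Fintype.card_fin, ← Nat.card_eq_fintype_card, Nat.card_coe_set_eq]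
    exact hK
  obtain ⟨f⟩ := Function.Embedding.nonempty_of_card_le hc
  refine ⟨fun s => (τ s).viaEmbedding f, fun w => ?_⟩
  have h1 : FreeGroup.lift (fun s => (τ s).viaEmbedding f) w
      = Equiv.Perm.viaEmbeddingHom f (FreeGroup.lift τ w) := by
    have : FreeGroup.lift (fun s => (τ s).viaEmbedding f)
        = (Equiv.Perm.viaEmbeddingHom f).comp (FreeGroup.lift τ) := by
      ext s : 1
      simp [Equiv.Perm.viaEmbeddingHom_apply]
    rw [this]; rfl
  rw [h1, map_eq_one_iff _ (Equiv.Perm.viaEmbeddingHom_injective f)]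
  constructor
  · intro h z hz
    have := lift_apply_mem σ τ hτ w ⟨z, hz⟩
    rw [h] at this
    exact this.symm
  · intro h
    ext z
    rw [lift_apply_mem σ τ hτ w z]
    exact h z z.2

/-- The universal group generated by permutations of `Fin K` subject to a condition `P`. -/
abbrev UG {S : Type} (K : ℕ) (P : (S → Equiv.Perm (Fin K)) → Prop) : Type :=
  {σ : S → Equiv.Perm (Fin K) // P σ} → Equiv.Perm (Fin K)

/-- The canonical generators of the universal group. -/
def ugen {S : Type} {K : ℕ} (P : (S → Equiv.Perm (Fin K)) → Prop) (s : S) : UG K P :=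
  fun σ => σ.1 s

lemma lift_ugen {S : Type} {K : ℕ} (P : (S → Equiv.Perm (Fin K)) → Prop) (w : FreeGroup S)
    (σ : {σ : S → Equiv.Perm (Fin K) // P σ}) :
    FreeGroup.lift (ugen P) w σ = FreeGroup.lift σ.1 w := by
  have : (Pi.evalMonoidHom _ σ).comp (FreeGroup.lift (ugen P)) = FreeGroup.lift σ.1 := by
    ext s : 1
    simp [ugen]
  exact DFunLike.congr_fun this w

lemma ugen_fix {S X : Type} {K : ℕ} (P : (S → Equiv.Perm (Fin K)) → Prop)
    (σ : S → Equiv.Perm X) (Z : Set X) (hf : Z.Finite) (hK : Z.ncard ≤ K)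
    (hZ : ∀ s, ∀ z ∈ Z, σ s z ∈ Z)
    (hP : ∀ σ' : S → Equiv.Perm (Fin K), (∀ w : FreeGroup S,
      FreeGroup.lift σ' w = 1 ↔ ∀ z ∈ Z, FreeGroup.lift σ w z = z) → P σ')
    (w : FreeGroup S) (hw : FreeGroup.lift (ugen P) w = 1) : ∀ z ∈ Z, FreeGroup.lift σ w z = z := by
  obtain ⟨σ', h⟩ := exists_restrict σ Z hf K hK hZ
  rw [← h, ← lift_ugen P w ⟨σ', hP σ' h⟩, hw]
  rfl

lemma ugen_fix_of_pow {S X : Type} {K D : ℕ} (σ : S → Equiv.Perm X) (hσ : ∀ s, σ s ^ D = 1)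
    (α : Set S) (Z : Set X) (hf : Z.Finite) (hK : Z.ncard ≤ K)
    (hZ : ∀ s ∈ α, ∀ z ∈ Z, σ s z ∈ Z) (w : FreeGroup S)
    (hα : w ∈ Subgroup.closure (FreeGroup.of '' α))
    (hw : FreeGroup.lift (ugen (fun σ : S → Equiv.Perm (Fin K) => ∀ s, σ s ^ D = 1)) w = 1) :
    ∀ z ∈ Z, FreeGroup.lift σ w z = z := by
  classical
  let σ1 : S → Equiv.Perm X := fun s => if s ∈ α then σ s else 1
  have h1 : FreeGroup.lift σ w = FreeGroup.lift σ1 w := by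
    refine MonoidHom.eqOn_closure (f := FreeGroup.lift σ) (g := FreeGroup.lift σ1) ?_ hα
    rintro _ ⟨s, hs, rfl⟩
    simp [σ1, hs]
  rw [h1]
  refine ugen_fix _ σ1 Z hf hK ?_ ?_ w hw
  · intro s z hz
    by_cases hs : s ∈ α
    · simpa [σ1, hs] using hZ s hs z hz
    · simpa [σ1, hs] using hz
  · intro σ' h s
    have h2 := (h (FreeGroup.of s ^ D)).2 (fun z _ => by
      have : σ1 s ^ D = 1 := by
        by_cases hs : s ∈ α
        · simp [σ1, hs, hσ]
        · simp [σ1, hs]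
      simp [this])
    simpa using h2

lemma exists_word {S H : Type} [Group H] (b : S → H) (α : Set S) {h : H}
    (hh : h ∈ Subgroup.closure (b '' α)) :
    ∃ w ∈ Subgroup.closure (FreeGroup.of '' α), FreeGroup.lift b w = h := by
  have : b '' α = FreeGroup.lift b '' (FreeGroup.of '' α) := by
    rw [← Set.image_comp]
    congr 1
    ext s
    simp
  rw [this, ← MonoidHom.map_closure] at hh
  exact hh

lemma lift_mem_closure {S H : Type} [Group H] (b : S → H) (α : Set S) {w : FreeGroup S}
    (hw : w ∈ Subgroup.closure (FreeGroup.of '' α)) :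
    FreeGroup.lift b w ∈ Subgroup.closure (b '' α) := by
  have : b '' α = FreeGroup.lift b '' (FreeGroup.of '' α) := by
    rw [← Set.image_comp]
    congr 1
    ext s
    simp
  rw [this, ← MonoidHom.map_closure]
  exact Subgroup.mem_map_of_mem _ hw

/-! ### Chains of glued sheets -/

section Chain

variable {S V H : Type} [Group H]

/-- The points along which the sheets `j` and `j + 1` of a chain are glued. -/
def glue (I : S → V → Prop) (b : S → H) (v : ℕ → V) (e : ℕ → H) (j : ℕ) : Set H :=
  {u | u * (e j)⁻¹ ∈ Subgroup.closure (b '' {s | I s (v j) ∧ I s (v (j + 1))})}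

open Classical in
/-- The canonical representative of a point of a chain. -/
noncomputable def chainNorm (I : S → V → Prop) (b : S → H) (v : ℕ → V) (e : ℕ → H)
    (p : ℕ × H) : ℕ × H :=
  if 1 ≤ p.1 ∧ p.2 ∈ glue I b v e (p.1 - 1) then (p.1 - 1, p.2) else p

open Classical in
/-- The action of a letter on the points of a chain. -/
noncomputable def chainAct (I : S → V → Prop) (b : S → H) (v : ℕ → V) (e : ℕ → H) (n : ℕ)
    (s : S) (h : H) (p : ℕ × H) : ℕ × H :=
  if p.1 ≤ n ∧ chainNorm I b v e p = p then
    if I s (v p.1) then chainNorm I b v e (p.1, h * p.2)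
    else if p.1 < n ∧ p.2 ∈ glue I b v e p.1 ∧ I s (v (p.1 + 1)) then
      chainNorm I b v e (p.1 + 1, h * p.2)
    else p
  else p

variable {I : S → V → Prop} {b : S → H} {v : ℕ → V} {e : ℕ → H} {n : ℕ}

lemma chainNorm_of_mem {j : ℕ} {u : H} (h : u ∈ glue I b v e j) :
    chainNorm I b v e (j + 1, u) = (j, u) := by
  simp [chainNorm, h]

lemma chainNorm_of_notMem {j : ℕ} {u : H} (h : u ∉ glue I b v e j) :
    chainNorm I b v e (j + 1, u) = (j + 1, u) := by
  simp [chainNorm, h]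

lemma chainNorm_zero {u : H} : chainNorm I b v e (0, u) = (0, u) := by
  simp [chainNorm]

lemma chainNorm_of_glue (hdis : ∀ j u, j + 1 < n → u ∈ glue I b v e j → u ∉ glue I b v e (j + 1))
    {j : ℕ} {u : H} (hj : j < n) (h : u ∈ glue I b v e j) :
    chainNorm I b v e (j, u) = (j, u) := by
  cases j with
  | zero => exact chainNorm_zero
  | succ j => exact chainNorm_of_notMem (fun h' => hdis j u hj h' h)

lemma chainNorm_fst_le {j : ℕ} {u : H} : (chainNorm I b v e (j, u)).1 ≤ j := by
  unfold chainNorm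
  split_ifs
  · exact Nat.sub_le _ _
  · exact le_rfl

lemma le_chainNorm_fst {j : ℕ} {u : H} : j ≤ (chainNorm I b v e (j, u)).1 + 1 := by
  unfold chainNorm
  split_ifs <;> simp only <;> omega

lemma chainNorm_snd {p : ℕ × H} : (chainNorm I b v e p).2 = p.2 := by
  unfold chainNorm
  split_ifs <;> rfl

lemma glue_mul_mem {j : ℕ} {u h : H}
    (hh : h ∈ Subgroup.closure (b '' {s | I s (v j) ∧ I s (v (j + 1))})) :
    h * u ∈ glue I b v e j ↔ u ∈ glue I b v e j := by
  unfold glue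
  simp only [Set.mem_ofPred_eq, mul_assoc]
  exact Subgroup.mul_mem_cancel_left _ hh

lemma zpowers_le_closure {s : S} {α : Set S} (hs : s ∈ α) {h : H}
    (hh : h ∈ Subgroup.zpowers (b s)) : h ∈ Subgroup.closure (b '' α) := by
  obtain ⟨k, rfl⟩ := hh
  exact Subgroup.zpow_mem _ (Subgroup.subset_closure (Set.mem_image_of_mem b hs)) k

lemma chainAct_norm (hdis : ∀ j u, j + 1 < n → u ∈ glue I b v e j → u ∉ glue I b v e (j + 1))
    {j : ℕ} {u : H} (hj : j ≤ n) {s : S} (hs : I s (v j)) {h : H}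
    (hh : h ∈ Subgroup.zpowers (b s)) :
    chainAct I b v e n s h (chainNorm I b v e (j, u)) = chainNorm I b v e (j, h * u) := by
  have base : chainNorm I b v e (j, u) = (j, u) →
      chainAct I b v e n s h (chainNorm I b v e (j, u)) = chainNorm I b v e (j, h * u) := by
    intro hx
    rw [hx]
    unfold chainAct
    rw [if_pos ⟨hj, hx⟩, if_pos hs]
  cases j with
  | zero => exact base chainNorm_zero
  | succ j =>
    by_cases hu : u ∈ glue I b v e j
    · have hx : chainNorm I b v e (j, u) = (j, u) := chainNorm_of_glue hdis (by omega) hu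
      rw [chainNorm_of_mem hu]
      unfold chainAct
      rw [if_pos ⟨by simp only; omega, hx⟩]
      simp only
      by_cases hs' : I s (v j)
      · have hm : h * u ∈ glue I b v e j :=
          (glue_mul_mem (zpowers_le_closure (α := {s | I s (v j) ∧ I s (v (j + 1))}) ⟨hs', hs⟩ hh)).2 hu
        rw [if_pos hs', chainNorm_of_mem hm, chainNorm_of_glue hdis (by omega) hm]
      · rw [if_neg hs', if_pos ⟨by omega, hu, hs⟩]
    · exact base (chainNorm_of_notMem hu)

/-- A point is either fixed by a letter, or it has a representative on a sheet on which the letter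
acts by multiplication. -/
lemma chainAct_cases (s : S) (p : ℕ × H) :
    (∀ h, chainAct I b v e n s h p = p) ∨
      ∃ j u, j ≤ n ∧ I s (v j) ∧ p = chainNorm I b v e (j, u) := by
  by_cases h1 : p.1 ≤ n ∧ chainNorm I b v e p = p
  · by_cases h2 : I s (v p.1)
    · exact Or.inr ⟨p.1, p.2, h1.1, h2, h1.2.symm⟩
    · by_cases h3 : p.1 < n ∧ p.2 ∈ glue I b v e p.1 ∧ I s (v (p.1 + 1))
      · exact Or.inr ⟨p.1 + 1, p.2, h3.1, h3.2.2, (chainNorm_of_mem h3.2.1).symm⟩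
      · left
        intro h
        unfold chainAct
        rw [if_pos h1, if_neg h2, if_neg h3]
  · left
    intro h
    unfold chainAct
    rw [if_neg h1]

lemma chainAct_inv (hdis : ∀ j u, j + 1 < n → u ∈ glue I b v e j → u ∉ glue I b v e (j + 1))
    (s : S) {h : H} (hh : h ∈ Subgroup.zpowers (b s)) (p : ℕ × H) :
    chainAct I b v e n s h⁻¹ (chainAct I b v e n s h p) = p := by
  rcases chainAct_cases (I := I) (b := b) (v := v) (e := e) (n := n) s p with h1 | ⟨j, u, hj, hs, rfl⟩
  · rw [h1, h1]
  · rw [chainAct_norm hdis hj hs hh, chainAct_norm hdis hj hs (inv_mem hh), inv_mul_cancel_left]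

/-- The permutation action of the letters on the points of a chain. -/
noncomputable def chainPerm
    (hdis : ∀ j u, j + 1 < n → u ∈ glue I b v e j → u ∉ glue I b v e (j + 1)) (s : S) :
    Equiv.Perm (ℕ × H) where
  toFun := chainAct I b v e n s (b s)
  invFun := chainAct I b v e n s (b s)⁻¹
  left_inv := chainAct_inv hdis s (Subgroup.mem_zpowers _)
  right_inv p := by
    have := chainAct_inv hdis s (inv_mem (Subgroup.mem_zpowers (b s))) p
    rwa [inv_inv] at this

lemma chainPerm_norm
    (hdis : ∀ j u, j + 1 < n → u ∈ glue I b v e j → u ∉ glue I b v e (j + 1))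
    {j : ℕ} (hj : j ≤ n) {s : S} (hs : I s (v j)) (u : H) :
    chainPerm hdis s (chainNorm I b v e (j, u)) = chainNorm I b v e (j, b s * u) :=
  chainAct_norm hdis hj hs (Subgroup.mem_zpowers _)

lemma chainPerm_cases
    (hdis : ∀ j u, j + 1 < n → u ∈ glue I b v e j → u ∉ glue I b v e (j + 1))
    (s : S) (p : ℕ × H) :
    chainPerm hdis s p = p ∨
      ∃ j u, j ≤ n ∧ I s (v j) ∧ p = chainNorm I b v e (j, u) := by
  rcases chainAct_cases (I := I) (b := b) (v := v) (e := e) (n := n) s p with h1 | h1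
  · exact Or.inl (h1 _)
  · exact Or.inr h1

lemma chainPerm_pow
    (hdis : ∀ j u, j + 1 < n → u ∈ glue I b v e j → u ∉ glue I b v e (j + 1))
    {D : ℕ} (hb : ∀ s, b s ^ D = 1) (s : S) : chainPerm hdis s ^ D = 1 := by
  ext1 p
  rcases chainPerm_cases hdis s p with h1 | ⟨j, u, hj, hs, rfl⟩
  · have : ∀ k : ℕ, (chainPerm hdis s ^ k) p = p := by
      intro k
      induction k with
      | zero => rfl
      | succ k ih => rw [pow_succ, Equiv.Perm.mul_apply, h1, ih]
    exact this D
  · have : ∀ k : ℕ, (chainPerm hdis s ^ k) (chainNorm I b v e (j, u))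
        = chainNorm I b v e (j, b s ^ k * u) := by
      intro k
      induction k with
      | zero => simp
      | succ k ih =>
        rw [pow_succ', Equiv.Perm.mul_apply, ih, chainPerm_norm hdis hj hs, pow_succ', mul_assoc]
    rw [this D, hb]
    simp

lemma chainPerm_word
    (hdis : ∀ j u, j + 1 < n → u ∈ glue I b v e j → u ∉ glue I b v e (j + 1))
    {j : ℕ} (hj : j ≤ n) {w : FreeGroup S}
    (hw : w ∈ Subgroup.closure (FreeGroup.of '' {s | I s (v j)})) :
    ∀ u : H, FreeGroup.lift (chainPerm hdis) w (chainNorm I b v e (j, u))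
      = chainNorm I b v e (j, FreeGroup.lift b w * u) := by
  induction hw using Subgroup.closure_induction with
  | mem x hx =>
    obtain ⟨s, hs, rfl⟩ := hx
    intro u
    simpa using chainPerm_norm hdis hj hs u
  | one => intro u; simp
  | mul x y _ _ hx hy =>
    intro u
    simp only [map_mul, Equiv.Perm.mul_apply]
    rw [hy, hx, mul_assoc]
  | inv x _ hx =>
    intro u
    rw [map_inv, Equiv.Perm.inv_eq_iff_eq, hx, map_inv, mul_inv_cancel_left]

/-! ### Orbits in a chain -/

/-- Compatible cosets along a chain of subgroups. -/
lemma exists_coset_chain (C E : ℕ → Subgroup H) (e : ℕ → H) (n : ℕ)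
    (hCE : ∀ t < n, ∀ h ∈ E t, h ∈ C t ↔ h ∈ C (t + 1)) (i : ℕ) (hi : i ≤ n) (u : H) :
    ∃ Z : ℕ → Set H, u ∈ Z i ∧
      (∀ t ≤ n, ∀ x ∈ Z t, ∀ y, y ∈ Z t ↔ y * x⁻¹ ∈ C t) ∧
      (∀ t < n, ∀ x, x * (e t)⁻¹ ∈ E t → (x ∈ Z t ↔ x ∈ Z (t + 1))) := by
  classical
  have coset : ∀ (D : Subgroup H) (a : H), ∀ x, x * a⁻¹ ∈ D → ∀ y, y * a⁻¹ ∈ D ↔ y * x⁻¹ ∈ D := by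
    intro D a x hx y
    have : y * a⁻¹ = (y * x⁻¹) * (x * a⁻¹) := by group
    rw [this]
    exact Subgroup.mul_mem_cancel_right _ hx
  induction n generalizing i u with
  | zero =>
    obtain rfl : i = 0 := by omega
    refine ⟨fun _ => {y | y * u⁻¹ ∈ C 0}, by simp, ?_, by omega⟩
    intro t ht
    obtain rfl : t = 0 := by omega
    exact coset _ _
  | succ n ih =>
    have hCE' : ∀ t < n, ∀ h ∈ E t, h ∈ C t ↔ h ∈ C (t + 1) := fun t ht => hCE t (by omega)
    have key : ∀ a x : H, a * (e n)⁻¹ ∈ E n → x * (e n)⁻¹ ∈ E n →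
        (x * a⁻¹ ∈ C n ↔ x * a⁻¹ ∈ C (n + 1)) := by
      intro a x ha hx
      apply hCE n (by omega)
      rwa [← coset _ _ _ ha]
    have ext : ∀ (Z : ℕ → Set H) (W : Set H), (∀ t ≤ n, ∀ x ∈ Z t, ∀ y, y ∈ Z t ↔ y * x⁻¹ ∈ C t) →
        (∀ t < n, ∀ x, x * (e t)⁻¹ ∈ E t → (x ∈ Z t ↔ x ∈ Z (t + 1))) →
        (∀ x ∈ W, ∀ y, y ∈ W ↔ y * x⁻¹ ∈ C (n + 1)) →
        (∀ x, x * (e n)⁻¹ ∈ E n → (x ∈ Z n ↔ x ∈ W)) →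
        (∀ t ≤ n + 1, ∀ x ∈ Function.update Z (n + 1) W t,
          ∀ y, y ∈ Function.update Z (n + 1) W t ↔ y * x⁻¹ ∈ C t) ∧
        (∀ t < n + 1, ∀ x, x * (e t)⁻¹ ∈ E t → (x ∈ Function.update Z (n + 1) W t ↔
          x ∈ Function.update Z (n + 1) W (t + 1))) := by
      intro Z W h1 h2 h3 h4
      constructor
      · intro t ht
        rcases ht.eq_or_lt with rfl | ht'
        · simpa using h3
        · rw [Function.update_of_ne (by omega)]
          exact h1 t (by omega)
      · intro t ht
        rcases (Nat.lt_succ_iff.1 ht).eq_or_lt with rfl | ht'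
        · rw [Function.update_of_ne (by omega), Function.update_self]
          exact h4
        · rw [Function.update_of_ne (by omega), Function.update_of_ne (by omega)]
          exact h2 t ht'
    rcases hi.eq_or_lt with rfl | hi'
    · by_cases hex : ∃ a, a * u⁻¹ ∈ C (n + 1) ∧ a * (e n)⁻¹ ∈ E n
      · obtain ⟨a, ha, ha'⟩ := hex
        obtain ⟨Z, hZ, h1, h2⟩ := ih hCE' n le_rfl a
        refine ⟨Function.update Z (n + 1) {y | y * u⁻¹ ∈ C (n + 1)}, by simp,
          ext Z _ h1 h2 (coset _ _) ?_⟩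
        intro x hx
        rw [h1 n le_rfl a hZ, key a x ha' hx]
        exact (coset _ _ a ha x).symm
      · refine ⟨Function.update (fun _ => ∅) (n + 1) {y | y * u⁻¹ ∈ C (n + 1)}, by simp,
          ext _ _ (by simp) (by simp) (coset _ _) ?_⟩
        intro x hx
        simp only [Set.mem_empty_iff_false, false_iff]
        exact fun h => hex ⟨x, h, hx⟩
    · obtain ⟨Z, hZ, h1, h2⟩ := ih hCE' i (by omega) u
      by_cases hex : ∃ a, a ∈ Z n ∧ a * (e n)⁻¹ ∈ E n
      · obtain ⟨a, ha, ha'⟩ := hex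
        refine ⟨Function.update Z (n + 1) {y | y * a⁻¹ ∈ C (n + 1)}, ?_,
          ext Z _ h1 h2 (coset _ _) ?_⟩
        · rwa [Function.update_of_ne (by omega)]
        · intro x hx
          rw [h1 n le_rfl a ha, key a x ha' hx]
          rfl
      · refine ⟨Function.update Z (n + 1) ∅, ?_, ext Z _ h1 h2 (by simp) ?_⟩
        · rwa [Function.update_of_ne (by omega)]
        · intro x hx
          simp only [Set.mem_empty_iff_false, iff_false]
          exact fun h => hex ⟨x, h, hx⟩

end Chain

section Orbit

variable {S V H : Type} [Group H] {I : S → V → Prop} {b : S → H} {v : ℕ → V} {e : ℕ → H} {n : ℕ}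

lemma chainNorm_eq_imp {j j' : ℕ} {u u' : H}
    (h : chainNorm I b v e (j, u) = chainNorm I b v e (j', u')) :
    u = u' ∧ (j = j' ∨ (j' = j + 1 ∧ u ∈ glue I b v e j) ∨ (j = j' + 1 ∧ u ∈ glue I b v e j')) := by
  have h2 : u = u' := by
    have := congrArg Prod.snd h
    rwa [chainNorm_snd, chainNorm_snd] at this
  subst h2
  refine ⟨rfl, ?_⟩
  have h1 := congrArg Prod.fst h
  by_cases hj : 1 ≤ j ∧ u ∈ glue I b v e (j - 1) <;>
    by_cases hj' : 1 ≤ j' ∧ u ∈ glue I b v e (j' - 1)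
  · simp only [chainNorm, if_pos hj, if_pos hj'] at h1
    left; omega
  · simp only [chainNorm, if_pos hj, if_neg hj'] at h1
    right; right
    exact ⟨by omega, by rw [← h1]; exact hj.2⟩
  · simp only [chainNorm, if_neg hj, if_pos hj'] at h1
    right; left
    exact ⟨by omega, by rw [h1]; exact hj'.2⟩
  · simp only [chainNorm, if_neg hj, if_neg hj'] at h1
    left; omega

lemma mem_closure_common (hI : ∀ x y s t, x ≠ y → I s x → I s y → I t x → I t y → s = t)
    {p q : V} (hpq : p ≠ q) {h : H} (hh : h ∈ Subgroup.closure (b '' {s | I s p ∧ I s q})) :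
    h = 1 ∨ ∃ s, I s p ∧ I s q ∧ h ∈ Subgroup.zpowers (b s) := by
  by_cases hex : ∃ s, I s p ∧ I s q
  · obtain ⟨s, hp, hq⟩ := hex
    right
    refine ⟨s, hp, hq, ?_⟩
    have : b '' {s | I s p ∧ I s q} = {b s} := by
      ext x
      constructor
      · rintro ⟨t, ⟨ht, ht'⟩, rfl⟩
        rw [hI p q t s hpq ht ht' hp hq]
        rfl
      · rintro rfl
        exact ⟨s, ⟨hp, hq⟩, rfl⟩
    rwa [this, ← Subgroup.zpowers_eq_closure] at hh
  · left
    have : b '' {s | I s p ∧ I s q} = ∅ := by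
      ext x
      simp only [Set.mem_image, Set.mem_empty_iff_false, iff_false]
      rintro ⟨t, ht, -⟩
      exact hex ⟨t, ht⟩
    rw [this, Subgroup.closure_empty] at hh
    exact hh

lemma closure_common_trans (hI : ∀ x y s t, x ≠ y → I s x → I s y → I t x → I t y → s = t)
    (hz : ∀ s t, s ≠ t → ∀ h, h ∈ Subgroup.zpowers (b s) → h ∈ Subgroup.zpowers (b t) → h = 1)
    {p q r : V} (hqr : q ≠ r) {h : H} (hh : h ∈ Subgroup.closure (b '' {s | I s q ∧ I s r}))
    (hh' : h ∈ Subgroup.closure (b '' {s | I s p ∧ I s q})) :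
    h ∈ Subgroup.closure (b '' {s | I s p ∧ I s r}) := by
  by_cases hpq : p = q
  · subst hpq; exact hh
  rcases mem_closure_common hI hqr hh with rfl | ⟨s, hs, hs', hs2⟩
  · exact one_mem _
  rcases mem_closure_common hI hpq hh' with rfl | ⟨t, ht, ht', ht2⟩
  · exact one_mem _
  by_cases hst : s = t
  · subst hst
    exact zpowers_le_closure (α := {s | I s p ∧ I s r}) ⟨ht, hs'⟩ hs2
  · rw [hz s t hst h hs2 ht2]
    exact one_mem _

lemma exists_pow_of_mem_zpowers {D : ℕ} (hD : 1 ≤ D) {c h : H} (hc : c ^ D = 1)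
    (hh : h ∈ Subgroup.zpowers c) : ∃ k : Fin D, h = c ^ (k : ℕ) := by
  obtain ⟨i, rfl⟩ := hh
  have hD' : (D : ℤ) ≠ 0 := by positivity
  have h1 : 0 ≤ i % D := Int.emod_nonneg _ hD'
  have h2 : i % D < D := Int.emod_lt_of_pos _ (by positivity)
  refine ⟨⟨(i % D).toNat, by omega⟩, ?_⟩
  rw [← zpow_natCast, Int.toNat_of_nonneg h1]
  conv_lhs => rw [← Int.mul_ediv_add_emod i D]
  simp [zpow_add, zpow_mul, hc]

/-- Words trivial in the sheet group act trivially on a chain. -/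
lemma chainPerm_word_eq_one
    (hI : ∀ x y s t, x ≠ y → I s x → I s y → I t x → I t y → s = t)
    (hz : ∀ s t, s ≠ t → ∀ h, h ∈ Subgroup.zpowers (b s) → h ∈ Subgroup.zpowers (b t) → h = 1)
    {D : ℕ} (hD : 1 ≤ D) (hb : ∀ s, b s ^ D = 1) (hne : ∀ j < n, v j ≠ v (j + 1))
    (hdis : ∀ j u, j + 1 < n → u ∈ glue I b v e j → u ∉ glue I b v e (j + 1))
    (v0 : V) (w : FreeGroup S) (hw : w ∈ Subgroup.closure (FreeGroup.of '' {s | I s v0}))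
    (hw1 : FreeGroup.lift b w = 1)
    (hfix : ∀ Z : Set (ℕ × H), Z.Finite → Z.ncard ≤ (n + 1) * D →
      (∀ s ∈ {s | I s v0}, ∀ z ∈ Z, chainPerm hdis s z ∈ Z) →
      ∀ z ∈ Z, FreeGroup.lift (chainPerm hdis) w z = z) :
    FreeGroup.lift (chainPerm hdis) w = 1 := by
  ext1 x
  by_cases hA : ∃ j u, j ≤ n ∧ v j = v0 ∧ x = chainNorm I b v e (j, u)
  · obtain ⟨j, u, hj, rfl, rfl⟩ := hA
    rw [chainPerm_word hdis hj hw, hw1]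
    simp
  by_cases hL : ∃ j u, j ≤ n ∧ x = chainNorm I b v e (j, u)
  swap
  · refine hfix {x} (Set.finite_singleton x) ?_ ?_ x rfl
    · rw [Set.ncard_singleton]
      nlinarith
    · rintro s - z rfl
      rcases chainPerm_cases hdis s z with h | ⟨j, u, hj, -, h⟩
      · exact h
      · exact absurd ⟨j, u, hj, h⟩ hL
  obtain ⟨i, u0, hi, hx⟩ := hL
  obtain ⟨Z, hZ, h1, h2⟩ := exists_coset_chain
    (fun t => Subgroup.closure (b '' {s | I s v0 ∧ I s (v t)}))
    (fun t => Subgroup.closure (b '' {s | I s (v t) ∧ I s (v (t + 1))})) e n (by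
      intro t ht h hh
      constructor
      · exact closure_common_trans hI hz (hne t ht) hh
      · refine closure_common_trans hI hz (hne t ht).symm ?_
        have : {s | I s (v (t + 1)) ∧ I s (v t)} = {s | I s (v t) ∧ I s (v (t + 1))} := by
          ext s; exact and_comm
        rwa [this]) i hi u0
  let T : Set (ℕ × H) := {p | (∃ j u, j ≤ n ∧ u ∈ Z j ∧ p = chainNorm I b v e (j, u)) ∧
    ∃ w' ∈ Subgroup.closure (FreeGroup.of '' {s | I s v0}), FreeGroup.lift (chainPerm hdis) w' x = p}
  have hcov : ∀ j, ∃ c u : H, j ≤ n → v j ≠ v0 → ∀ y ∈ Z j, ∃ k : Fin D, y = c ^ (k : ℕ) * u := by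
    intro j
    by_cases hj : j ≤ n ∧ v j ≠ v0 ∧ ∃ u, u ∈ Z j
    · obtain ⟨hj, hv, u, hu⟩ := hj
      by_cases hs : ∃ s, I s v0 ∧ I s (v j)
      · obtain ⟨s, hs, hs'⟩ := hs
        refine ⟨b s, u, fun _ _ y hy => ?_⟩
        have h3 := (h1 j hj u hu y).1 hy
        have h4 : y * u⁻¹ ∈ Subgroup.zpowers (b s) := by
          rcases mem_closure_common hI hv.symm h3 with h5 | ⟨t, ht, ht', h5⟩
          · rw [h5]; exact one_mem _
          · rwa [hI v0 (v j) s t hv.symm hs hs' ht ht']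
        obtain ⟨k, hk⟩ := exists_pow_of_mem_zpowers hD (hb s) h4
        exact ⟨k, by rw [← hk]; group⟩
      · refine ⟨1, u, fun _ _ y hy => ?_⟩
        have h3 := (h1 j hj u hu y).1 hy
        rcases mem_closure_common hI hv.symm h3 with h5 | ⟨t, ht, ht', h5⟩
        · refine ⟨⟨0, hD⟩, ?_⟩
          rw [mul_inv_eq_one] at h5
          simp [h5]
        · exact absurd ⟨t, ht, ht'⟩ hs
    · refine ⟨1, 1, fun h3 h4 y hy => absurd ⟨h3, h4, y, hy⟩ hj⟩
  choose c u hcu using hcov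
  let f : Fin (n + 1) × Fin D → ℕ × H :=
    fun p => chainNorm I b v e ((p.1 : ℕ), c p.1 ^ (p.2 : ℕ) * u p.1)
  have hTf : T ⊆ Set.range f := by
    rintro p ⟨⟨j, y, hj, hy, rfl⟩, w', hw', hp⟩
    have hv : v j ≠ v0 := by
      intro hv
      apply hA
      refine ⟨j, FreeGroup.lift b w'⁻¹ * y, hj, hv, ?_⟩
      rw [← chainPerm_word hdis hj (by rw [hv]; exact inv_mem hw'), ← hp]
      simp
    obtain ⟨k, hk⟩ := hcu j hj hv y hy
    refine ⟨(⟨j, by omega⟩, k), ?_⟩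
    simp only [f]
    rw [← hk]
  have hcard : T.ncard ≤ (n + 1) * D := by
    calc T.ncard ≤ (Set.range f).ncard := Set.ncard_le_ncard hTf (Set.finite_range f)
      _ = Nat.card (Set.range f) := (Nat.card_coe_set_eq _).symm
      _ ≤ Nat.card (Fin (n + 1) × Fin D) := Finite.card_range_le f
      _ = (n + 1) * D := by simp
  refine hfix T ((Set.finite_range f).subset hTf) hcard ?_ x ?_
  · rintro s hs p ⟨⟨j, y, hj, hy, hp1⟩, w', hw', hp⟩
    refine ⟨?_, FreeGroup.of s * w', mul_mem (Subgroup.subset_closure ⟨s, hs, rfl⟩) hw', ?_⟩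
    · rcases chainPerm_cases hdis s p with h | ⟨j', y', hj', hs', hp2⟩
      · rw [h]; exact ⟨j, y, hj, hy, hp1⟩
      · rw [hp2, chainPerm_norm hdis hj' hs']
        refine ⟨j', b s * y', hj', ?_, rfl⟩
        rw [hp1] at hp2
        obtain ⟨rfl, h⟩ := chainNorm_eq_imp hp2
        have hy' : y ∈ Z j' := by
          rcases h with rfl | ⟨rfl, h⟩ | ⟨rfl, h⟩
          · exact hy
          · exact (h2 j (by omega) y h).1 hy
          · exact (h2 j' (by omega) y h).2 hy
        rw [h1 j' hj' y hy']
        rw [mul_inv_cancel_right]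
        exact Subgroup.subset_closure ⟨s, ⟨hs, hs'⟩, rfl⟩
    · rw [map_mul, Equiv.Perm.mul_apply, hp]
      simp
  · exact ⟨⟨i, u0, hi, hZ, hx⟩, 1, one_mem _, by simp⟩

end Orbit

lemma pow_and_disjoint_of_test {S G : Type} [Group G] (a : S → G) (D : ℕ)
    (htest : ∀ σ : S → Equiv.Perm (ZMod D), (∀ s, σ s ^ D = 1) → ∀ w, FreeGroup.lift a w = 1 →
      ∀ z, FreeGroup.lift σ w z = z) :
    (∀ s (i : ℤ), a s ^ i = 1 → (D : ℤ) ∣ i) ∧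
      ∀ s t (i j : ℤ), s ≠ t → a s ^ i = a t ^ j → (D : ℤ) ∣ i := by
  classical
  let σ : S → S → Equiv.Perm (ZMod D) := fun s t => if t = s then Equiv.addLeft 1 else 1
  have hσ : ∀ s t, σ s t ^ D = 1 := by
    intro s t
    by_cases h : t = s
    · simp [σ, h, Equiv.nsmul_addLeft]
    · simp [σ, h]
  constructor
  · intro s i hi
    have := htest (σ s) (hσ s) (FreeGroup.of s ^ i) (by simpa using hi) 0
    simp only [map_zpow, FreeGroup.lift_apply_of, σ, if_true, Equiv.zsmul_addLeft] at this
    rw [← ZMod.intCast_zmod_eq_zero_iff_dvd]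
    simpa using this
  · intro s t i j hst hij
    have := htest (σ s) (hσ s) (FreeGroup.of s ^ i * (FreeGroup.of t ^ j)⁻¹) (by
      simp [hij]) 0
    simp only [map_mul, map_inv, map_zpow, FreeGroup.lift_apply_of, σ, if_true, if_neg hst.symm,
      Equiv.zsmul_addLeft, one_zpow, inv_one, mul_one] at this
    rw [← ZMod.intCast_zmod_eq_zero_iff_dvd]
    simpa using this

section Walk

variable {S V H : Type} [Group H] {I : S → V → Prop} {b : S → H} {v : ℕ → V} {n : ℕ}

/-- The words describing the positions reached along a walk. -/
def walkWord (ω : ℕ → FreeGroup S) : ℕ → FreeGroup S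
  | 0 => (ω 0)⁻¹
  | k + 1 => (ω (k + 1))⁻¹ * walkWord ω k

lemma mem_glue_self (e : ℕ → H) (j : ℕ) : e j ∈ glue I b v e j := by
  unfold glue
  simp [one_mem]

lemma chainPerm_walk (ω : ℕ → FreeGroup S)
    (hω : ∀ j ≤ n, ω j ∈ Subgroup.closure (FreeGroup.of '' {s | I s (v j)}))
    (hdis : ∀ j u, j + 1 < n → u ∈ glue I b v (fun k => FreeGroup.lift b (walkWord ω k)) j →
      u ∉ glue I b v (fun k => FreeGroup.lift b (walkWord ω k)) (j + 1)) :
    ∀ k ≤ n, FreeGroup.lift (chainPerm hdis) (walkWord ω k) (0, 1)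
      = chainNorm I b v (fun k => FreeGroup.lift b (walkWord ω k))
        (k, FreeGroup.lift b (walkWord ω k)) := by
  intro k
  induction k with
  | zero =>
    intro _
    have := chainPerm_word hdis (Nat.zero_le n) (inv_mem (hω 0 (Nat.zero_le n))) 1
    rw [chainNorm_zero, mul_one] at this
    exact this
  | succ k ih =>
    intro hk
    have h1 := mem_glue_self (I := I) (b := b) (v := v)
      (fun k => FreeGroup.lift b (walkWord ω k)) k
    have := chainPerm_word hdis hk (inv_mem (hω (k + 1) hk)) (FreeGroup.lift b (walkWord ω k))
    rw [chainNorm_of_mem h1] at this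
    rw [walkWord, map_mul, Equiv.Perm.mul_apply, ih (by omega),
      chainNorm_of_glue hdis (by omega) h1, this, map_mul]

end Walk

/-- Finite groups whose cosets of the subgroups attached to the vertices of a linear incidence
structure have no short cycles. -/
theorem exists_group_of_large_girth {S V : Type} [Finite S] (I : S → V → Prop)
    (hI : ∀ x y s t, x ≠ y → I s x → I s y → I t x → I t y → s = t) (N D : ℕ) (hN : 2 ≤ N)
    (hD : 2 ≤ D) :
    ∃ (G : Type) (_ : Group G) (_ : Finite G) (a : S → G),
      (∀ s, a s ^ D = 1) ∧ (∀ s (i : ℤ), a s ^ i = 1 → (D : ℤ) ∣ i) ∧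
      (∀ s t h, s ≠ t → h ∈ Subgroup.zpowers (a s) → h ∈ Subgroup.zpowers (a t) → h = 1) ∧
      (∀ x y h, x ≠ y → h ∈ Subgroup.closure (a '' {s | I s x}) →
        h ∈ Subgroup.closure (a '' {s | I s y}) →
        h = 1 ∨ ∃ s, I s x ∧ I s y ∧ h ∈ Subgroup.zpowers (a s)) ∧
      (∀ (n : ℕ) (v : ℕ → V) (g : ℕ → G) (g' : G), 2 ≤ n → n + 1 ≤ N →
        (∀ j < n, v j ≠ v (j + 1)) →
        (∀ j, j + 1 < n → (g j)⁻¹ * g (j + 1) ∈ Subgroup.closure (a '' {s | I s (v (j + 1))})) →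
        (g 0)⁻¹ * g' ∈ Subgroup.closure (a '' {s | I s (v 0)}) →
        (g (n - 1))⁻¹ * g' ∈ Subgroup.closure (a '' {s | I s (v n)}) →
        ∃ j h, j + 1 < n ∧ (g j)⁻¹ * h ∈ Subgroup.closure (a '' {s | I s (v j)}) ∧
          (g j)⁻¹ * h ∈ Subgroup.closure (a '' {s | I s (v (j + 1))}) ∧
          (g (j + 1))⁻¹ * h ∈ Subgroup.closure (a '' {s | I s (v (j + 1))}) ∧
          (g (j + 1))⁻¹ * h ∈ Subgroup.closure (a '' {s | I s (v (j + 2))})) := by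
  classical
  have : NeZero D := ⟨by omega⟩
  let P1 : (S → Equiv.Perm (Fin ((N + 1) * D))) → Prop := fun σ => ∀ s, σ s ^ D = 1
  let b : S → UG ((N + 1) * D) P1 := ugen P1
  have hbfix : ∀ {X : Type} (σ : S → Equiv.Perm X), (∀ s, σ s ^ D = 1) → ∀ (α : Set S)
      (Z : Set X), Z.Finite → Z.ncard ≤ (N + 1) * D → (∀ s ∈ α, ∀ z ∈ Z, σ s z ∈ Z) →
      ∀ w ∈ Subgroup.closure (FreeGroup.of '' α), FreeGroup.lift b w = 1 →
      ∀ z ∈ Z, FreeGroup.lift σ w z = z :=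
    fun σ hσ α Z hf hK hZ w hα hw => ugen_fix_of_pow σ hσ α Z hf hK hZ w hα hw
  have hbD : ∀ s, b s ^ D = 1 := by
    intro s
    funext σ
    exact σ.2 s
  have hbtest : ∀ σ : S → Equiv.Perm (ZMod D), (∀ s, σ s ^ D = 1) → ∀ w,
      FreeGroup.lift b w = 1 → ∀ z, FreeGroup.lift σ w z = z := by
    intro σ hσ w hw z
    refine hbfix σ hσ Set.univ Set.univ (Set.toFinite _) ?_ (by simp) w ?_ hw z trivial
    · rw [Set.ncard_univ, Nat.card_zmod]
      nlinarith
    · rw [Set.image_univ, FreeGroup.closure_range_of]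
      trivial
  have hbz : ∀ s t, s ≠ t → ∀ h, h ∈ Subgroup.zpowers (b s) → h ∈ Subgroup.zpowers (b t) →
      h = 1 := by
    rintro s t hst _ ⟨i, rfl⟩ ⟨j, hj⟩
    obtain ⟨k, rfl⟩ := (pow_and_disjoint_of_test b D hbtest).2 s t i j hst hj.symm
    simp [zpow_mul, hbD]
  clear_value b
  let K2 := (N + 1) * Nat.card (UG ((N + 1) * D) P1) + D
  let P2 : (S → Equiv.Perm (Fin K2)) → Prop := fun σ => (∀ s, σ s ^ D = 1) ∧
    ∀ x, ∀ w ∈ Subgroup.closure (FreeGroup.of '' {s | I s x}), FreeGroup.lift b w = 1 →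
      FreeGroup.lift σ w = 1
  let a : S → UG K2 P2 := ugen P2
  have hafix : ∀ {X : Type} (σ : S → Equiv.Perm X), (∀ s, σ s ^ D = 1) →
      (∀ x, ∀ w ∈ Subgroup.closure (FreeGroup.of '' {s | I s x}), FreeGroup.lift b w = 1 →
        FreeGroup.lift σ w = 1) → ∀ (Z : Set X), Z.Finite → Z.ncard ≤ K2 →
      (∀ s, ∀ z ∈ Z, σ s z ∈ Z) → ∀ w, FreeGroup.lift a w = 1 →
      ∀ z ∈ Z, FreeGroup.lift σ w z = z := by
    intro X σ hσ hσ' Z hf hK hZ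
    refine ugen_fix P2 σ Z hf hK hZ ?_
    intro σ' h
    constructor
    · intro s
      have h2 := (h (FreeGroup.of s ^ D)).2 (fun z _ => by simp [hσ])
      simpa using h2
    · intro x w hw hw1
      rw [h]
      intro z _
      rw [hσ' x w hw hw1]
      rfl
  have haD : ∀ s, a s ^ D = 1 := by
    intro s
    funext σ
    exact σ.2.1 s
  have hab : ∀ x, ∀ w ∈ Subgroup.closure (FreeGroup.of '' {s | I s x}), FreeGroup.lift b w = 1 →
      FreeGroup.lift a w = 1 := by
    intro x w hw hw1
    funext σ
    rw [lift_ugen, σ.2.2 x w hw hw1]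
    rfl
  have hatest : ∀ σ : S → Equiv.Perm (ZMod D), (∀ s, σ s ^ D = 1) → ∀ w,
      FreeGroup.lift a w = 1 → ∀ z, FreeGroup.lift σ w z = z := by
    intro σ hσ w hw z
    refine hafix σ hσ ?_ Set.univ (Set.toFinite _) ?_ (by simp) w hw z trivial
    · intro x w _ hw
      ext1 z
      exact hbtest σ hσ w hw z
    · rw [Set.ncard_univ, Nat.card_zmod]
      exact Nat.le_add_left _ _
  clear_value a
  have hwalk : ∀ (n : ℕ) (v : ℕ → V) (ω : ℕ → FreeGroup S), n ≤ N → (∀ j < n, v j ≠ v (j + 1)) →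
      (∀ j ≤ n, ω j ∈ Subgroup.closure (FreeGroup.of '' {s | I s (v j)})) →
      FreeGroup.lift a (walkWord ω n) = 1 →
      (∀ j u, j + 1 < n → u ∈ glue I b v (fun k => FreeGroup.lift b (walkWord ω k)) j →
        u ∉ glue I b v (fun k => FreeGroup.lift b (walkWord ω k)) (j + 1)) →
      (0, 1) = chainNorm I b v (fun k => FreeGroup.lift b (walkWord ω k))
        (n, FreeGroup.lift b (walkWord ω n)) := by
    intro n v ω hn hne hω hw hdis
    rw [← chainPerm_walk ω hω hdis n le_rfl]
    symm
    have hfin : {p : ℕ × UG ((N + 1) * D) P1 | p.1 ≤ n} =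
        Set.range (fun q : Fin (n + 1) × UG ((N + 1) * D) P1 => ((q.1 : ℕ), q.2)) := by
      ext p
      constructor
      · intro hp
        exact ⟨(⟨p.1, Nat.lt_succ_of_le hp⟩, p.2), rfl⟩
      · rintro ⟨q, rfl⟩
        exact Nat.le_of_lt_succ q.1.2
    refine hafix (chainPerm hdis) (chainPerm_pow hdis hbD) ?_ {p | p.1 ≤ n} ?_ ?_ ?_ _ hw _
      (Nat.zero_le n)
    · intro x w hw hw1
      refine chainPerm_word_eq_one hI hbz (by omega) hbD hne hdis x w hw hw1 ?_
      intro Z hf hZc hZ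
      refine hbfix _ (chainPerm_pow hdis hbD) _ Z hf (hZc.trans ?_) hZ w hw hw1
      gcongr
    · rw [hfin]; exact Set.finite_range _
    · rw [hfin, ← Nat.card_coe_set_eq]
      refine (Finite.card_range_le _).trans ?_
      rw [Nat.card_prod, Nat.card_fin]
      refine (Nat.mul_le_mul_right _ (by omega)).trans (Nat.le_add_right _ _)
    · intro s p hp
      rcases chainPerm_cases hdis s p with h | ⟨j, u, hj, hs, h⟩
      · rw [h]; exact hp
      · rw [h, chainPerm_norm hdis hj hs]
        exact chainNorm_fst_le.trans hj
  refine ⟨UG K2 P2, inferInstance, inferInstance, a, haD, (pow_and_disjoint_of_test a D hatest).1,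
    ?_, ?_, ?_⟩
  · rintro s t _ hst ⟨i, rfl⟩ ⟨j, hj⟩
    obtain ⟨k, rfl⟩ := (pow_and_disjoint_of_test a D hatest).2 s t i j hst hj.symm
    simp [zpow_mul, haD]
  · intro x y h hxy hx hy
    obtain ⟨w0, hw0, rfl⟩ := exists_word a _ hx
    obtain ⟨w1, hw1, hw⟩ := exists_word a _ hy
    have h1 := hwalk 1 (fun j => if j = 0 then x else y)
      (fun j => if j = 0 then w0 else w1⁻¹) (by omega)
      (by intro j hj; obtain rfl : j = 0 := by omega
          simpa using hxy)
      (by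
        intro j hj
        by_cases h : j = 0
        · simpa [h] using hw0
        · simpa [h] using hw1)
      (by simp [walkWord, hw]) (by intro j u hj; omega)
    have h2 : (1 : UG ((N + 1) * D) P1) ∈ glue I b (fun j => if j = 0 then x else y)
        (fun k => FreeGroup.lift b (walkWord (fun j => if j = 0 then w0 else w1⁻¹) k)) 0 := by
      have h3 := congrArg Prod.snd h1
      rw [chainNorm_snd] at h3
      rw [show (1 : UG ((N + 1) * D) P1) = _ from h3]
      by_contra hcon
      rw [chainNorm_of_notMem hcon] at h1
      exact absurd (congrArg Prod.fst h1) (by simp)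
    have h4 : FreeGroup.lift b w0 ∈ Subgroup.closure (b '' {s | I s x ∧ I s y}) := by
      simpa [glue, walkWord] using h2
    obtain ⟨w2, hw2, hw2'⟩ := exists_word b _ h4
    have h5 : FreeGroup.lift a w0 = FreeGroup.lift a w2 := by
      rw [← mul_inv_eq_one, ← map_inv, ← map_mul]
      refine hab x _ (mul_mem hw0 (inv_mem ?_)) ?_
      · refine Subgroup.closure_mono (Set.image_mono ?_) hw2
        exact fun s hs => hs.1
      · rw [map_mul, map_inv, hw2', mul_inv_cancel]
    rw [h5]
    exact mem_closure_common hI hxy (lift_mem_closure a _ hw2)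
  · intro n v g g' hn hnN hne hg h0 hlast
    choose! w hw hw' using fun j (hj : j + 1 < n) => exists_word a _ (hg j hj)
    obtain ⟨w0, hw0, hw0'⟩ := exists_word a _ (inv_mem h0)
    obtain ⟨wn, hwn, hwn'⟩ := exists_word a _ hlast
    obtain ⟨ω, hω0, hω1, hωn⟩ : ∃ ω : ℕ → FreeGroup S, ω 0 = w0 ∧
        (∀ j, j + 1 < n → ω (j + 1) = w j) ∧ ω n = wn := by
      refine ⟨fun j => if j = 0 then w0 else if j = n then wn else w (j - 1), by simp, ?_, ?_⟩
      · intro j hj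
        simp [show ¬ (j + 1 = n) by omega]
      · simp [show n ≠ 0 by omega]
    have hω : ∀ j ≤ n, ω j ∈ Subgroup.closure (FreeGroup.of '' {s | I s (v j)}) := by
      intro j hj
      rcases Nat.eq_zero_or_pos j with rfl | hj0
      · rwa [hω0]
      rcases hj.eq_or_lt with rfl | hj'
      · rwa [hωn]
      obtain ⟨i, rfl⟩ : ∃ i, j = i + 1 := ⟨j - 1, by omega⟩
      rw [hω1 i hj']
      exact hw i hj'
    have hpos : ∀ j < n, FreeGroup.lift a (walkWord ω j) = (g j)⁻¹ * g' := by
      intro j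
      induction j with
      | zero =>
        intro _
        rw [walkWord, map_inv, hω0, hw0', inv_inv]
      | succ j ih =>
        intro hj
        rw [walkWord, map_mul, map_inv, hω1 j hj, hw' j hj, ih (by omega)]
        group
    have htot : FreeGroup.lift a (walkWord ω n) = 1 := by
      obtain ⟨m, rfl⟩ : ∃ m, n = m + 1 := ⟨n - 1, by omega⟩
      rw [walkWord, map_mul, map_inv, hωn, hwn', hpos m (by omega)]
      simp
    by_contra hcon
    have hdis : ∀ j u, j + 1 < n → u ∈ glue I b v (fun k => FreeGroup.lift b (walkWord ω k)) j →
        u ∉ glue I b v (fun k => FreeGroup.lift b (walkWord ω k)) (j + 1) := by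
      intro j u hj hu hu'
      apply hcon
      obtain ⟨c, hc, hc'⟩ := exists_word b _ hu
      obtain ⟨d, hd, hd'⟩ := exists_word b _ hu'
      have hcj : c ∈ Subgroup.closure (FreeGroup.of '' {s | I s (v j)}) :=
        Subgroup.closure_mono (Set.image_mono fun s hs => hs.1) hc
      have hcj' : c ∈ Subgroup.closure (FreeGroup.of '' {s | I s (v (j + 1))}) :=
        Subgroup.closure_mono (Set.image_mono fun s hs => hs.2) hc
      have hdj : d ∈ Subgroup.closure (FreeGroup.of '' {s | I s (v (j + 1))}) :=
        Subgroup.closure_mono (Set.image_mono fun s hs => hs.1) hd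
      have hdj' : d ∈ Subgroup.closure (FreeGroup.of '' {s | I s (v (j + 2))}) :=
        Subgroup.closure_mono (Set.image_mono fun s hs => hs.2) hd
      have h1 := hab (v (j + 1)) (c⁻¹ * (d * (ω (j + 1))⁻¹))
        (mul_mem (inv_mem hcj') (mul_mem hdj (inv_mem (hω (j + 1) hj.le)))) (by
          simp only [walkWord, map_mul, map_inv] at hd' ⊢
          simp only [hc', hd']
          group)
      have hwj : FreeGroup.lift a (ω (j + 1)) = (g j)⁻¹ * g (j + 1) := by
        rw [hω1 j hj, hw' j hj]
      have h2 : FreeGroup.lift a c = FreeGroup.lift a d * ((g j)⁻¹ * g (j + 1))⁻¹ := by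
        rw [← hwj]
        simp only [map_mul, map_inv] at h1
        exact inv_mul_eq_one.1 h1
      have h3 : (g (j + 1))⁻¹ * (g j * (FreeGroup.lift a c)⁻¹) = (FreeGroup.lift a d)⁻¹ := by
        rw [h2]
        group
      refine ⟨j, g j * (FreeGroup.lift a c)⁻¹, hj, ?_, ?_, ?_, ?_⟩
      · rw [inv_mul_cancel_left]
        exact inv_mem (lift_mem_closure a _ hcj)
      · rw [inv_mul_cancel_left]
        exact inv_mem (lift_mem_closure a _ hcj')
      · rw [h3]
        exact inv_mem (lift_mem_closure a _ hdj)
      · rw [h3]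
        exact inv_mem (lift_mem_closure a _ hdj')
    have h1 := hwalk n v ω (by omega) hne hω htot hdis
    have h2 := le_chainNorm_fst (I := I) (b := b) (v := v)
      (e := fun k => FreeGroup.lift b (walkWord ω k)) (j := n)
      (u := FreeGroup.lift b (walkWord ω n))
    rw [← h1] at h2
    simp only at h2
    omega

/-! ### Covers -/

/-- Two edges sharing two distinct points are equal. -/
def Lin {ι V : Type} (E : Set (ι → V)) : Prop :=
  ∀ f ∈ E, ∀ g ∈ E, ∀ x y, x ≠ y → x ∈ Set.range f → y ∈ Set.range f →
    x ∈ Set.range g → y ∈ Set.range g → f = g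

lemma exists_mul_pow_lt (K k : ℕ) : ∃ D, 2 ≤ D ∧ K * k ^ D < (k + 1) ^ D := by
  rcases Nat.eq_zero_or_pos k with rfl | hk
  · exact ⟨2, le_rfl, by simp⟩
  have key : ∀ D, (k + D) * k ^ D ≤ k * (k + 1) ^ D := by
    intro D
    induction D with
    | zero => simp
    | succ D ih =>
      calc (k + (D + 1)) * k ^ (D + 1) = ((k + D + 1) * k) * k ^ D := by ring
        _ ≤ ((k + D) * (k + 1)) * k ^ D := Nat.mul_le_mul_right _ (by nlinarith)
        _ = ((k + D) * k ^ D) * (k + 1) := by ring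
        _ ≤ (k * (k + 1) ^ D) * (k + 1) := by gcongr
        _ = k * (k + 1) ^ (D + 1) := by ring
  refine ⟨K * k + 2, by omega, ?_⟩
  have h := key (K * k + 2)
  have hp : 0 < k ^ (K * k + 2) := by positivity
  generalize k ^ (K * k + 2) = P at *
  generalize (k + 1) ^ (K * k + 2) = Q at *
  by_contra hc
  push Not at hc
  have : k * Q ≤ k * (K * P) := by gcongr
  nlinarith

/-- A counting argument: if every colouring admits, at each `g`, a good choice from a set of size
`k + 1`, and there are few colourings, then a single choice function works for all colourings. -/
lemma exists_uniform_choice {G Ω C 𝒜 : Type} [Finite G] [Finite Ω] [Finite C] (k : ℕ)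
    (e : 𝒜 ≃ Fin (k + 1)) (good : (Ω → C) → G → 𝒜 → Prop) (h : ∀ c g, ∃ A, good c g A)
    (hcard : Nat.card C ^ Nat.card Ω * k ^ Nat.card G < (k + 1) ^ Nat.card G) :
    ∃ A : G → 𝒜, ∀ c, ∃ g, good c g (A g) := by
  by_contra hcon
  push Not at hcon
  choose cA hcA using hcon
  choose p hp using h
  have hne : ∀ A g, e (A g) ≠ e (p (cA A) g) := by
    intro A g h
    exact hcA A g (e.injective h ▸ hp _ _)
  choose z hz using fun A g => Fin.exists_succAbove_eq (hne A g)
  have hinj : Function.Injective (fun A : G → 𝒜 => (cA A, z A)) := by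
    intro A A' h
    simp only [Prod.mk.injEq] at h
    funext g
    apply e.injective
    rw [← hz A g, ← hz A' g, h.1, h.2]
  have := Nat.card_le_card_of_injective _ hinj
  have hA : Nat.card 𝒜 = k + 1 := by rw [Nat.card_congr e]; simp
  rw [Nat.card_prod, Nat.card_fun, Nat.card_fun, Nat.card_fun, hA, Nat.card_fin] at this
  omega

theorem exists_cover {ι V T C : Type} [Finite ι] [Finite V] [Finite T] [Finite C] [Nonempty C]
    (ET : Set (ι → T)) (hlin : Lin ET) (E : Set (ι → V)) (𝒜 : Set (V → T))
    (hA : ∀ A ∈ 𝒜, ∀ f ∈ E, A ∘ f ∈ ET)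
    (hram : ∀ c : (ι → T) → C, ∃ A ∈ 𝒜, ∃ k, ∀ f ∈ E, c (A ∘ f) = k) (N : ℕ) (hN : 2 ≤ N) :
    ∃ (G : Type) (_ : Finite G) (X : Type) (_ : Finite X) (τ : G → T → T × X) (A : G → V → T),
      (∀ g v, (τ g v).1 = v) ∧ (∀ g, A g ∈ 𝒜) ∧
      (∀ g g' v w, g ≠ g' → v ≠ w → τ g v = τ g' v → τ g w = τ g' w →
        ∃ t ∈ ET, v ∈ Set.range t ∧ w ∈ Set.range t ∧ τ g ∘ t = τ g' ∘ t ∧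
          ∀ u, τ g u = τ g' u → u ∈ Set.range t) ∧
      PathEar (Set.range fun g => Set.range (τ g)) N ∧
      (∀ c : (ι → T × X) → C, ∃ g k, ∀ f ∈ E, c (τ g ∘ A g ∘ f) = k) := by
  classical
  obtain ⟨A₀, hA₀, -⟩ := hram fun _ => Classical.arbitrary C
  have hk : ∃ k, Nat.card 𝒜 = k + 1 := by
    have : Nonempty 𝒜 := ⟨⟨A₀, hA₀⟩⟩
    exact ⟨Nat.card 𝒜 - 1, by have := Nat.card_pos (α := 𝒜); omega⟩
  obtain ⟨k, hk⟩ := hk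
  obtain ⟨D, hD, hDk⟩ := exists_mul_pow_lt (Nat.card C ^ Nat.card ET) k
  obtain ⟨G, _, _, a, -, hord, hdisj, hcap, hgirth⟩ :=
    exists_group_of_large_girth (S := ET) (V := T) (fun s v => v ∈ Set.range s.1)
      (fun x y s t hxy h1 h2 h3 h4 => Subtype.ext (hlin _ s.2 _ t.2 x y hxy h1 h2 h3 h4)) N D hN hD
  set H : T → Subgroup G := fun v => Subgroup.closure (a '' {s | v ∈ Set.range s.1}) with hH
  set τ : G → T → T × Set G := fun g v => (v, {h | g⁻¹ * h ∈ H v}) with hτ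
  have hτeq : ∀ g g' v, τ g v = τ g' v ↔ g⁻¹ * g' ∈ H v := by
    intro g g' v
    simp only [hτ, Prod.mk.injEq, true_and]
    constructor
    · intro h
      have : g' ∈ {h | g⁻¹ * h ∈ H v} := by
        rw [h]
        simp only [Set.mem_ofPred_eq, inv_mul_cancel]
        exact one_mem _
      exact this
    · intro h
      ext x
      simp only [Set.mem_ofPred_eq]
      have e : g⁻¹ * x = (g⁻¹ * g') * (g'⁻¹ * x) := by group
      rw [e]
      exact Subgroup.mul_mem_cancel_left _ h
  have hzH : ∀ (s : ET) v h, v ∈ Set.range s.1 → h ∈ Subgroup.zpowers (a s) → h ∈ H v := by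
    intro s v h hv hh
    have : Subgroup.zpowers (a s) ≤ H v := by
      rw [Subgroup.zpowers_le]
      exact Subgroup.subset_closure (Set.mem_image_of_mem a hv)
    exact this hh
  let Ω : Set (ι → T × Set G) := {ω | ∃ g, ∃ t : ET, ω = τ g ∘ t.1}
  have hΩ : Nat.card Ω * D ≤ Nat.card ET * Nat.card G := by
    choose gg tt hgt using fun ω : Ω => ω.2
    have hinj : Function.Injective (fun p : Ω × Fin D => (tt p.1, gg p.1 * a (tt p.1) ^ (p.2 : ℕ))) := by
      rintro ⟨ω, i⟩ ⟨ω', i'⟩ h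
      simp only [Prod.mk.injEq] at h
      obtain ⟨h1, h2⟩ := h
      have hω : ω = ω' := by
        apply Subtype.ext
        rw [hgt ω, hgt ω', ← h1]
        funext j
        simp only [Function.comp]
        rw [hτeq]
        apply hzH (tt ω) _ _ ⟨j, rfl⟩
        have : (gg ω)⁻¹ * gg ω' = a (tt ω) ^ (i : ℕ) * (a (tt ω) ^ (i' : ℕ))⁻¹ := by
          have h3 : gg ω' = gg ω * a (tt ω) ^ (i : ℕ) * (a (tt ω) ^ (i' : ℕ))⁻¹ := by
            rw [h2, h1]; group
          rw [h3]; group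
        rw [this]
        exact mul_mem (Subgroup.npow_mem_zpowers _ _)
          (inv_mem (Subgroup.npow_mem_zpowers _ _))
      subst hω
      have h3 := mul_left_cancel h2
      have h4 : a (tt ω) ^ ((i : ℤ) - (i' : ℤ)) = 1 := by
        rw [zpow_sub, zpow_natCast, zpow_natCast, h3, mul_inv_cancel]
      have h5 := hord _ _ h4
      have h6 : (i : ℤ) - (i' : ℤ) = 0 := by
        apply Int.eq_zero_of_abs_lt_dvd h5
        have := i.2
        have := i'.2
        rw [abs_lt]
        constructor <;> omega
      have h7 : i = i' := Fin.ext (by omega)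
      rw [h7]
    have := Nat.card_le_card_of_injective _ hinj
    rwa [Nat.card_prod, Nat.card_prod, Nat.card_fin] at this
  have hG : 0 < Nat.card G := Nat.card_pos
  have hC : 0 < Nat.card C := Nat.card_pos
  have hcard : Nat.card C ^ Nat.card Ω * k ^ Nat.card G < (k + 1) ^ Nat.card G := by
    apply lt_of_pow_lt_pow_left₀ D (Nat.zero_le _)
    calc (Nat.card C ^ Nat.card Ω * k ^ Nat.card G) ^ D
        = Nat.card C ^ (Nat.card Ω * D) * k ^ (Nat.card G * D) := by
          rw [mul_pow, ← pow_mul, ← pow_mul]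
      _ ≤ Nat.card C ^ (Nat.card ET * Nat.card G) * k ^ (Nat.card G * D) := by
          gcongr
      _ = (Nat.card C ^ Nat.card ET * k ^ D) ^ Nat.card G := by
          rw [mul_pow, ← pow_mul, ← pow_mul, mul_comm D]
      _ < ((k + 1) ^ D) ^ Nat.card G := by
          apply Nat.pow_lt_pow_left hDk hG.ne'
      _ = ((k + 1) ^ Nat.card G) ^ D := by rw [← pow_mul, ← pow_mul, mul_comm]
  obtain ⟨A, hAA⟩ := exists_uniform_choice (G := G) (Ω := Ω) (C := C) (𝒜 := 𝒜) k
    (Finite.equivFinOfCardEq hk)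
    (fun c g A => ∃ k, ∀ f, ∀ hf : f ∈ E, c ⟨τ g ∘ A.1 ∘ f, g, ⟨_, hA _ A.2 f hf⟩, rfl⟩ = k)
    (by
      intro c g
      obtain ⟨A, hA1, k, hk⟩ := hram fun t =>
        if ht : t ∈ ET then c ⟨τ g ∘ t, g, ⟨t, ht⟩, rfl⟩ else Classical.arbitrary C
      refine ⟨⟨A, hA1⟩, k, fun f hf => ?_⟩
      have := hk f hf
      rwa [dif_pos (hA _ hA1 f hf)] at this) hcard
  refine ⟨G, inferInstance, Set G, inferInstance, τ, fun g => (A g).1, fun _ _ => rfl,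
    fun g => (A g).2, ?_, ?_, ?_⟩
  · intro g g' v w hg hvw h1 h2
    rw [hτeq] at h1 h2
    have hne : g⁻¹ * g' ≠ 1 := by
      intro h
      exact hg (inv_mul_eq_one.mp h)
    rcases hcap v w _ hvw h1 h2 with h | ⟨s, hv, hw, hs⟩
    · exact absurd h hne
    refine ⟨s.1, s.2, hv, hw, ?_, ?_⟩
    · funext j
      simp only [Function.comp]
      rw [hτeq]
      exact hzH s _ _ ⟨j, rfl⟩ hs
    · intro u hu
      rw [hτeq] at hu
      by_cases huv : u = v
      · rw [huv]; exact hv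
      rcases hcap u v _ huv hu h1 with h | ⟨s', hu', -, hs'⟩
      · exact absurd h hne
      by_cases hss : s = s'
      · rw [hss]; exact hu'
      · exact absurd (hdisj s s' _ hss hs hs') hne
  · intro n x hn2 hnN hsteps hclose
    by_cases hst : ∃ j, j < n ∧ x j = x (j + 1)
    · obtain ⟨j, hj, hjx⟩ := hst
      rcases Nat.lt_or_ge (j + 1) n with h | h
      · refine ⟨j, by omega, ?_⟩
        rw [hjx]
        exact (hsteps _ h).co3_left
      · refine ⟨j - 1, by omega, ?_⟩
        have e1 : j - 1 + 1 = j := by omega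
        have e2 : j - 1 + 2 = j + 1 := by omega
        rw [e1, e2, ← hjx]
        have := hsteps (j - 1) (by omega)
        rw [e1] at this
        exact this.co3_right
    · push Not at hst
      have hg : ∀ j, ∃ g, j < n → ∃ v w, x j = τ g v ∧ x (j + 1) = τ g w := by
        intro j
        by_cases hj : j < n
        · obtain ⟨_, ⟨g, rfl⟩, ⟨v, hv⟩, ⟨w, hw⟩⟩ := hsteps j hj
          exact ⟨g, fun _ => ⟨v, w, hv.symm, hw.symm⟩⟩
        · exact ⟨1, fun h => absurd h hj⟩
      choose g hg using hg
      obtain ⟨_, ⟨g', rfl⟩, ⟨v', hv'⟩, ⟨w', hw'⟩⟩ := hclose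
      have hx0 : ∀ j, j < n → x j = τ (g j) (x j).1 ∧ x (j + 1) = τ (g j) (x (j + 1)).1 := by
        intro j hj
        obtain ⟨v, w, hv, hw⟩ := hg j hj
        exact ⟨by rw [hv], by rw [hw]⟩
      have hn1 : n - 1 + 1 = n := by omega
      obtain ⟨j, h, hj, h1, h2, h3, h4⟩ := hgirth n (fun j => (x j).1) g g' hn2 hnN
        (by
          intro j hj he
          apply hst j hj
          rw [(hx0 j hj).1, (hx0 j hj).2]
          exact congrArg (τ (g j)) he)
        (by
          intro j hj
          exact (hτeq _ _ _).mp ((hx0 j (by omega)).2.symm.trans (hx0 (j + 1) hj).1))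
        (by
          apply (hτeq _ _ _).mp
          rw [← (hx0 0 (by omega)).1, ← hv'])
        (by
          apply (hτeq _ _ _).mp
          have := (hx0 (n - 1) (by omega)).2
          rw [hn1] at this
          rw [← this, ← hw'])
      refine ⟨j, by omega, Set.range (τ h), ⟨h, rfl⟩, ⟨(x j).1, ?_⟩, ⟨(x (j + 1)).1, ?_⟩,
        ⟨(x (j + 2)).1, ?_⟩⟩
      · exact ((hx0 j (by omega)).1.trans ((hτeq _ _ _).mpr h1)).symm
      · exact ((hx0 j (by omega)).2.trans ((hτeq _ _ _).mpr h2)).symm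
      · exact ((hx0 (j + 1) (by omega)).2.trans ((hτeq _ _ _).mpr h4)).symm
  · intro c
    obtain ⟨g, k, hk⟩ := hAA fun ω => c ω.1
    exact ⟨g, k, fun f hf => hk f hf⟩

/-! ### Strongly induced systems and amalgamation over a cover -/

/-- The supports of a set of edges. -/
def eb {ι V : Type} (E : Set (ι → V)) : Set (Set V) := Set.image Set.range E

/-- The edges of a system `Φ` of copies of the hypergraph `F`. -/
def Ed {ι U V : Type} (Φ : Set (U → V)) (F : Set (ι → U)) : Set (ι → V) :=
  {e | ∃ φ ∈ Φ, ∃ t ∈ F, e = φ ∘ t}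

/-- A strongly induced system of copies: an edge meeting a copy in two points belongs to it,
and two copies meeting in two points intersect in an edge. -/
structure Sys {ι U V : Type} (F : Set (ι → U)) (Φ : Set (U → V)) : Prop where
  inj : ∀ φ ∈ Φ, Function.Injective φ
  strong : ∀ φ ∈ Φ, ∀ f ∈ Ed Φ F, ∀ x y, x ≠ y → x ∈ Set.range φ → y ∈ Set.range φ →
    x ∈ Set.range f → y ∈ Set.range f → ∃ t ∈ F, f = φ ∘ t
  link : ∀ φ ∈ Φ, ∀ ψ ∈ Φ, φ ≠ ψ → ∀ x y, x ≠ y → x ∈ Set.range φ → y ∈ Set.range φ →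
    x ∈ Set.range ψ → y ∈ Set.range ψ → ∃ t ∈ F, ∃ t' ∈ F, φ ∘ t = ψ ∘ t' ∧
      x ∈ Set.range (φ ∘ t) ∧ y ∈ Set.range (φ ∘ t) ∧
      Set.range φ ∩ Set.range ψ ⊆ Set.range (φ ∘ t)

lemma Sys.lin {ι U V : Type} {F : Set (ι → U)} {Φ : Set (U → V)} (h : Sys F Φ) (hF : Lin F) :
    Lin (Ed Φ F) := by
  rintro f ⟨φ, hφ, t, ht, rfl⟩ g hg x y hxy ⟨i, rfl⟩ ⟨j, rfl⟩ hx hy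
  obtain ⟨t', ht', rfl⟩ := h.strong φ hφ g hg _ _ hxy ⟨t i, rfl⟩ ⟨t j, rfl⟩ hx hy
  obtain ⟨i', hi'⟩ := hx
  obtain ⟨j', hj'⟩ := hy
  have := hF t ht t' ht' (t i) (t j) (fun e => hxy (by simp [e])) ⟨i, rfl⟩ ⟨j, rfl⟩
    ⟨i', h.inj φ hφ hi'⟩ ⟨j', h.inj φ hφ hj'⟩
  rw [this]

/-- Short walks with ends in `S` have an ear or stay inside `S`. -/
def Conv {ι V : Type} (M : ℕ) (E : Set (ι → V)) (S : Set V) : Prop :=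
  ∀ (n : ℕ) (x : ℕ → V), n + 2 ≤ M → (∀ i < n, Co2 (eb E) (x i) (x (i + 1))) →
    x 0 ∈ S → x n ∈ S →
    (∃ i, i + 2 ≤ n ∧ Co3 (eb E) (x i) (x (i + 1)) (x (i + 2))) ∨ ∀ i ≤ n, x i ∈ S

/-- The vertices lying over an edge `e` of the template. -/
def partD {ι V W : Type} (π : V → W) (D : Set V) (e : ι → W) : Set V :=
  {x | x ∈ D ∧ π x ∈ Set.range e}

/-- The edges lying over an edge `e` of the template. -/
def partE {ι U V W : Type} (π : V → W) (Φ : Set (U → V)) (F : Set (ι → U)) (e : ι → W) :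
    Set (ι → V) :=
  {f | f ∈ Ed Φ F ∧ π ∘ f = e}

open Classical in
/-- The embedding of the `g`-th copy of a picture into the amalgam. -/
noncomputable def emb {ι V W T G X : Type} (π : V → W) (e : ι → W) (τ : G → T → T × X)
    (A : G → V → T) (g : G) (x : V) : (T × X) ⊕ (G × V) :=
  if π x ∈ Set.range e then Sum.inl (τ g (A g x)) else Sum.inr (g, x)

/-- The projection of the amalgam to the template. -/
def proj {ι V W T G X : Type} (π : V → W) (e : ι → W) (clT : T → ι) : (T × X) ⊕ (G × V) → W :=
  Sum.elim (fun p => e (clT p.1)) (fun q => π q.2)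

/-- The copies in the amalgam. -/
def embΦ {ι U V W T G X : Type} (π : V → W) (e : ι → W) (τ : G → T → T × X)
    (A : G → V → T) (Φ : Set (U → V)) : Set (U → (T × X) ⊕ (G × V)) :=
  {φ' | ∃ g, ∃ φ ∈ Φ, φ' = emb π e τ A g ∘ φ}

/-- The data of an amalgamation of copies of a picture over a cover of the hypergraph `ET`. -/
structure Amalg {ι U V W T G X : Type} (F : Set (ι → U)) (𝒲 : Set (U → W)) (π : V → W)
    (Φ : Set (U → V)) (D : Set V) (e : ι → W) (clT : T → ι) (ET : Set (ι → T))
    (τ : G → T → T × X) (A : G → V → T) (M : ℕ) : Prop where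
  linF : Lin F
  sys : Sys F Φ
  tinj : ∀ B ∈ 𝒲, Function.Injective B
  hproj : ∀ φ ∈ Φ, π ∘ φ ∈ 𝒲
  mem : ∀ φ ∈ Φ, ∀ u, φ u ∈ D
  einj : Function.Injective e
  clT_edge : ∀ t ∈ ET, ∀ i, clT (t i) = i
  linT : Lin ET
  earT : PathEar (eb ET) M
  fst : ∀ g v, (τ g v).1 = v
  cap : ∀ g g' v w, g ≠ g' → v ≠ w → τ g v = τ g' v → τ g w = τ g' w →
    ∃ t ∈ ET, v ∈ Set.range t ∧ w ∈ Set.range t ∧ τ g ∘ t = τ g' ∘ t ∧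
      ∀ u, τ g u = τ g' u → u ∈ Set.range t
  earτ : PathEar (Set.range fun g => Set.range (τ g)) (M + 1)
  injA : ∀ g, Set.InjOn (A g) (partD π D e)
  clA : ∀ g, ∀ x ∈ partD π D e, e (clT (A g x)) = π x
  edgeA : ∀ g, ∀ f ∈ partE π Φ F e, A g ∘ f ∈ ET
  strongA : ∀ g, ∀ t ∈ ET, ∀ x ∈ partD π D e, ∀ y ∈ partD π D e, x ≠ y →
    A g x ∈ Set.range t → A g y ∈ Set.range t → ∃ f ∈ partE π Φ F e, t = A g ∘ f
  convA : ∀ g, Conv M ET (A g '' partD π D e)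

section
variable {ι U V W T G X : Type} {F : Set (ι → U)} {𝒲 : Set (U → W)} {π : V → W}
    {Φ : Set (U → V)} {D : Set V} {e : ι → W} {clT : T → ι} {ET : Set (ι → T)}
    {τ : G → T → T × X} {A : G → V → T} {M : ℕ}

lemma emb_of_mem {g : G} {x : V} (h : π x ∈ Set.range e) :
    emb π e τ A g x = Sum.inl (τ g (A g x)) := if_pos h

lemma emb_of_notMem {g : G} {x : V} (h : π x ∉ Set.range e) :
    emb π e τ A g x = Sum.inr (g, x) := if_neg h

lemma emb_eq_inl {g : G} {x : V} {p : T × X} (h : emb π e τ A g x = Sum.inl p) :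
    π x ∈ Set.range e ∧ τ g (A g x) = p := by
  by_cases hx : π x ∈ Set.range e
  · rw [emb_of_mem hx] at h
    exact ⟨hx, Sum.inl.inj h⟩
  · rw [emb_of_notMem hx] at h
    simp at h

lemma emb_eq_inr {g : G} {x : V} {p : G × V} (h : emb π e τ A g x = Sum.inr p) :
    π x ∉ Set.range e ∧ (g, x) = p := by
  by_cases hx : π x ∈ Set.range e
  · rw [emb_of_mem hx] at h
    simp at h
  · rw [emb_of_notMem hx] at h
    exact ⟨hx, Sum.inr.inj h⟩

lemma mem_of_mem_Ed (hmem : ∀ φ ∈ Φ, ∀ u, φ u ∈ D) {f : ι → V} (hf : f ∈ Ed Φ F) (i : ι) :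
    f i ∈ D := by
  obtain ⟨φ, hφ, t, -, rfl⟩ := hf
  exact hmem φ hφ _

lemma mem_partD_of_mem_partE (hmem : ∀ φ ∈ Φ, ∀ u, φ u ∈ D) {f : ι → V}
    (hf : f ∈ partE π Φ F e) (i : ι) : f i ∈ partD π D e :=
  ⟨mem_of_mem_Ed hmem hf.1 i, i, (congrFun hf.2 i).symm⟩

namespace Amalg

lemma τ_fst_eq (h : Amalg F 𝒲 π Φ D e clT ET τ A M) {g g' : G} {v w : T}
    (hv : τ g v = τ g' w) : v = w := by
  rw [← h.fst g v, hv, h.fst]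

lemma proj_emb (h : Amalg F 𝒲 π Φ D e clT ET τ A M) {g : G} {x : V} (hx : x ∈ D) :
    proj π e clT (emb π e τ A g x) = π x := by
  by_cases hx' : π x ∈ Set.range e
  · rw [emb_of_mem hx']
    simp only [proj, Sum.elim_inl, h.fst]
    exact h.clA g x ⟨hx, hx'⟩
  · rw [emb_of_notMem hx']
    rfl

lemma emb_injOn (h : Amalg F 𝒲 π Φ D e clT ET τ A M) (g : G) :
    Set.InjOn (emb π e τ A g) D := by
  intro x hx y hy hxy
  by_cases hx' : π x ∈ Set.range e
  · rw [emb_of_mem hx'] at hxy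
    obtain ⟨hy', hxy⟩ := emb_eq_inl hxy.symm
    exact h.injA g ⟨hx, hx'⟩ ⟨hy, hy'⟩ (h.τ_fst_eq hxy).symm
  · rw [emb_of_notMem hx'] at hxy
    have := (emb_eq_inr hxy.symm).2
    simp only [Prod.mk.injEq, true_and] at this
    exact this.symm

lemma emb_comp_edge {g : G} {f : ι → V} (hf : f ∈ partE π Φ F e) :
    emb π e τ A g ∘ f = fun i => Sum.inl (τ g (A g (f i))) := by
  funext i
  exact emb_of_mem ⟨i, (congrFun hf.2 i).symm⟩

lemma emb_shared {g g' : G} (hg : g ≠ g') {x y : V}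
    (hxy : emb π e τ A g x = emb π e τ A g' y) :
    π x ∈ Set.range e ∧ π y ∈ Set.range e ∧ τ g (A g x) = τ g' (A g' y) := by
  by_cases hx' : π x ∈ Set.range e
  · rw [emb_of_mem hx'] at hxy
    obtain ⟨hy', hxy⟩ := emb_eq_inl hxy.symm
    exact ⟨hx', hy', hxy.symm⟩
  · rw [emb_of_notMem hx'] at hxy
    have := (emb_eq_inr hxy.symm).2
    simp only [Prod.mk.injEq] at this
    exact absurd this.1.symm hg

lemma shared_edge (h : Amalg F 𝒲 π Φ D e clT ET τ A M) {g g' : G} (hg : g ≠ g') {x y x' y' : V}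
    (hx : x ∈ D) (hy : y ∈ D) (hx' : x' ∈ D) (hy' : y' ∈ D) (hxy : x ≠ y)
    (hxx : emb π e τ A g x = emb π e τ A g' x') (hyy : emb π e τ A g y = emb π e τ A g' y') :
    ∃ f ∈ partE π Φ F e, ∃ f' ∈ partE π Φ F e, emb π e τ A g ∘ f = emb π e τ A g' ∘ f' ∧
      x ∈ Set.range f ∧ y ∈ Set.range f ∧ x' ∈ Set.range f' ∧ y' ∈ Set.range f' ∧
      ∀ z z', emb π e τ A g z = emb π e τ A g' z' →
        emb π e τ A g z ∈ Set.range (emb π e τ A g ∘ f) := by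
  obtain ⟨hxe, hxe', hxτ⟩ := emb_shared hg hxx
  obtain ⟨hye, hye', hyτ⟩ := emb_shared hg hyy
  have h1 := h.τ_fst_eq hxτ
  have h2 := h.τ_fst_eq hyτ
  have hA : A g x ≠ A g y := fun hh => hxy (h.injA g ⟨hx, hxe⟩ ⟨hy, hye⟩ hh)
  have hxy' : x' ≠ y' := by
    rintro rfl
    exact hA (h1.trans h2.symm)
  obtain ⟨t, ht, hxt, hyt, htt, hall⟩ := h.cap g g' _ _ hg hA (hxτ.trans (by rw [h1]))
    (hyτ.trans (by rw [h2]))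
  obtain ⟨f, hf, hft⟩ := h.strongA g t ht x ⟨hx, hxe⟩ y ⟨hy, hye⟩ hxy hxt hyt
  obtain ⟨f', hf', hft'⟩ := h.strongA g' t ht x' ⟨hx', hxe'⟩ y' ⟨hy', hye'⟩ hxy'
    (h1 ▸ hxt) (h2 ▸ hyt)
  have hmemf : ∀ {g f}, f ∈ partE π Φ F e → t = A g ∘ f → ∀ {x}, x ∈ partD π D e →
      A g x ∈ Set.range t → x ∈ Set.range f := by
    rintro g f hf rfl x hx ⟨i, hi⟩
    exact ⟨i, h.injA g (mem_partD_of_mem_partE h.mem hf i) hx hi⟩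
  refine ⟨f, hf, f', hf', ?_, hmemf hf hft ⟨hx, hxe⟩ hxt, hmemf hf hft ⟨hy, hye⟩ hyt,
    hmemf hf' hft' ⟨hx', hxe'⟩ (h1 ▸ hxt), hmemf hf' hft' ⟨hy', hye'⟩ (h2 ▸ hyt), ?_⟩
  · rw [emb_comp_edge hf, emb_comp_edge hf']
    funext i
    have e1 := congrFun hft i
    have e2 := congrFun hft' i
    have e3 := congrFun htt i
    simp only [Function.comp] at e1 e2 e3
    rw [← e1, ← e2, e3]
  · intro z z' hzz
    obtain ⟨hze, hze', hzτ⟩ := emb_shared hg hzz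
    have h3 := h.τ_fst_eq hzτ
    obtain ⟨i, hi⟩ := hall (A g z) (hzτ.trans (by rw [h3]))
    refine ⟨i, ?_⟩
    rw [emb_comp_edge hf, emb_of_mem hze, ← hi, hft]
    rfl

lemma mem_Ed_emb {g : G} {f : ι → V} (hf : f ∈ Ed Φ F) :
    emb π e τ A g ∘ f ∈ Ed (embΦ π e τ A Φ) F := by
  obtain ⟨φ, hφ, t, ht, rfl⟩ := hf
  exact ⟨_, ⟨g, φ, hφ, rfl⟩, t, ht, rfl⟩

lemma sys' (h : Amalg F 𝒲 π Φ D e clT ET τ A M) : Sys F (embΦ π e τ A Φ) where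
  inj := by
    rintro _ ⟨g, φ, hφ, rfl⟩ u v huv
    exact h.sys.inj φ hφ (h.emb_injOn g (h.mem φ hφ u) (h.mem φ hφ v) huv)
  strong := by
    rintro _ ⟨g, φ, hφ, rfl⟩ _ ⟨_, ⟨g', ψ, hψ, rfl⟩, t, ht, rfl⟩ x y hxy ⟨u, rfl⟩ ⟨v, rfl⟩ ⟨i, hi⟩
      ⟨j, hj⟩
    have hne : φ u ≠ φ v := fun hh => hxy (by simp [hh])
    by_cases hg : g = g'
    · subst hg
      have h1 := h.emb_injOn g (h.mem ψ hψ _) (h.mem φ hφ _) hi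
      have h2 := h.emb_injOn g (h.mem ψ hψ _) (h.mem φ hφ _) hj
      obtain ⟨t', ht', hh⟩ := h.sys.strong φ hφ (ψ ∘ t) ⟨ψ, hψ, t, ht, rfl⟩ (φ u) (φ v) hne
        ⟨u, rfl⟩ ⟨v, rfl⟩ ⟨i, h1⟩ ⟨j, h2⟩
      refine ⟨t', ht', ?_⟩
      rw [Function.comp_assoc, hh, Function.comp_assoc]
    · obtain ⟨f, hf, f', hf', hff, hxf, hyf, hxf', hyf', -⟩ := h.shared_edge hg (h.mem φ hφ u)
        (h.mem φ hφ v) (h.mem ψ hψ (t i)) (h.mem ψ hψ (t j)) hne hi.symm hj.symm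
      obtain ⟨s, hs, rfl⟩ := h.sys.strong φ hφ f hf.1 (φ u) (φ v) hne ⟨u, rfl⟩ ⟨v, rfl⟩ hxf hyf
      have hne' : ψ (t i) ≠ ψ (t j) := by
        intro hh
        apply hxy
        rw [← hi, ← hj]
        simp [hh]
      have := h.sys.lin h.linF f' hf'.1 (ψ ∘ t) ⟨ψ, hψ, t, ht, rfl⟩ _ _ hne' hxf' hyf' ⟨i, rfl⟩
        ⟨j, rfl⟩
      refine ⟨s, hs, ?_⟩
      rw [Function.comp_assoc, ← this, ← hff, Function.comp_assoc]
  link := by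
    rintro _ ⟨g, φ, hφ, rfl⟩ _ ⟨g', ψ, hψ, rfl⟩ hφψ x y hxy ⟨u, rfl⟩ ⟨v, rfl⟩ ⟨i, hi⟩ ⟨j, hj⟩
    have hne : φ u ≠ φ v := fun hh => hxy (by simp [hh])
    have hne' : ψ i ≠ ψ j := by
      intro hh
      apply hxy
      rw [← hi, ← hj]
      simp [hh]
    by_cases hg : g = g'
    · subst hg
      have h1 := h.emb_injOn g (h.mem ψ hψ _) (h.mem φ hφ _) hi
      have h2 := h.emb_injOn g (h.mem ψ hψ _) (h.mem φ hφ _) hj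
      obtain ⟨t, ht, t', ht', htt, hx, hy, hsub⟩ := h.sys.link φ hφ ψ hψ
        (fun hh => hφψ (by rw [hh])) (φ u) (φ v) hne ⟨u, rfl⟩ ⟨v, rfl⟩ ⟨i, h1⟩ ⟨j, h2⟩
      refine ⟨t, ht, t', ht', ?_, ?_, ?_, ?_⟩
      · rw [Function.comp_assoc, htt, Function.comp_assoc]
      · obtain ⟨k, hk⟩ := hx
        exact ⟨k, congrArg (emb π e τ A g) hk⟩
      · obtain ⟨k, hk⟩ := hy
        exact ⟨k, congrArg (emb π e τ A g) hk⟩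
      · rintro _ ⟨⟨p, rfl⟩, q, hq⟩
        have h3 := h.emb_injOn g (h.mem ψ hψ _) (h.mem φ hφ _) hq
        obtain ⟨k, hk⟩ := hsub ⟨⟨p, rfl⟩, q, h3⟩
        exact ⟨k, congrArg (emb π e τ A g) hk⟩
    · obtain ⟨f, hf, f', hf', hff, hxf, hyf, hxf', hyf', hall⟩ := h.shared_edge hg (h.mem φ hφ u)
        (h.mem φ hφ v) (h.mem ψ hψ i) (h.mem ψ hψ j) hne hi.symm hj.symm
      obtain ⟨s, hs, rfl⟩ := h.sys.strong φ hφ f hf.1 (φ u) (φ v) hne ⟨u, rfl⟩ ⟨v, rfl⟩ hxf hyf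
      obtain ⟨s', hs', rfl⟩ := h.sys.strong ψ hψ f' hf'.1 (ψ i) (ψ j) hne' ⟨i, rfl⟩ ⟨j, rfl⟩
        hxf' hyf'
      refine ⟨s, hs, s', hs', hff, ?_, ?_, ?_⟩
      · obtain ⟨k, hk⟩ := hxf
        exact ⟨k, congrArg (emb π e τ A g) hk⟩
      · obtain ⟨k, hk⟩ := hyf
        exact ⟨k, congrArg (emb π e τ A g) hk⟩
      · rintro _ ⟨⟨p, rfl⟩, q, hq⟩
        exact hall (φ p) (ψ q) hq.symm

lemma hproj' (h : Amalg F 𝒲 π Φ D e clT ET τ A M) :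
    ∀ φ ∈ embΦ π e τ A Φ, proj π e clT ∘ φ ∈ 𝒲 := by
  rintro _ ⟨g, φ, hφ, rfl⟩
  have : proj π e clT ∘ emb π e τ A g ∘ φ = π ∘ φ := by
    funext u
    exact h.proj_emb (h.mem φ hφ u)
  rw [this]
  exact h.hproj φ hφ

lemma mem' (h : Amalg F 𝒲 π Φ D e clT ET τ A M) :
    ∀ φ ∈ embΦ π e τ A Φ, ∀ u, φ u ∈ ⋃ g, emb π e τ A g '' D := by
  rintro _ ⟨g, φ, hφ, rfl⟩ u
  exact Set.mem_iUnion.mpr ⟨g, φ u, h.mem φ hφ u, rfl⟩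

end Amalg
end

/-! ### Girth of the amalgam -/

/-- Pairwise adjacent points lie in a single block. -/
def Conf {V : Type} (B : Set (Set V)) : Prop :=
  ∀ K : Set V, K.Nonempty → (∀ x ∈ K, ∀ y ∈ K, Co2 B x y) → ∃ b ∈ B, K ⊆ b

/-- The blocks of the `g`-th copy in the amalgam, together with the edges of the cover. -/
def Blk {ι U V W T G X : Type} (π : V → W) (e : ι → W) (τ : G → T → T × X)
    (A : G → V → T) (Φ : Set (U → V)) (ET : Set (ι → T)) (g : G) :
    Set (Set ((T × X) ⊕ (G × V))) :=
  {b | (∃ φ ∈ Φ, b = Set.range (emb π e τ A g ∘ φ)) ∨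
    ∃ t ∈ ET, b = Set.range fun i => (Sum.inl (τ g (t i)) : (T × X) ⊕ (G × V))}

/-- The points of the `g`-th copy in the amalgam. -/
def Pts {ι V W T G X : Type} (π : V → W) (e : ι → W) (τ : G → T → T × X)
    (A : G → V → T) (D : Set V) (g : G) : Set ((T × X) ⊕ (G × V)) :=
  {p | (∃ x ∈ D, p = emb π e τ A g x) ∨ ∃ v, p = Sum.inl (τ g v)}

lemma Cyc.image {V V' : Type} {B : Set (Set V)} {M : ℕ} (h : Cyc B M) {D : Set V} {f : V → V'}
    (hf : Set.InjOn f D) (hB : ∀ b ∈ B, b ⊆ D) : Cyc ((fun b => f '' b) '' B) M := by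
  intro n x h1 hM hp hs
  have hy : ∀ i, ∃ y ∈ D, f y = x i := by
    intro i
    obtain ⟨_, ⟨b, hb, rfl⟩, ⟨y, hy, hyx⟩, -⟩ := hs i
    exact ⟨y, hB b hb hy, hyx⟩
  choose y hyD hyx using hy
  obtain ⟨i, b, hb, b1, b2, b3⟩ := h n y h1 hM
    (fun i => hf (hyD _) (hyD _) (by rw [hyx, hyx, hp]))
    (by
      intro i
      obtain ⟨_, ⟨b, hb, rfl⟩, ⟨z, hz, hzx⟩, ⟨w, hw, hwx⟩⟩ := hs i
      refine ⟨b, hb, ?_, ?_⟩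
      · rwa [hf (hyD i) (hB b hb hz) (by rw [hyx, hzx])]
      · rwa [hf (hyD (i + 1)) (hB b hb hw) (by rw [hyx, hwx])])
  exact ⟨i, _, ⟨b, hb, rfl⟩, ⟨_, b1, hyx _⟩, ⟨_, b2, hyx _⟩, ⟨_, b3, hyx _⟩⟩

lemma forall_of_forall_lt_of_periodic {P : ℕ → Prop} {n : ℕ} (hn : 1 ≤ n)
    (hP : ∀ i, P (i + n) ↔ P i) (a : ℕ) (h : ∀ i < n, P (a + i)) (i : ℕ) : P i := by
  have h1 : ∀ k, P (a + k) := by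
    intro k
    induction k using Nat.strong_induction_on with
    | _ k ih =>
      rcases Nat.lt_or_ge k n with hk | hk
      · exact h k hk
      · have e : a + k = a + (k - n) + n := by omega
        rw [e, hP]
        exact ih _ (by omega)
  have h2 : ∀ k, P (i + n * k) ↔ P i := by
    intro k
    induction k with
    | zero => simp
    | succ k ih => rw [Nat.mul_succ, ← Nat.add_assoc, hP, ih]
  rw [← h2 a]
  have h3 : a ≤ n * a := Nat.le_mul_of_pos_left a hn
  have e : i + n * a = a + (i + n * a - a) := by omega
  rw [e]
  exact h1 _

lemma exists_switch {P : ℕ → Prop} {n : ℕ} (hn : 1 ≤ n) (hP : ∀ i, P (i + n) ↔ P i) {a b : ℕ}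
    (ha : P a) (hb : ¬ P b) : ∃ j, P j ∧ ¬ P (j + 1) := by
  by_contra hcon
  push Not at hcon
  have h1 : ∀ k, P (a + k) := by
    intro k
    induction k with
    | zero => exact ha
    | succ k ih => exact hcon _ ih
  exact hb (forall_of_forall_lt_of_periodic hn hP a (fun i _ => h1 i) b)

section
variable {ι U V W T G X : Type} {F : Set (ι → U)} {𝒲 : Set (U → W)} {π : V → W}
    {Φ : Set (U → V)} {D : Set V} {e : ι → W} {clT : T → ι} {ET : Set (ι → T)}
    {τ : G → T → T × X} {A : G → V → T} {M : ℕ}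

namespace Amalg

lemma exists_of_mem_partD (h : Amalg F 𝒲 π Φ D e clT ET τ A M) {e' : ι → W}
    {y : (T × X) ⊕ (G × V)}
    (hy : y ∈ partD (proj π e clT) (⋃ g, emb π e τ A g '' D) e') :
    ∃ g, ∃ x ∈ partD π D e', y = emb π e τ A g x := by
  obtain ⟨hy1, hy2⟩ := hy
  obtain ⟨g, x, hx, rfl⟩ := Set.mem_iUnion.mp hy1
  rw [h.proj_emb hx] at hy2
  exact ⟨g, x, ⟨hx, hy2⟩, rfl⟩

lemma τ_injective (h : Amalg F 𝒲 π Φ D e clT ET τ A M) (g : G) : Function.Injective (τ g) :=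
  fun _ _ hvw => h.τ_fst_eq hvw

/-- A step inside a copy between points over `e` lies in an edge over `e`. -/
lemma exists_partE (h : Amalg F 𝒲 π Φ D e clT ET τ A M) (ht : Sys F 𝒲) (he : e ∈ Ed 𝒲 F)
    {φ : U → V} (hφ : φ ∈ Φ) {u v : U} (huv : φ u ≠ φ v) (hu : π (φ u) ∈ Set.range e)
    (hv : π (φ v) ∈ Set.range e) :
    ∃ t ∈ F, φ ∘ t ∈ partE π Φ F e ∧
      ∀ w, π (φ w) ∈ Set.range e → φ w ∈ Set.range (φ ∘ t) := by
  have hinj : Function.Injective (π ∘ φ) := h.tinj _ (h.hproj φ hφ)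
  obtain ⟨t, ht', hte⟩ := ht.strong (π ∘ φ) (h.hproj φ hφ) e he (π (φ u)) (π (φ v))
    (fun hh => huv (congrArg φ (hinj hh))) ⟨u, rfl⟩ ⟨v, rfl⟩ hu hv
  refine ⟨t, ht', ⟨⟨φ, hφ, t, ht', rfl⟩, by rw [hte]; rfl⟩, ?_⟩
  rintro w ⟨i, hi⟩
  refine ⟨i, ?_⟩
  have : (π ∘ φ) (t i) = (π ∘ φ) w := by
    rw [← Function.comp_apply (f := π ∘ φ) (g := t), ← hte, hi]
    rfl
  exact congrArg φ (hinj this)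

lemma inner_cyc (h : Amalg F 𝒲 π Φ D e clT ET τ A M) (ht : Sys F 𝒲) (he : e ∈ Ed 𝒲 F)
    (hear : PathEar (eb Φ) M) (g : G) : Cyc (Blk π e τ A Φ ET g) M := by
  intro n x h1 hM hp hs
  by_contra hno
  push Not at hno
  have hne : ∀ i, x i ≠ x (i + 1) := by
    intro i hi
    apply hno i
    rw [hi]
    exact (hs (i + 1)).co3_left
  have ha : Cyc ((fun b => emb π e τ A g '' b) '' eb Φ) M := by
    refine hear.cyc.image (h.emb_injOn g) ?_
    rintro _ ⟨φ, hφ, rfl⟩ _ ⟨u, rfl⟩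
    exact h.mem φ hφ u
  have hb : Cyc ((fun b => (fun v => (Sum.inl (τ g v) : (T × X) ⊕ (G × V))) '' b) '' eb ET) M := by
    refine h.earT.cyc.image (D := Set.univ) ?_ (fun _ _ => Set.subset_univ _)
    intro v _ w _ hvw
    exact h.τ_injective g (Sum.inl.inj hvw)
  set Sa : ℕ → Prop := fun i => ∃ φ ∈ Φ, x i ∈ Set.range (emb π e τ A g ∘ φ) ∧
    x (i + 1) ∈ Set.range (emb π e τ A g ∘ φ) with hSa
  set Sb : ℕ → Prop := fun i => ∃ t ∈ ET,
    x i ∈ Set.range (fun k => (Sum.inl (τ g (t k)) : (T × X) ⊕ (G × V))) ∧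
    x (i + 1) ∈ Set.range (fun k => (Sum.inl (τ g (t k)) : (T × X) ⊕ (G × V))) with hSb
  have hp1 : ∀ i, x (i + n + 1) = x (i + 1) := by
    intro i
    rw [← hp (i + 1)]
    congr 1
    omega
  have hSap : ∀ i, Sa (i + n) ↔ Sa i := by
    intro i
    simp only [hSa, hp, hp1]
  have hSbp : ∀ i, Sb (i + n) ↔ Sb i := by
    intro i
    simp only [hSb, hp, hp1]
  have hab : ∀ i, Sa i ∨ Sb i := by
    intro i
    obtain ⟨_, ⟨φ, hφ, rfl⟩ | ⟨t, ht, rfl⟩, b1, b2⟩ := hs i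
    · exact Or.inl ⟨φ, hφ, b1, b2⟩
    · exact Or.inr ⟨t, ht, b1, b2⟩
  have alla : ¬ ∀ i, Sa i := by
    intro hall
    obtain ⟨i, _, ⟨_, ⟨φ, hφ, rfl⟩, rfl⟩, hi⟩ := ha n x h1 hM hp (by
      intro i
      obtain ⟨φ, hφ, b1, b2⟩ := hall i
      rw [Set.range_comp] at b1 b2
      exact ⟨_, ⟨_, ⟨φ, hφ, rfl⟩, rfl⟩, b1, b2⟩)
    simp only [← Set.range_comp] at hi
    exact hno i ⟨_, Or.inl ⟨φ, hφ, rfl⟩, hi⟩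
  have allb : ¬ ∀ i, Sb i := by
    intro hall
    obtain ⟨i, _, ⟨_, ⟨t, ht, rfl⟩, rfl⟩, hi⟩ := hb n x h1 hM hp (by
      intro i
      obtain ⟨t, ht, b1, b2⟩ := hall i
      refine ⟨_, ⟨_, ⟨t, ht, rfl⟩, rfl⟩, ?_⟩
      simp only [← Set.range_comp]
      exact ⟨b1, b2⟩)
    simp only [← Set.range_comp] at hi
    exact hno i ⟨_, Or.inr ⟨t, ht, rfl⟩, hi⟩
  have hatob : ∀ i, Sa i → (∃ v, x i = Sum.inl (τ g v)) → (∃ v, x (i + 1) = Sum.inl (τ g v)) →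
      Sb i := by
    rintro i ⟨φ, hφ, ⟨u, hu⟩, ⟨v, hv⟩⟩ ⟨a, ha⟩ ⟨b, hb⟩
    have huv : φ u ≠ φ v := by
      intro hh
      apply hne i
      rw [← hu, ← hv]
      simp [hh]
    obtain ⟨hue, -⟩ := emb_eq_inl (hu.trans ha)
    obtain ⟨hve, -⟩ := emb_eq_inl (hv.trans hb)
    obtain ⟨t, -, htE, hall⟩ := h.exists_partE ht he hφ huv hue hve
    refine ⟨_, h.edgeA g _ htE, ?_, ?_⟩
    · obtain ⟨k, hk⟩ := hall u hue
      refine ⟨k, ?_⟩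
      rw [← hu]
      simp only [Function.comp] at hk ⊢
      rw [emb_of_mem hue, hk]
    · obtain ⟨k, hk⟩ := hall v hve
      refine ⟨k, ?_⟩
      rw [← hv]
      simp only [Function.comp] at hk ⊢
      rw [emb_of_mem hve, hk]
  have hbtoa : ∀ i, Sb i → (∃ a ∈ D, x i = emb π e τ A g a) →
      (∃ a ∈ D, x (i + 1) = emb π e τ A g a) → Sa i := by
    rintro i ⟨t, htE, ⟨k, hk⟩, ⟨l, hl⟩⟩ ⟨a, haD, ha⟩ ⟨b, hbD, hb⟩
    obtain ⟨hae, ha'⟩ := emb_eq_inl (ha.symm.trans hk.symm)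
    obtain ⟨hbe, hb'⟩ := emb_eq_inl (hb.symm.trans hl.symm)
    have hab : a ≠ b := by
      rintro rfl
      exact hne i (ha.trans hb.symm)
    obtain ⟨f, hf, rfl⟩ := h.strongA g t htE a ⟨haD, hae⟩ b ⟨hbD, hbe⟩ hab
      ⟨k, (h.τ_injective g ha').symm⟩ ⟨l, (h.τ_injective g hb').symm⟩
    obtain ⟨φ, hφ, s, hs, rfl⟩ := hf.1
    have := emb_comp_edge (τ := τ) (A := A) (g := g) hf
    refine ⟨φ, hφ, ⟨s k, ?_⟩, ⟨s l, ?_⟩⟩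
    · rw [← hk]; exact congrFun this k
    · rw [← hl]; exact congrFun this l
  have hSaD : ∀ i, Sa i → (∃ a ∈ D, x i = emb π e τ A g a) ∧
      (∃ a ∈ D, x (i + 1) = emb π e τ A g a) := by
    rintro i ⟨φ, hφ, ⟨u, hu⟩, ⟨v, hv⟩⟩
    exact ⟨⟨_, h.mem φ hφ u, hu.symm⟩, ⟨_, h.mem φ hφ v, hv.symm⟩⟩
  have hSbT : ∀ i, Sb i → (∃ v, x i = Sum.inl (τ g v)) ∧ (∃ v, x (i + 1) = Sum.inl (τ g v)) := by
    rintro i ⟨t, -, ⟨u, hu⟩, ⟨v, hv⟩⟩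
    exact ⟨⟨_, hu.symm⟩, ⟨_, hv.symm⟩⟩
  push Not at alla allb
  obtain ⟨i0, hi0⟩ := alla
  obtain ⟨i1, hi1⟩ := allb
  obtain ⟨j, hj, hj1⟩ := exists_switch h1 hSap ((hab i1).resolve_right hi1) hi0
  have hex : ∃ s, Sa (j + 1 + s) := ⟨n - 1, by
    have e : j + 1 + (n - 1) = j + n := by omega
    rw [e, hSap]
    exact hj⟩
  classical
  obtain ⟨s, hs1, hs2⟩ : ∃ s, Sa (j + 1 + s) ∧ ∀ i < s, ¬ Sa (j + 1 + i) :=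
    ⟨Nat.find hex, Nat.find_spec hex, fun i hi => Nat.find_min hex hi⟩
  have hs0 : 1 ≤ s := by
    rcases Nat.eq_zero_or_pos s with rfl | h0
    · exact absurd hs1 hj1
    · exact h0
  have hsn : s ≤ n - 1 := by
    by_contra hcon
    apply hs2 (n - 1) (by omega)
    have e : j + 1 + (n - 1) = j + n := by omega
    rw [e, hSap]
    exact hj
  have hSbs : ∀ i < s, Sb (j + 1 + i) := fun i hi => (hab _).resolve_left (hs2 i hi)
  have hpt : ∀ i ≤ s, ∃ v, x (j + 1 + i) = Sum.inl (τ g v) := by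
    intro i hi
    rcases hi.lt_or_eq with h2 | rfl
    · exact (hSbT _ (hSbs i h2)).1
    · have := (hSbT _ (hSbs (i - 1) (by omega))).2
      have e : j + 1 + (i - 1) + 1 = j + 1 + i := by omega
      rwa [e] at this
  rcases hsn.lt_or_eq with hlt | heq
  · obtain ⟨v0, -⟩ := hpt 0 (by omega)
    have hz : ∀ i, ∃ v, i ≤ s → x (j + 1 + i) = Sum.inl (τ g v) := by
      intro i
      by_cases hi : i ≤ s
      · obtain ⟨v, hv⟩ := hpt i hi
        exact ⟨v, fun _ => hv⟩
      · exact ⟨v0, fun hh => absurd hh hi⟩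
    choose z hz using hz
    have hlift : ∀ i ≤ s, (∃ a ∈ D, x (j + 1 + i) = emb π e τ A g a) →
        z i ∈ A g '' partD π D e := by
      rintro i hi ⟨a, haD, ha⟩
      obtain ⟨hae, ha'⟩ := emb_eq_inl (ha.symm.trans (hz i hi))
      exact ⟨a, ⟨haD, hae⟩, h.τ_injective g ha'⟩
    have hunlift : ∀ i ≤ s, z i ∈ A g '' partD π D e →
        (∃ a ∈ D, x (j + 1 + i) = emb π e τ A g a) := by
      rintro i hi ⟨a, haD, ha⟩
      refine ⟨a, haD.1, ?_⟩
      rw [emb_of_mem haD.2, ha, hz i hi]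
    have hmemz : ∀ i ≤ s, ∀ t : ι → T,
        x (j + 1 + i) ∈ Set.range (fun k => (Sum.inl (τ g (t k)) : (T × X) ⊕ (G × V))) →
        z i ∈ Set.range t := by
      rintro i hi t ⟨k, hk⟩
      exact ⟨k, h.τ_injective g (Sum.inl.inj (hk.trans (hz i hi)))⟩
    rcases h.convA g s z (by omega) (by
        intro i hi
        obtain ⟨t, htE, b1, b2⟩ := hSbs i hi
        exact ⟨_, ⟨t, htE, rfl⟩, hmemz i (by omega) t b1, hmemz (i + 1) (by omega) t b2⟩)
      (hlift 0 (by omega) (hSaD j hj).2) (hlift s le_rfl (hSaD _ hs1).1) with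
      ⟨i, hi, _, ⟨t, htE, rfl⟩, ⟨k1, hk1⟩, ⟨k2, hk2⟩, ⟨k3, hk3⟩⟩ | hall
    · apply hno (j + 1 + i)
      refine ⟨_, Or.inr ⟨t, htE, rfl⟩, ⟨k1, ?_⟩, ⟨k2, ?_⟩, ⟨k3, ?_⟩⟩
      · simp only [hk1]; exact (hz i (by omega)).symm
      · simp only [hk2]; exact (hz (i + 1) (by omega)).symm
      · simp only [hk3]; exact (hz (i + 2) (by omega)).symm
    · apply hj1
      exact hbtoa _ ((hab _).resolve_left hj1) (hunlift 0 (by omega) (hall 0 (by omega)))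
        (hunlift 1 (by omega) (hall 1 (by omega)))
  · apply hi1
    refine forall_of_forall_lt_of_periodic h1 hSbp (j + 1) ?_ i1
    intro i hi
    rcases Nat.lt_or_ge i s with h2 | h2
    · exact hSbs i h2
    · have hie : i = s := by omega
      subst hie
      apply hatob _ hs1 (hpt i le_rfl)
      have := hpt 0 (by omega)
      have e : j + 1 + i + 1 = (j + 1 + 0) + n := by omega
      rw [e, hp]
      exact this

end Amalg
end

/-- The colouring property of a picture with respect to a set `𝒰` of processed edges. -/
def RS {ι U V W : Type} (C : Type) (F : Set (ι → U)) (𝒲 : Set (U → W)) (π : V → W)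
    (Φ : Set (U → V)) (𝒰 : Set (ι → W)) : Prop :=
  ∀ c : (ι → V) → C, ∃ κ : (ι → W) → C, ∀ B ∈ 𝒲, ∃ φ ∈ Φ, π ∘ φ = B ∧
    ∀ t ∈ F, B ∘ t ∈ 𝒰 → c (φ ∘ t) = κ (B ∘ t)

section
variable {ι U V W T G X : Type} {F : Set (ι → U)} {𝒲 : Set (U → W)} {π : V → W}
    {Φ : Set (U → V)} {D : Set V} {e : ι → W} {clT : T → ι} {ET : Set (ι → T)}
    {τ : G → T → T × X} {A : G → V → T} {M : ℕ}

namespace Amalg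

lemma rs_insert (h : Amalg F 𝒲 π Φ D e clT ET τ A M) {C : Type} {𝒰 : Set (ι → W)}
    (hcov : ∀ c : (ι → T × X) → C, ∃ g k, ∀ f ∈ partE π Φ F e, c (τ g ∘ A g ∘ f) = k)
    (hrs : RS C F 𝒲 π Φ 𝒰) :
    RS C F 𝒲 (proj π e clT) (embΦ π e τ A Φ) (insert e 𝒰) := by
  classical
  intro c
  obtain ⟨g, k, hk⟩ := hcov fun f => c (Sum.inl ∘ f)
  obtain ⟨κ, hκ⟩ := hrs fun f => c (emb π e τ A g ∘ f)
  refine ⟨fun f => if f = e then k else κ f, fun B hB => ?_⟩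
  obtain ⟨φ, hφ, hφB, hφc⟩ := hκ B hB
  refine ⟨_, ⟨g, φ, hφ, rfl⟩, ?_, ?_⟩
  · rw [← hφB]
    funext u
    exact h.proj_emb (h.mem φ hφ u)
  · intro t ht htU
    beta_reduce
    by_cases hte : B ∘ t = e
    · rw [if_pos hte]
      have hf : φ ∘ t ∈ partE π Φ F e := ⟨⟨φ, hφ, t, ht, rfl⟩, by
        rw [← hte, ← hφB]
        rfl⟩
      rw [← hk _ hf, Function.comp_assoc, emb_comp_edge hf]
      rfl
    · rw [if_neg hte]
      exact hφc t ht (htU.resolve_left hte)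

lemma mem_Pts_of_Co2 {g : G} (hmem : ∀ φ ∈ Φ, ∀ u, φ u ∈ D) {p q : (T × X) ⊕ (G × V)}
    (hpq : Co2 (Blk π e τ A Φ ET g) p q) :
    p ∈ Pts π e τ A D g ∧ q ∈ Pts π e τ A D g := by
  obtain ⟨_, ⟨φ, hφ, rfl⟩ | ⟨t, -, rfl⟩, ⟨u, hu⟩, ⟨v, hv⟩⟩ := hpq
  · exact ⟨Or.inl ⟨_, hmem φ hφ u, hu.symm⟩, Or.inl ⟨_, hmem φ hφ v, hv.symm⟩⟩
  · exact ⟨Or.inr ⟨_, hu.symm⟩, Or.inr ⟨_, hv.symm⟩⟩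

lemma exists_of_mem_Pts_inter (h : Amalg F 𝒲 π Φ D e clT ET τ A M) {g g' : G} (hg : g ≠ g')
    {p : (T × X) ⊕ (G × V)} (h1 : p ∈ Pts π e τ A D g) (h2 : p ∈ Pts π e τ A D g') :
    ∃ v, p = Sum.inl (τ g v) ∧ τ g v = τ g' v := by
  rcases h1 with ⟨x, hx, rfl⟩ | ⟨v, rfl⟩
  · rcases h2 with ⟨y, hy, hxy⟩ | ⟨w, hw⟩
    · obtain ⟨hxe, -, hτ⟩ := emb_shared hg hxy
      exact ⟨A g x, emb_of_mem hxe, hτ.trans (by rw [h.τ_fst_eq hτ])⟩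
    · obtain ⟨hxe, hτ⟩ := emb_eq_inl hw
      exact ⟨A g x, emb_of_mem hxe, hτ.trans (by rw [h.τ_fst_eq hτ])⟩
  · rcases h2 with ⟨y, hy, hxy⟩ | ⟨w, hw⟩
    · obtain ⟨hxe, hτ⟩ := emb_eq_inl hxy.symm
      exact ⟨v, rfl, hτ.symm.trans (by rw [h.τ_fst_eq hτ])⟩
    · have hτ := Sum.inl.inj hw
      exact ⟨v, rfl, hτ.trans (by rw [h.τ_fst_eq hτ])⟩

lemma exists_inl_of_mem_Pts {g : G} {p : T × X}
    (h1 : (Sum.inl p : (T × X) ⊕ (G × V)) ∈ Pts π e τ A D g) : ∃ v, p = τ g v := by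
  rcases h1 with ⟨x, hx, hp⟩ | ⟨v, hv⟩
  · exact ⟨_, (emb_eq_inl hp.symm).2.symm⟩
  · exact ⟨v, Sum.inl.inj hv⟩

lemma Co2_of_mem_Pts_inter (h : Amalg F 𝒲 π Φ D e clT ET τ A M) {g g' : G} (hg : g ≠ g')
    {p q : (T × X) ⊕ (G × V)} (hpq : p ≠ q) (h1 : p ∈ Pts π e τ A D g)
    (h2 : p ∈ Pts π e τ A D g') (h3 : q ∈ Pts π e τ A D g) (h4 : q ∈ Pts π e τ A D g') :
    Co2 (Blk π e τ A Φ ET g) p q := by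
  obtain ⟨v, rfl, hv⟩ := h.exists_of_mem_Pts_inter hg h1 h2
  obtain ⟨w, rfl, hw⟩ := h.exists_of_mem_Pts_inter hg h3 h4
  obtain ⟨t, ht, ⟨i, rfl⟩, ⟨j, rfl⟩, -⟩ := h.cap g g' v w hg (fun hh => hpq (by rw [hh])) hv hw
  exact ⟨_, Or.inr ⟨t, ht, rfl⟩, ⟨i, rfl⟩, ⟨j, rfl⟩⟩

/-- If a step of a copy lies in an edge of the cover, then that edge is covered by a copy. -/
lemma exists_cover_edge (h : Amalg F 𝒲 π Φ D e clT ET τ A M) {g : G} {t : ι → T} (ht : t ∈ ET)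
    {p q : (T × X) ⊕ (G × V)} (hpq : p ≠ q) (hΦ : Co2 (eb (embΦ π e τ A Φ)) p q)
    (hp : p ∈ Set.range fun i => (Sum.inl (τ g (t i)) : (T × X) ⊕ (G × V)))
    (hq : q ∈ Set.range fun i => (Sum.inl (τ g (t i)) : (T × X) ⊕ (G × V))) :
    ∃ b ∈ eb (embΦ π e τ A Φ),
      (Set.range fun i => (Sum.inl (τ g (t i)) : (T × X) ⊕ (G × V))) ⊆ b := by
  obtain ⟨_, ⟨_, ⟨g', φ, hφ, rfl⟩, rfl⟩, ⟨u, rfl⟩, ⟨v, rfl⟩⟩ := hΦ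
  obtain ⟨i, hi⟩ := hp
  obtain ⟨j, hj⟩ := hq
  obtain ⟨hue, huτ⟩ := emb_eq_inl hi.symm
  obtain ⟨hve, hvτ⟩ := emb_eq_inl hj.symm
  have huv : φ u ≠ φ v := fun hh => hpq (by simp [hh])
  have hu := h.τ_fst_eq huτ
  have hv := h.τ_fst_eq hvτ
  have htij : t i ≠ t j := by
    intro hh
    apply hpq
    rw [← hi, ← hj]
    beta_reduce
    rw [hh]
  obtain ⟨f, hf, hft⟩ := h.strongA g' t ht (φ u) ⟨h.mem φ hφ u, hue⟩ (φ v) ⟨h.mem φ hφ v, hve⟩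
    huv ⟨i, hu.symm⟩ ⟨j, hv.symm⟩
  have hgg : τ g ∘ t = τ g' ∘ t := by
    by_cases hg : g = g'
    · rw [hg]
    · rw [hu] at huτ
      rw [hv] at hvτ
      obtain ⟨t0, ht0, h1, h2, h3, -⟩ := h.cap g g' (t i) (t j) hg htij huτ.symm hvτ.symm
      rwa [h.linT t ht t0 ht0 _ _ htij ⟨i, rfl⟩ ⟨j, rfl⟩ h1 h2]
  obtain ⟨ψ, hψ, s, hs, hfs⟩ := hf.1
  refine ⟨_, ⟨_, ⟨g', ψ, hψ, rfl⟩, rfl⟩, ?_⟩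
  rintro _ ⟨k, rfl⟩
  refine ⟨s k, ?_⟩
  have h4 := congrFun (emb_comp_edge (τ := τ) (A := A) (g := g') hf) k
  have h5 := congrFun hgg k
  have h6 := congrFun hfs k
  have h7 := congrFun hft k
  simp only [Function.comp] at h4 h5 h6 h7 ⊢
  rw [← h6, h4, ← h7, h5]

lemma Co3_of_Blk (h : Amalg F 𝒲 π Φ D e clT ET τ A M) {g : G}
    {p q r : (T × X) ⊕ (G × V)} (hpq : p ≠ q) (hΦ : Co2 (eb (embΦ π e τ A Φ)) p q)
    (h3 : Co3 (Blk π e τ A Φ ET g) p q r) : Co3 (eb (embΦ π e τ A Φ)) p q r := by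
  obtain ⟨_, ⟨φ, hφ, rfl⟩ | ⟨t, ht, rfl⟩, b1, b2, b3⟩ := h3
  · exact ⟨_, ⟨_, ⟨g, φ, hφ, rfl⟩, rfl⟩, b1, b2, b3⟩
  · obtain ⟨b, hb, hsub⟩ := h.exists_cover_edge ht hpq hΦ b1 b2
    exact ⟨b, hb, hsub b1, hsub b2, hsub b3⟩

theorem pathEar (h : Amalg F 𝒲 π Φ D e clT ET τ A M) (ht : Sys F 𝒲) (he : e ∈ Ed 𝒲 F)
    (hear : PathEar (eb Φ) M) : PathEar (eb (embΦ π e τ A Φ)) M := by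
  apply Cyc.pathEar
  intro n x₀ h1 hM hp₀ hs₀
  by_contra hno₀
  push Not at hno₀
  have main : ∀ x : ℕ → (T × X) ⊕ (G × V), (∀ i, x (i + n) = x i) →
      (∀ i, Co2 (eb (embΦ π e τ A Φ)) (x i) (x (i + 1))) →
      (∀ i, ¬ Co3 (eb (embΦ π e τ A Φ)) (x i) (x (i + 1)) (x (i + 2))) →
      (∃ g, ∀ i < n, Co2 (Blk π e τ A Φ ET g) (x i) (x (i + 1))) → False := by
    rintro x hp hs hno ⟨g, hg⟩
    have hne : ∀ i, x i ≠ x (i + 1) := by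
      intro i hi
      apply hno i
      rw [hi]
      exact (hs (i + 1)).co3_left
    have hall : ∀ i, Co2 (Blk π e τ A Φ ET g) (x i) (x (i + 1)) := by
      refine forall_of_forall_lt_of_periodic
        (P := fun i => Co2 (Blk π e τ A Φ ET g) (x i) (x (i + 1))) h1 ?_ 0 ?_
      · intro i
        have e1 : x (i + n + 1) = x (i + 1) := by
          rw [← hp (i + 1)]
          congr 1
          omega
        rw [hp, e1]
      · intro i hi
        simpa using hg i hi
    obtain ⟨i, hi⟩ := h.inner_cyc ht he hear g n x h1 hM hp hall
    exact hno i (h.Co3_of_Blk (hne i) (hs i) hi)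
  by_cases hinl : ∃ r p, x₀ r = Sum.inl p
  · obtain ⟨r, p, hr⟩ := hinl
    set x : ℕ → (T × X) ⊕ (G × V) := fun i => x₀ (r + i) with hx
    have hp : ∀ i, x (i + n) = x i := fun i => by
      simp only [hx, ← Nat.add_assoc, hp₀]
    have hs : ∀ i, Co2 (eb (embΦ π e τ A Φ)) (x i) (x (i + 1)) := fun i => hs₀ _
    have hno : ∀ i, ¬ Co3 (eb (embΦ π e τ A Φ)) (x i) (x (i + 1)) (x (i + 2)) := fun i => hno₀ _
    have hne : ∀ i, x i ≠ x (i + 1) := by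
      intro i hi
      apply hno i
      rw [hi]
      exact (hs (i + 1)).co3_left
    apply main x hp hs hno
    refine (exists_common_label
      (fun g p q => Co2 (eb (embΦ π e τ A Φ)) p q ∧ Co2 (Blk π e τ A Φ ET g) p q)
      (Pts π e τ A D) n h1 x ?_ (fun i _ => hne i) ?_ ?_ ?_).imp fun g hg i hi => (hg i hi).2
    · intro i hi
      obtain ⟨_, ⟨_, ⟨g, φ, hφ, rfl⟩, rfl⟩, b1, b2⟩ := hs i
      exact ⟨g, hs i, _, Or.inl ⟨φ, hφ, rfl⟩, b1, b2⟩
    · intro i j g hij hjn hjin hst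
      have key : ¬ Co2 (Blk π e τ A Φ ET g) (x i) (x j) := by
        intro hco
        have e1 : i + (j - i) = j := by omega
        obtain ⟨s, hs1, hs2⟩ := (h.inner_cyc ht he hear g).pathEar (j - i) (fun s => x (i + s))
          (by omega) (by omega) (fun s hs' => (hst (i + s) (by omega) (by omega)).2)
          (by simpa [e1] using hco)
        exact hno (i + s) (h.Co3_of_Blk (hne _) (hs _) hs2)
      have hi := (mem_Pts_of_Co2 h.mem (hst i le_rfl (by omega)).2).1
      have hj := (mem_Pts_of_Co2 h.mem (hst (j - 1) (by omega) (by omega)).2).2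
      have e2 : j - 1 + 1 = j := by omega
      rw [e2] at hj
      have hxij : x i ≠ x j := by
        intro hh
        apply key
        rw [← hh]
        exact (hst i le_rfl (by omega)).2.refl_left
      refine ⟨hxij, fun g' hi' hj' => ?_⟩
      by_contra hg
      exact key (h.Co2_of_mem_Pts_inter (Ne.symm hg) hxij hi hi' hj hj')
    · rintro g g' i hi ⟨hst1, hst2⟩ hxi hxi1
      refine ⟨hst1, ?_⟩
      by_cases hg : g' = g
      · rw [hg]; exact hst2
      · have := mem_Pts_of_Co2 h.mem hst2
        exact h.Co2_of_mem_Pts_inter hg (hne i) hxi this.1 hxi1 this.2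
    · intro q k w hq hk0 hkq hk hst hdist
      have hstart : ∀ j < q, x (k j) ∈ Pts π e τ A D (w j) := fun j hj =>
        (mem_Pts_of_Co2 h.mem (hst j hj (k j) le_rfl (hk j hj)).2).1
      have hend : ∀ j < q, x (k (j + 1)) ∈ Pts π e τ A D (w j) := by
        intro j hj
        have h2 := hk j hj
        have := (mem_Pts_of_Co2 h.mem (hst j hj (k (j + 1) - 1) (by omega) (by omega)).2).2
        have e2 : k (j + 1) - 1 + 1 = k (j + 1) := by omega
        rwa [e2] at this
      by_cases heq : ∃ j, j + 2 ≤ q ∧ w j = w (j + 1)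
      · obtain ⟨j, hj, hw⟩ := heq
        refine ⟨j, w j, hj, hstart j (by omega), hend j (by omega), ?_⟩
        rw [hw]
        exact hend (j + 1) (by omega)
      · push Not at heq
        have hx0 : x 0 = Sum.inl p := hr
        have hxn : x n = Sum.inl p := by
          have := hp 0
          rw [Nat.zero_add] at this
          rw [this, hx0]
        have hy : ∀ j, ∃ y, j ≤ q → x (k j) = Sum.inl y := by
          intro j
          by_cases hj : j ≤ q
          · rcases Nat.eq_zero_or_pos j with rfl | hj0
            · exact ⟨p, fun _ => by rw [hk0, hx0]⟩
            · rcases hj.lt_or_eq with hjq | rfl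
              · have e1 : j - 1 + 1 = j := by omega
                have h2 := hend (j - 1) (by omega)
                have h3 := heq (j - 1) (by omega)
                rw [e1] at h2 h3
                obtain ⟨v, hv, -⟩ := h.exists_of_mem_Pts_inter h3 h2 (hstart j hjq)
                exact ⟨_, fun _ => hv⟩
              · exact ⟨p, fun _ => by rw [hkq, hxn]⟩
          · exact ⟨p, fun hh => absurd hh hj⟩
        choose y hy using hy
        have hqn : ∀ j ≤ q, j ≤ k j := by
          intro j
          induction j with
          | zero => intro _; omega
          | succ j ih =>
            intro hj
            have := ih (by omega)
            have := hk j (by omega)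
            omega
        have hstepy : ∀ i < q, ∃ v v', y i = τ (w i) v ∧ y (i + 1) = τ (w i) v' := by
          intro i hi
          have h2 := hstart i hi
          have h3 := hend i hi
          rw [hy i (by omega)] at h2
          rw [hy (i + 1) (by omega)] at h3
          obtain ⟨v, hv⟩ := exists_inl_of_mem_Pts h2
          obtain ⟨v', hv'⟩ := exists_inl_of_mem_Pts h3
          exact ⟨v, v', hv, hv'⟩
        have hy0q : y 0 = y q := by
          have h2 := hy 0 (by omega)
          have h3 := hy q le_rfl
          rw [hk0, hx0] at h2
          rw [hkq, hxn] at h3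
          exact Sum.inl.inj (h2.symm.trans h3)
        obtain ⟨j, hj, _, ⟨g, rfl⟩, ⟨v1, hv1⟩, ⟨v2, hv2⟩, ⟨v3, hv3⟩⟩ := h.earτ q y hq
          (by have := hqn q le_rfl; omega)
          (by
            intro i hi
            obtain ⟨v, v', hv, hv'⟩ := hstepy i hi
            exact ⟨_, ⟨w i, rfl⟩, ⟨v, hv.symm⟩, ⟨v', hv'.symm⟩⟩)
          (by
            rw [← hy0q]
            obtain ⟨v, v', hv, hv'⟩ := hstepy 0 (by omega)
            exact ⟨_, ⟨w 0, rfl⟩, ⟨v, hv.symm⟩, ⟨v, hv.symm⟩⟩)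
        refine ⟨j, g, hj, Or.inr ⟨v1, ?_⟩, Or.inr ⟨v2, ?_⟩, Or.inr ⟨v3, ?_⟩⟩
        · rw [hv1]; exact hy j (by omega)
        · rw [hv2]; exact hy (j + 1) (by omega)
        · rw [hv3]; exact hy (j + 2) hj
  · push Not at hinl
    have hstep : ∀ i g z, x₀ i = Sum.inr (g, z) → Co2 (Blk π e τ A Φ ET g) (x₀ i) (x₀ (i + 1)) ∧
        ∃ z', x₀ (i + 1) = Sum.inr (g, z') := by
      intro i g z hi
      obtain ⟨_, ⟨_, ⟨g', φ, hφ, rfl⟩, rfl⟩, ⟨u, hu⟩, ⟨v, hv⟩⟩ := hs₀ i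
      have hgg : g' = g := by
        have := (emb_eq_inr (hu.trans hi)).2
        exact congrArg Prod.fst this
      subst hgg
      refine ⟨⟨_, Or.inl ⟨φ, hφ, rfl⟩, ⟨u, hu⟩, ⟨v, hv⟩⟩, φ v, ?_⟩
      rw [← hv]
      apply emb_of_notMem
      intro hve
      exact hinl (i + 1) _ (hv.symm.trans (emb_of_mem hve))
    obtain ⟨⟨g, z⟩, hgz⟩ : ∃ q, x₀ 0 = Sum.inr q := by
      rcases hx0 : x₀ 0 with q | q
      · exact absurd hx0 (hinl 0 q)
      · exact ⟨q, rfl⟩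
    have hall : ∀ i, ∃ z', x₀ i = Sum.inr (g, z') := by
      intro i
      induction i with
      | zero => exact ⟨z, hgz⟩
      | succ i ih =>
        obtain ⟨z', hz'⟩ := ih
        exact (hstep i g z' hz').2
    apply main x₀ hp₀ hs₀ hno₀
    refine ⟨g, fun i _ => ?_⟩
    obtain ⟨z', hz'⟩ := hall i
    exact (hstep i g z' hz').1

theorem conf (h : Amalg F 𝒲 π Φ D e clT ET τ A M) (ht : Sys F 𝒲) (he : e ∈ Ed 𝒲 F)
    (hM : 3 ≤ M) (hear : PathEar (eb (embΦ π e τ A Φ)) M) (hconf : Conf (eb Φ)) :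
    Conf (eb (embΦ π e τ A Φ)) := by
  intro K hK hco
  by_cases hinr : ∃ g z, Sum.inr (g, z) ∈ K
  · obtain ⟨g, z, hz⟩ := hinr
    have hpull : ∀ p ∈ K, ∃ x ∈ D, p = emb π e τ A g x := by
      intro p hp
      obtain ⟨_, ⟨_, ⟨g', φ, hφ, rfl⟩, rfl⟩, ⟨u, hu⟩, ⟨v, hv⟩⟩ := hco _ hz p hp
      have hgg : g' = g := congrArg Prod.fst (emb_eq_inr hu).2
      subst hgg
      exact ⟨φ v, h.mem φ hφ v, hv.symm⟩
    have hcoP : ∀ x ∈ D, ∀ y ∈ D, emb π e τ A g x ∈ K → emb π e τ A g y ∈ K →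
        Co2 (eb Φ) x y := by
      intro x hx y hy hxK hyK
      obtain ⟨_, ⟨_, ⟨g', φ, hφ, rfl⟩, rfl⟩, ⟨u, hu⟩, ⟨v, hv⟩⟩ := hco _ hxK _ hyK
      by_cases hg : g = g'
      · subst hg
        refine ⟨_, ⟨φ, hφ, rfl⟩, ?_, ?_⟩
        · exact ⟨u, h.emb_injOn g (h.mem φ hφ u) hx hu⟩
        · exact ⟨v, h.emb_injOn g (h.mem φ hφ v) hy hv⟩
      · by_cases hxy : x = y
        · subst hxy
          obtain ⟨_, ⟨_, ⟨g'', ψ, hψ, rfl⟩, rfl⟩, ⟨u, hu⟩, ⟨v, hv⟩⟩ := hco _ hz _ hxK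
          have hgg : g'' = g := congrArg Prod.fst (emb_eq_inr hu).2
          subst hgg
          have := h.emb_injOn g'' (h.mem ψ hψ v) hx hv
          exact ⟨_, ⟨ψ, hψ, rfl⟩, ⟨v, this⟩, ⟨v, this⟩⟩
        · obtain ⟨f, hf, -, -, -, ⟨i, rfl⟩, ⟨j, rfl⟩, -⟩ := h.shared_edge hg hx hy (h.mem φ hφ u)
            (h.mem φ hφ v) hxy hu.symm hv.symm
          obtain ⟨ψ, hψ, t, -, rfl⟩ := hf.1
          exact ⟨_, ⟨ψ, hψ, rfl⟩, ⟨t i, rfl⟩, ⟨t j, rfl⟩⟩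
    obtain ⟨x₀, hx₀, hx₀K⟩ := hpull _ hz
    obtain ⟨_, ⟨φ, hφ, rfl⟩, hsub⟩ := hconf {x | x ∈ D ∧ emb π e τ A g x ∈ K}
      ⟨x₀, hx₀, hx₀K ▸ hz⟩ (fun x hx y hy => hcoP x hx.1 y hy.1 hx.2 hy.2)
    refine ⟨_, ⟨_, ⟨g, φ, hφ, rfl⟩, rfl⟩, ?_⟩
    intro p hp
    obtain ⟨x, hx, rfl⟩ := hpull p hp
    obtain ⟨u, hu⟩ := hsub (a := x) ⟨hx, hp⟩
    exact ⟨u, congrArg (emb π e τ A g) hu⟩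
  · push Not at hinr
    have hinl : ∀ p ∈ K, proj π e clT p ∈ Set.range e := by
      rintro (p | ⟨g, z⟩) hp
      · exact ⟨clT p.1, rfl⟩
      · exact absurd hp (hinr g z)
    obtain ⟨p, hp⟩ := hK
    by_cases hsing : ∀ q ∈ K, q = p
    · obtain ⟨b, hb, hpb, -⟩ := hco p hp p hp
      exact ⟨b, hb, fun q hq => hsing q hq ▸ hpb⟩
    push Not at hsing
    obtain ⟨q, hq, hqp⟩ := hsing
    have htri : ∀ r ∈ K, ∃ f ∈ Ed (embΦ π e τ A Φ) F, p ∈ Set.range f ∧ q ∈ Set.range f ∧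
        r ∈ Set.range f := by
      intro r hr
      obtain ⟨_, ⟨φ, hφ, rfl⟩, hpφ, hqφ, hrφ⟩ : Co3 (eb (embΦ π e τ A Φ)) p q r := by
        obtain ⟨i, hi1, hi2⟩ := hear 2 (fun i => if i = 0 then p else if i = 1 then q else r)
          le_rfl (by omega) (by
            intro i hi
            interval_cases i
            · simpa using hco p hp q hq
            · simpa using hco q hq r hr) (by simpa using hco p hp r hr)
        obtain rfl : i = 0 := by omega
        simpa using hi2
      obtain ⟨u, rfl⟩ := hpφ
      obtain ⟨v, rfl⟩ := hqφ
      obtain ⟨w, rfl⟩ := hrφ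
      have hinj : Function.Injective (proj π e clT ∘ φ) := h.tinj _ (h.hproj' φ hφ)
      obtain ⟨t, ht', hte⟩ := ht.strong _ (h.hproj' φ hφ) e he _ _
        (fun hh => hqp (congrArg φ (hinj hh)).symm) ⟨u, rfl⟩ ⟨v, rfl⟩ (hinl _ hp) (hinl _ hq)
      have hmem : ∀ u, proj π e clT (φ u) ∈ Set.range e → φ u ∈ Set.range (φ ∘ t) := by
        rintro u ⟨i, hi⟩
        refine ⟨i, congrArg φ (hinj ?_)⟩
        rw [← Function.comp_apply (f := proj π e clT ∘ φ) (g := t), ← hte, hi]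
        rfl
      exact ⟨_, ⟨φ, hφ, t, ht', rfl⟩, hmem u (hinl _ hp), hmem v (hinl _ hq), hmem w (hinl _ hr)⟩
    obtain ⟨f, hf, hpf, hqf, -⟩ := htri p hp
    obtain ⟨φ, hφ, t, ht', rfl⟩ := hf
    refine ⟨_, ⟨φ, hφ, rfl⟩, ?_⟩
    intro r hr
    obtain ⟨f', hf', hpf', hqf', hrf'⟩ := htri r hr
    rw [h.sys'.lin h.linF f' hf' (φ ∘ t) ⟨φ, hφ, t, ht', rfl⟩ p q hqp.symm hpf' hqf' hpf hqf]
      at hrf'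
    obtain ⟨k, rfl⟩ := hrf'
    exact ⟨t k, rfl⟩

end Amalg
end

/-! ### Ramsey properties of partite hypergraphs and the picture step -/

/-- A well-behaved copy of the partite hypergraph `(D, E)` in the partite hypergraph `ET`. -/
structure GoodMap {ι V T : Type} (M : ℕ) (D : Set V) (cls : V → ι) (E : Set (ι → V)) (r : V → ℕ)
    (clT : T → ι) (ET : Set (ι → T)) (rT : T → ℕ) (A : V → T) : Prop where
  injOn : Set.InjOn A D
  cl : ∀ x ∈ D, clT (A x) = cls x
  mono : ∀ x ∈ D, ∀ y ∈ D, cls x = cls y → r x < r y → rT (A x) < rT (A y)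
  edge : ∀ f ∈ E, A ∘ f ∈ ET
  strong : ∀ t ∈ ET, ∀ x ∈ D, ∀ y ∈ D, x ≠ y → A x ∈ Set.range t → A y ∈ Set.range t →
    ∃ f ∈ E, t = A ∘ f
  conv : Conv M ET (Set.image A D)

/-- The partite hypergraph `(D, E)` has a Ramsey hypergraph without short cycles. -/
def Good {ι V : Type} (M : ℕ) (D : Set V) (cls : V → ι) (E : Set (ι → V)) (r : V → ℕ) : Prop :=
  ∀ (C : Type) [Finite C] [Nonempty C], ∃ (T : Type) (_ : Finite T) (clT : T → ι)
    (ET : Set (ι → T)) (rT : T → ℕ) (𝒜 : Set (V → T)),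
    (∀ t ∈ ET, ∀ i, clT (t i) = i) ∧ Lin ET ∧ PathEar (eb ET) M ∧
    (∀ A ∈ 𝒜, GoodMap M D cls E r clT ET rT A) ∧
    ∀ c : (ι → T) → C, ∃ A ∈ 𝒜, ∃ k, ∀ f ∈ E, c (A ∘ f) = k

/-- A partite hypergraph pasted together from copies of another one, the copies sharing only
vertices of the class `c`, sparsely. -/
structure Pasting {ι V V₁ J : Type} (M : ℕ) (D : Set V) (cls : V → ι) (E : Set (ι → V))
    (r : V → ℕ) (D₁ : Set V₁) (cls₁ : V₁ → ι) (E₁ : Set (ι → V₁)) (r₁ : V₁ → ℕ)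
    (ord : J → ℕ) (ε : J → V → V₁) (c : ι) : Prop where
  edge_mem : ∀ f ∈ E, ∀ i, f i ∈ D
  rank_inj : Function.Injective r
  ord_inj : Function.Injective ord
  injOn : ∀ j, Set.InjOn (ε j) D
  cls_eq : ∀ j, ∀ x ∈ D, cls₁ (ε j x) = cls x
  mono : ∀ j, ∀ x ∈ D, ∀ y ∈ D, cls x = cls y → r x < r y → r₁ (ε j x) < r₁ (ε j y)
  exists_eq : ∀ y ∈ D₁, ∃ j, ∃ x ∈ D, y = ε j x
  mem : ∀ j, ∀ x ∈ D, ε j x ∈ D₁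
  exists_edge : ∀ f ∈ E₁, ∃ j, ∃ f₀ ∈ E, f = ε j ∘ f₀
  edge : ∀ j, ∀ f ∈ E, ε j ∘ f ∈ E₁
  priv : ∀ j j', ∀ x ∈ D, ∀ x' ∈ D, cls x ≠ c → ε j x = ε j' x' → j = j'
  share : ∀ j j', ∀ x ∈ D, ∀ x' ∈ D, ∀ y ∈ D, ∀ y' ∈ D, cls x = c → cls y = c → j ≠ j' →
    ε j x = ε j' x' → ε j y = ε j' y' → x = y
  ord_mono : ∀ j j', ∀ x ∈ D, ∀ x' ∈ D, cls x ≠ c → cls x = cls x' → ord j < ord j' →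
    r₁ (ε j x) < r₁ (ε j' x')
  cyc : Cyc (Set.range fun j => ε j '' {x | x ∈ D ∧ cls x = c}) M

/-- The class of a vertex with respect to the template edge `e`. -/
noncomputable def fib {ι V W : Type} [Nonempty ι] (π : V → W) (e : ι → W) (x : V) : ι :=
  Function.invFun e (π x)

lemma apply_fib {ι V W : Type} [Nonempty ι] {π : V → W} {e : ι → W} {x : V}
    (h : π x ∈ Set.range e) : e (fib π e x) = π x :=
  Function.invFun_eq (Set.mem_range.mp h)

lemma fib_eq {ι V W : Type} [Nonempty ι] {π : V → W} {e : ι → W} {x : V} {i : ι}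
    (he : Function.Injective e) (h : π x = e i) : fib π e x = i := by
  unfold fib
  rw [h]
  exact Function.leftInverse_invFun he i

/-- A stage of the partite construction. -/
structure Pic {ι U V W : Type} [Nonempty ι] (C : Type) (M : ℕ) (F : Set (ι → U))
    (𝒲 : Set (U → W)) (𝒰 : Set (ι → W)) (π : V → W) (Φ : Set (U → V)) (D : Set V)
    (r : V → ℕ) : Prop where
  sys : Sys F Φ
  hproj : ∀ φ ∈ Φ, π ∘ φ ∈ 𝒲
  mem : ∀ φ ∈ Φ, ∀ u, φ u ∈ D
  rank_inj : Function.Injective r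
  rs : RS C F 𝒲 π Φ 𝒰
  good : ∀ e ∈ Ed 𝒲 F, e ∉ 𝒰 → Good M (partD π D e) (fib π e) (partE π Φ F e) r

section
variable {ι U V W : Type} [Nonempty ι] {C : Type} {M : ℕ} {F : Set (ι → U)}
    {𝒲 : Set (U → W)} {𝒰 : Set (ι → W)} {π : V → W} {Φ : Set (U → V)} {D : Set V} {r : V → ℕ}

theorem Pic.exists_amalg [Finite ι] [Finite V] [Finite C] [Nonempty C]
    (P : Pic C M F 𝒲 𝒰 π Φ D r) (hF : Lin F) (hM : 1 ≤ M)
    (hFinj : ∀ f ∈ F, Function.Injective f) (hW : ∀ B ∈ 𝒲, Function.Injective B)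
    {e : ι → W} (he : e ∈ Ed 𝒲 F) (heU : e ∉ 𝒰) :
    ∃ (T : Type) (_ : Finite T) (G : Type) (_ : Finite G) (X : Type) (_ : Finite X)
      (clT : T → ι) (ET : Set (ι → T)) (τ : G → T → T × X) (A : G → V → T) (ord : G → ℕ)
      (r' : (T × X) ⊕ (G × V) → ℕ), Amalg F 𝒲 π Φ D e clT ET τ A M ∧
      RS C F 𝒲 (proj π e clT) (embΦ π e τ A Φ) (insert e 𝒰) ∧
      Function.Injective ord ∧ Function.Injective r' ∧
      (∀ g, ∀ x ∈ D, ∀ y ∈ D, π x = π y → r x < r y →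
        r' (emb π e τ A g x) < r' (emb π e τ A g y)) ∧
      ∀ g g' x y, ord g < ord g' → r' (Sum.inr (g, x)) < r' (Sum.inr (g', y)) := by
  have heinj : Function.Injective e := by
    obtain ⟨B, hB, t, ht, rfl⟩ := he
    exact (hW B hB).comp (hFinj t ht)
  obtain ⟨T, hT, clT, ET, rT, 𝒜, h1, h2, h3, h4, h5⟩ := P.good e he heU C
  obtain ⟨G, hG, X, hX, τ, A, g1, g2, g3, g4, g5⟩ := exists_cover ET h2 (partE π Φ F e) 𝒜
    (fun A hA => (h4 A hA).edge) h5 (M + 1) (by omega)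
  obtain ⟨ord, ho, -⟩ := exists_injective_rank fun _ : G => (0 : ℕ)
  obtain ⟨r', hr', hkey⟩ := exists_injective_rank fun p : (T × X) ⊕ (G × V) =>
    (Sum.elim (fun p => toLex (rT p.1, 0)) (fun q => toLex (ord q.1, r q.2)) p : ℕ ×ₗ ℕ)
  have ham : Amalg F 𝒲 π Φ D e clT ET τ A M :=
    { linF := hF
      sys := P.sys
      tinj := hW
      hproj := P.hproj
      mem := P.mem
      einj := heinj
      clT_edge := h1
      linT := h2
      earT := h3
      fst := g1
      cap := g3
      earτ := g4
      injA := fun g => (h4 _ (g2 g)).injOn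
      clA := fun g x hx => by rw [(h4 _ (g2 g)).cl x hx]; exact apply_fib hx.2
      edgeA := fun g => (h4 _ (g2 g)).edge
      strongA := fun g => (h4 _ (g2 g)).strong
      convA := fun g => (h4 _ (g2 g)).conv }
  refine ⟨T, hT, G, hG, X, hX, clT, ET, τ, A, ord, r', ham, ham.rs_insert g5 P.rs, ho, hr',
    ?_, ?_⟩
  · intro g x hx y hy hxy hlt
    apply hkey
    by_cases hxe : π x ∈ Set.range e
    · have hye : π y ∈ Set.range e := hxy ▸ hxe
      rw [emb_of_mem hxe, emb_of_mem hye]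
      simp only [Sum.elim_inl, g1]
      rw [Prod.Lex.toLex_lt_toLex]
      exact Or.inl ((h4 _ (g2 g)).mono x ⟨hx, hxe⟩ y ⟨hy, hye⟩ (by simp only [fib, hxy]) hlt)
    · have hye : π y ∉ Set.range e := hxy ▸ hxe
      rw [emb_of_notMem hxe, emb_of_notMem hye]
      simp only [Sum.elim_inr]
      rw [Prod.Lex.toLex_lt_toLex]
      exact Or.inr ⟨rfl, hlt⟩
  · intro g g' x y hlt
    apply hkey
    simp only [Sum.elim_inr]
    rw [Prod.Lex.toLex_lt_toLex]
    exact Or.inl hlt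

variable {T G X : Type} {e : ι → W} {clT : T → ι} {ET : Set (ι → T)}
    {τ : G → T → T × X} {A : G → V → T}

/-- The part of an amalgam over another template edge is a pasting of the corresponding parts
of the original picture. -/
theorem Amalg.exists_pasting (h : Amalg F 𝒲 π Φ D e clT ET τ A M)
    (hW : Lin (Ed 𝒲 F)) (he : e ∈ Ed 𝒲 F) {e' : ι → W} (he' : e' ∈ Ed 𝒲 F) (hne : e' ≠ e)
    (hinj' : Function.Injective e') (hr : Function.Injective r) {ord : G → ℕ}
    {r' : (T × X) ⊕ (G × V) → ℕ} (ho : Function.Injective ord)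
    (hmono : ∀ g, ∀ x ∈ D, ∀ y ∈ D, π x = π y → r x < r y →
        r' (emb π e τ A g x) < r' (emb π e τ A g y))
    (hord : ∀ g g' x y, ord g < ord g' → r' (Sum.inr (g, x)) < r' (Sum.inr (g', y))) :
    ∃ c, Pasting M (partD π D e') (fib π e') (partE π Φ F e') r
      (partD (proj π e clT) (⋃ g, emb π e τ A g '' D) e') (fib (proj π e clT) e')
      (partE (proj π e clT) (embΦ π e τ A Φ) F e') r' ord (emb π e τ A) c := by
  obtain ⟨c, hc⟩ : ∃ c, ∀ i, e' i ∈ Set.range e → i = c := by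
    by_cases hex : ∃ i, e' i ∈ Set.range e
    · obtain ⟨c, hc⟩ := hex
      refine ⟨c, fun i hi => ?_⟩
      by_contra hic
      exact hne (hW e' he' e he _ _ (fun hh => hic (hinj' hh)) ⟨i, rfl⟩ ⟨c, rfl⟩ hi hc)
    · push Not at hex
      exact ⟨Classical.arbitrary ι, fun i hi => absurd hi (hex i)⟩
  have hnot : ∀ x ∈ partD π D e', fib π e' x ≠ c → π x ∉ Set.range e := by
    intro x hx hxc hxe
    rw [← apply_fib hx.2] at hxe
    exact hxc (hc _ hxe)
  have hpi : ∀ x ∈ partD π D e', ∀ y ∈ partD π D e', fib π e' x = fib π e' y → π x = π y := by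
    intro x hx y hy hxy
    rw [← apply_fib hx.2, hxy, apply_fib hy.2]
  have htrans : ∀ g g', ∀ x ∈ D, ∀ y ∈ D, π x = π y → g ≠ g' → π x ∈ Set.range e →
      τ g (A g x) = τ g' (A g x) → τ g (A g y) = τ g' (A g y) → A g x = A g y := by
    intro g g' x hx y hy hxy hg hxe h1 h2
    by_contra hA
    obtain ⟨t, ht, ⟨i, hi⟩, ⟨j, hj⟩, -⟩ := h.cap g g' _ _ hg hA h1 h2
    have e1 : clT (A g x) = clT (A g y) := by
      apply h.einj
      rw [h.clA g x ⟨hx, hxe⟩, h.clA g y ⟨hy, hxy ▸ hxe⟩, hxy]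
    rw [← hi, ← hj, h.clT_edge t ht, h.clT_edge t ht] at e1
    exact hA (by rw [← hi, ← hj, e1])
  refine ⟨c, ?_⟩
  exact
  { edge_mem := fun f hf i => mem_partD_of_mem_partE h.mem hf i
    rank_inj := hr
    ord_inj := ho
    injOn := fun g => (h.emb_injOn g).mono fun x hx => hx.1
    cls_eq := fun g x hx => by simp only [fib, h.proj_emb hx.1]
    mono := fun g x hx y hy hxy hlt => hmono g x hx.1 y hy.1 (hpi x hx y hy hxy) hlt
    exists_eq := fun y hy => h.exists_of_mem_partD hy
    mem := fun g x hx => ⟨Set.mem_iUnion.mpr ⟨g, x, hx.1, rfl⟩, by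
      rw [h.proj_emb hx.1]; exact hx.2⟩
    exists_edge := by
      rintro _ ⟨⟨_, ⟨g, φ, hφ, rfl⟩, t, ht, rfl⟩, hfe⟩
      refine ⟨g, φ ∘ t, ⟨⟨φ, hφ, t, ht, rfl⟩, ?_⟩, rfl⟩
      rw [← hfe]
      funext i
      exact (h.proj_emb (h.mem φ hφ (t i))).symm
    edge := by
      rintro g f ⟨hf, hfe⟩
      refine ⟨mem_Ed_emb hf, ?_⟩
      rw [← hfe]
      funext i
      exact h.proj_emb (mem_of_mem_Ed h.mem hf i)
    priv := by
      intro g g' x hx x' hx' hxc hxx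
      by_contra hg
      exact hnot x hx hxc (emb_shared hg hxx).1
    share := by
      intro g g' x hx x' hx' y hy y' hy' hxc hyc hg hxx hyy
      obtain ⟨hxe, -, h1⟩ := emb_shared hg hxx
      obtain ⟨hye, -, h2⟩ := emb_shared hg hyy
      apply h.injA g ⟨hx.1, hxe⟩ ⟨hy.1, hye⟩
      refine htrans g g' x hx.1 y hy.1 (hpi x hx y hy (hxc.trans hyc.symm)) hg hxe ?_ ?_
      · rw [h1, h.τ_fst_eq h1]
      · rw [h2, h.τ_fst_eq h2]
    cyc := by
      intro n x hn hnM hp hs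
      by_cases hce : e' c ∈ Set.range e
      · have hrep : ∀ i g, x i ∈ emb π e τ A g '' {x | x ∈ partD π D e' ∧ fib π e' x = c} →
            ∃ z ∈ D, π z = e' c ∧ x i = Sum.inl (τ g (A g z)) := by
          rintro i g ⟨z, ⟨hz, hzc⟩, hzi⟩
          have h1 : π z = e' c := by rw [← apply_fib hz.2, hzc]
          refine ⟨z, hz.1, h1, ?_⟩
          rw [← hzi, emb_of_mem (by rw [h1]; exact hce)]
        have hy : ∀ i, ∃ y, x i = Sum.inl y := by
          intro i
          obtain ⟨_, ⟨g, rfl⟩, hxi, -⟩ := hs i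
          obtain ⟨z, -, -, hz⟩ := hrep i g hxi
          exact ⟨_, hz⟩
        choose y hy using hy
        obtain ⟨i, _, ⟨g, rfl⟩, h1, h2, h3⟩ := (h.earτ.mono (Nat.le_succ M)).cyc n y hn hnM
          (fun i => Sum.inl.inj (by rw [← hy, ← hy, hp]))
          (by
            intro i
            obtain ⟨_, ⟨g, rfl⟩, h1, h2⟩ := hs i
            obtain ⟨z, -, -, hz⟩ := hrep i g h1
            obtain ⟨z', -, -, hz'⟩ := hrep (i + 1) g h2
            rw [hy] at hz hz'
            exact ⟨_, ⟨g, rfl⟩, ⟨_, (Sum.inl.inj hz).symm⟩, ⟨_, (Sum.inl.inj hz').symm⟩⟩)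
        have hkey : ∀ i, y i ∈ Set.range (τ g) → y (i + 1) ∈ Set.range (τ g) → x i ≠ x (i + 1) →
            ∀ b ∈ Set.range (fun j => emb π e τ A j ''
              {x | x ∈ partD π D e' ∧ fib π e' x = c}), x i ∈ b → x (i + 1) ∈ b →
            b = emb π e τ A g '' {x | x ∈ partD π D e' ∧ fib π e' x = c} := by
          rintro i ⟨v, hv⟩ ⟨w, hw⟩ hxne _ ⟨g', rfl⟩ hb1 hb2
          obtain ⟨z, hzD, hz, hzi⟩ := hrep i g' hb1
          obtain ⟨z', hzD', hz', hzi'⟩ := hrep (i + 1) g' hb2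
          by_cases hg : g' = g
          · rw [hg]
          · exfalso
            apply hxne
            rw [hzi, hzi', htrans g' g z hzD z' hzD' (hz.trans hz'.symm) hg (hz ▸ hce)]
            · have e1 : τ g' (A g' z) = τ g v := by
                rw [hv]; exact Sum.inl.inj (hzi.symm.trans (hy i))
              rw [e1, h.τ_fst_eq e1]
            · have e1 : τ g' (A g' z') = τ g w := by
                rw [hw]; exact Sum.inl.inj (hzi'.symm.trans (hy (i + 1)))
              rw [e1, h.τ_fst_eq e1]
        refine ⟨i, ?_⟩
        by_cases e1 : x i = x (i + 1)
        · rw [e1]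
          exact (hs (i + 1)).co3_left
        by_cases e2 : x (i + 1) = x (i + 2)
        · rw [← e2]
          exact (hs i).co3_right
        obtain ⟨b, hb, b1, b2⟩ := hs i
        obtain ⟨b', hb', b1', b2'⟩ := hs (i + 1)
        have := hkey i h1 h2 e1 b hb b1 b2
        have h4 := hkey (i + 1) h2 h3 e2 b' hb' b1' b2'
        refine ⟨b, hb, b1, b2, ?_⟩
        rw [this, ← h4]
        exact b2'
      · have hrep : ∀ i g, x i ∈ emb π e τ A g '' {x | x ∈ partD π D e' ∧ fib π e' x = c} →
            ∃ z, x i = Sum.inr (g, z) := by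
          rintro i g ⟨z, ⟨hz, hzc⟩, hzi⟩
          have h1 : π z = e' c := by rw [← apply_fib hz.2, hzc]
          refine ⟨z, ?_⟩
          rw [← hzi, emb_of_notMem (by rw [h1]; exact hce)]
        obtain ⟨_, ⟨g, rfl⟩, b1, b2⟩ := hs 0
        obtain ⟨_, ⟨g', rfl⟩, b1', b2'⟩ := hs 1
        obtain ⟨z, hz⟩ := hrep 1 g b2
        obtain ⟨z', hz'⟩ := hrep 1 g' b1'
        have hg : g = g' := congrArg Prod.fst (Sum.inr.inj (hz.symm.trans hz'))
        subst hg
        exact ⟨0, _, ⟨g, rfl⟩, b1, b2, b2'⟩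
    ord_mono := by
      intro g g' x hx x' hx' hxc hxx hlt
      rw [emb_of_notMem (hnot x hx hxc), emb_of_notMem (hnot x' hx' (hxx ▸ hxc))]
      exact hord g g' x x' hlt }

end

/-! ### Short walks along the edges of a system of copies -/

lemma Co2_eb_comp {ι U V : Type} {F : Set (ι → U)} {φ : U → V} (hφ : Function.Injective φ)
    {f : ι → U} (hf : f ∈ F) {u v : U} (hu : φ u ∈ Set.range (φ ∘ f))
    (hv : φ v ∈ Set.range (φ ∘ f)) : Co2 (eb F) u v := by
  obtain ⟨i, hi⟩ := hu
  obtain ⟨j, hj⟩ := hv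
  exact ⟨_, ⟨f, hf, rfl⟩, ⟨i, hφ hi⟩, ⟨j, hφ hj⟩⟩

/-- A walk inside one copy, closed by an edge of that copy, has an ear. -/
lemma Sys.ear_of_single {ι U V : Type} {F : Set (ι → U)} {Φ : Set (U → V)} (h : Sys F Φ) {m : ℕ}
    (hF : PathEar (eb F) m) {φ : U → V} (hφ : φ ∈ Φ) {n : ℕ} {x : ℕ → V} (hn : 2 ≤ n)
    (hnm : n + 1 ≤ m)
    (hs : ∀ i < n, ∃ f ∈ F, x i ∈ Set.range (φ ∘ f) ∧ x (i + 1) ∈ Set.range (φ ∘ f))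
    (hc : x 0 = x n ∨ ∃ f ∈ F, x 0 ∈ Set.range (φ ∘ f) ∧ x n ∈ Set.range (φ ∘ f)) :
    ∃ i, i + 2 ≤ n ∧ Co3 (eb (Ed Φ F)) (x i) (x (i + 1)) (x (i + 2)) := by
  have hpt : ∀ i, ∃ u, i ≤ n → x i = φ u := by
    intro i
    rcases Nat.lt_or_ge i n with hi | hi
    · obtain ⟨f, hf, ⟨u, hu⟩, -⟩ := hs i hi
      exact ⟨f u, fun _ => hu.symm⟩
    · obtain ⟨f, hf, -, ⟨u, hu⟩⟩ := hs (n - 1) (by omega)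
      rw [Nat.sub_add_cancel (by omega)] at hu
      refine ⟨f u, fun h' => ?_⟩
      rw [le_antisymm h' hi]
      exact hu.symm
  choose u hu using hpt
  have hinj := h.inj φ hφ
  obtain ⟨i, hi, _, ⟨f, hf, rfl⟩, ⟨a, ha⟩, ⟨b, hb⟩, ⟨c, hc⟩⟩ := hF n u hn hnm
    (by
      intro i hi
      obtain ⟨f, hf, h1, h2⟩ := hs i hi
      rw [hu i (by omega)] at h1
      rw [hu (i + 1) (by omega)] at h2
      exact Co2_eb_comp hinj hf h1 h2)
    (by
      rcases hc with hc | ⟨f, hf, h1, h2⟩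
      · rw [hu 0 (by omega), hu n le_rfl] at hc
        rw [← hinj hc]
        obtain ⟨f, hf, h1, -⟩ := hs 0 (by omega)
        rw [hu 0 (by omega)] at h1
        exact Co2_eb_comp hinj hf h1 h1
      · rw [hu 0 (by omega)] at h1
        rw [hu n le_rfl] at h2
        exact Co2_eb_comp hinj hf h1 h2)
  refine ⟨i, hi, _, ⟨_, ⟨φ, hφ, f, hf, rfl⟩, rfl⟩, ⟨a, ?_⟩, ⟨b, ?_⟩, ⟨c, ?_⟩⟩
  · rw [hu i (by omega), ← ha]; rfl
  · rw [hu (i + 1) (by omega), ← hb]; rfl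
  · rw [hu (i + 2) (by omega), ← hc]; rfl

theorem Sys.ear_or_mem_range {ι U V : Type} {F : Set (ι → U)} {Φ : Set (U → V)} (h : Sys F Φ)
    {m : ℕ} (hear : PathEar (eb Φ) m) (hF : PathEar (eb F) m) {θ : U → V} (hθ : θ ∈ Φ)
    {n : ℕ} {x : ℕ → V} (hnm : n + 1 ≤ m)
    (hs : ∀ i < n, Co2 (eb (Ed Φ F)) (x i) (x (i + 1)))
    (h0 : x 0 ∈ Set.range θ) (hxn : x n ∈ Set.range θ) :
    (∃ i, i + 2 ≤ n ∧ Co3 (eb (Ed Φ F)) (x i) (x (i + 1)) (x (i + 2))) ∨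
      ∀ i ≤ n, x i ∈ Set.range θ := by
  by_cases hno : ∃ i, i + 2 ≤ n ∧ Co3 (eb (Ed Φ F)) (x i) (x (i + 1)) (x (i + 2))
  · exact Or.inl hno
  refine Or.inr ?_
  rcases Nat.lt_or_ge n 2 with hn | hn
  · intro i hi
    rcases Nat.eq_zero_or_pos i with rfl | hi0
    · exact h0
    · rwa [show i = n by omega]
  have hne : ∀ i < n, x i ≠ x (i + 1) := by
    intro i hi he
    apply hno
    rcases Nat.lt_or_ge (i + 1) n with h1 | h1
    · refine ⟨i, by omega, ?_⟩
      rw [he]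
      exact (hs (i + 1) h1).co3_left
    · refine ⟨i - 1, by omega, ?_⟩
      have e1 : i - 1 + 1 = i := by omega
      have e2 : i - 1 + 2 = i + 1 := by omega
      rw [e1, e2, ← he]
      have := hs (i - 1) (by omega)
      rw [e1] at this
      exact this.co3_right
  have hclosed : ∀ i j φ, i + 2 ≤ j → j ≤ n → φ ∈ Φ →
      (∀ t, i ≤ t → t < j → ∃ f ∈ F, x t ∈ Set.range (φ ∘ f) ∧ x (t + 1) ∈ Set.range (φ ∘ f)) →
      ¬ (x i = x j ∨ ∃ f ∈ F, x i ∈ Set.range (φ ∘ f) ∧ x j ∈ Set.range (φ ∘ f)) := by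
    intro i j φ hij hjn hφ hst hc
    have e1 : i + (j - i) = j := by omega
    obtain ⟨s, hs1, hs2⟩ := h.ear_of_single hF hφ (n := j - i) (x := fun s => x (i + s))
      (by omega) (by omega) (fun s hs' => hst (i + s) (by omega) (by omega))
      (by simpa [e1] using hc)
    exact hno ⟨i + s, by omega, hs2⟩
  have hrange : ∀ {φ : U → V} {p q : V},
      (∃ f ∈ F, p ∈ Set.range (φ ∘ f) ∧ q ∈ Set.range (φ ∘ f)) →
      p ∈ Set.range φ ∧ q ∈ Set.range φ := by
    rintro φ p q ⟨f, -, ⟨i, hi⟩, ⟨j, hj⟩⟩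
    exact ⟨⟨_, hi⟩, ⟨_, hj⟩⟩
  have hinner : ∀ i j (φ : U → V), φ ∈ Φ → i + 2 ≤ j → j ≤ n →
      (∀ t, i ≤ t → t < j → ∃ f ∈ F, x t ∈ Set.range (φ ∘ f) ∧ x (t + 1) ∈ Set.range (φ ∘ f)) →
      ∀ ψ ∈ Φ, x i ∈ Set.range ψ → x j ∈ Set.range ψ → ψ = φ := by
    intro i j φ hφ hij hjn hst ψ hψ h1 h2
    by_contra hne'
    have hcl := hclosed i j φ hij hjn hφ hst
    have h3 := (hrange (hst i le_rfl (by omega))).1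
    have h4 := (hrange (hst (j - 1) (by omega) (by omega))).2
    rw [Nat.sub_add_cancel (by omega)] at h4
    obtain ⟨t, ht, -, -, -, h5, h6, -⟩ := h.link φ hφ ψ hψ (Ne.symm hne') _ _
      (fun hh => hcl (Or.inl hh)) h3 h4 h1 h2
    exact hcl (Or.inr ⟨t, ht, h5, h6⟩)
  obtain ⟨φ, hφ⟩ := exists_common_label (Q := Φ)
    (fun φ p q => ∃ f ∈ F, p ∈ Set.range (φ.1 ∘ f) ∧ q ∈ Set.range (φ.1 ∘ f))
    (fun φ => Set.range φ.1) n (by omega) x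
    (by
      intro i hi
      obtain ⟨_, ⟨_, ⟨φ, hφ, f, hf, rfl⟩, rfl⟩, h1, h2⟩ := hs i hi
      exact ⟨⟨φ, hφ⟩, f, hf, h1, h2⟩)
    hne
    (by
      intro i j φ hij hjn _ hst
      refine ⟨fun hh => hclosed i j φ.1 hij hjn φ.2 hst (Or.inl hh), fun ψ h1 h2 => ?_⟩
      exact Subtype.ext (hinner i j φ.1 φ.2 hij hjn hst ψ.1 ψ.2 h1 h2))
    (by
      rintro φ ψ i hi ⟨f, hf, h1, h2⟩ h3 h4
      obtain ⟨t, ht, he⟩ := h.strong ψ.1 ψ.2 (φ.1 ∘ f) ⟨φ.1, φ.2, f, hf, rfl⟩ _ _ (hne i hi)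
        h3 h4 h1 h2
      rw [he] at h1 h2
      exact ⟨t, ht, h1, h2⟩)
    (by
      intro q k w hq hk0 hkq hk hst hdist
      have hqn : ∀ j ≤ q, j ≤ k j := by
        intro j
        induction j with
        | zero => intro _; omega
        | succ j ih =>
          intro hj
          have := ih (by omega)
          have := hk j (by omega)
          omega
      obtain ⟨j, hj, _, ⟨ψ, hψ, rfl⟩, h1, h2, h3⟩ := hear q (fun j => x (k j)) hq
        (by have := hqn q le_rfl; omega)
        (by
          intro j hj
          have hkj := hk j hj
          refine ⟨_, ⟨_, (w j).2, rfl⟩, (hrange (hst j hj (k j) le_rfl hkj)).1, ?_⟩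
          have := (hrange (hst j hj (k (j + 1) - 1) (by omega) (by omega))).2
          rwa [Nat.sub_add_cancel (by omega)] at this)
        ⟨_, ⟨θ, hθ, rfl⟩, by rw [hk0]; exact h0, by rw [hkq]; exact hxn⟩
      exact ⟨j, ⟨ψ, hψ⟩, hj, h1, h2, h3⟩)
  have hθφ := hinner 0 n φ.1 φ.2 (by omega) le_rfl (fun t _ ht => hφ t ht) θ hθ h0 hxn
  intro i hi
  rw [hθφ]
  rcases hi.lt_or_eq with hi | rfl
  · exact (hrange (hφ i hi)).1
  · have := (hrange (hφ (i - 1) (by omega))).2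
    rwa [Nat.sub_add_cancel (by omega)] at this

theorem Sys.pathEar_Ed {ι U V : Type} {F : Set (ι → U)} {Φ : Set (U → V)} (h : Sys F Φ)
    {m : ℕ} (hear : PathEar (eb Φ) m) (hF : PathEar (eb F) m) : PathEar (eb (Ed Φ F)) m := by
  intro n x hn hnm hs hc
  obtain ⟨_, ⟨_, ⟨θ, hθ, f, hf, rfl⟩, rfl⟩, hc1, hc2⟩ := hc
  have hc1' : x 0 ∈ Set.range θ := by obtain ⟨i, hi⟩ := hc1; exact ⟨_, hi⟩
  have hc2' : x n ∈ Set.range θ := by obtain ⟨i, hi⟩ := hc2; exact ⟨_, hi⟩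
  rcases h.ear_or_mem_range hear hF hθ hnm hs hc1' hc2' with hh | hall
  · exact hh
  by_cases hne : ∀ i < n, x i ≠ x (i + 1)
  · refine h.ear_of_single hF hθ hn hnm ?_ (Or.inr ⟨f, hf, hc1, hc2⟩)
    intro i hi
    obtain ⟨_, ⟨g, hg, rfl⟩, h1, h2⟩ := hs i hi
    obtain ⟨t, ht, he⟩ := h.strong θ hθ g hg _ _ (hne i hi) (hall i hi.le) (hall (i + 1) hi)
      h1 h2
    rw [he] at h1 h2
    exact ⟨t, ht, h1, h2⟩
  · push Not at hne
    obtain ⟨i, hi, he⟩ := hne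
    rcases Nat.lt_or_ge (i + 1) n with h1 | h1
    · refine ⟨i, by omega, ?_⟩
      rw [he]
      exact (hs (i + 1) h1).co3_left
    · refine ⟨i - 1, by omega, ?_⟩
      have e1 : i - 1 + 1 = i := by omega
      have e2 : i - 1 + 2 = i + 1 := by omega
      rw [e1, e2, ← he]
      have := hs (i - 1) (by omega)
      rw [e1] at this
      exact this.co3_right

/-! ### Attaching copies of a partite hypergraph to the edges of another hypergraph -/

open Classical in
/-- The copy of `T` attached to the hyperedge `h`: vertices of class `c` are identified with the
vertices of `h`, all others are private. -/
noncomputable def om {ι T Y : Type} (clT : T → ι) (c : ι) (h : Option T → Y) (v : T) :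
    Y ⊕ ((Option T → Y) × T) :=
  if clT v = c then Sum.inl (h (some v)) else Sum.inr (h, v)

section
variable {ι T Y : Type} {clT : T → ι} {c : ι} {H : Set (Option T → Y)} {ET : Set (ι → T)}

lemma om_cases (h : Option T → Y) (v : T) :
    (clT v = c ∧ om clT c h v = Sum.inl (h (some v))) ∨
      (clT v ≠ c ∧ om clT c h v = Sum.inr (h, v)) := by
  by_cases hv : clT v = c
  · exact Or.inl ⟨hv, if_pos hv⟩
  · exact Or.inr ⟨hv, if_neg hv⟩

lemma om_eq_inr {h g : Option T → Y} {v w : T} (e : om clT c h v = Sum.inr (g, w)) :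
    h = g ∧ v = w ∧ clT v ≠ c := by
  rcases om_cases (clT := clT) (c := c) h v with ⟨-, h1⟩ | ⟨h2, h1⟩
  · rw [h1] at e
    simp at e
  · rw [h1] at e
    simp only [Sum.inr.injEq, Prod.mk.injEq] at e
    exact ⟨e.1, e.2, h2⟩

lemma om_eq_inl {h : Option T → Y} {v : T} {y : Y} (e : om clT c h v = Sum.inl y) :
    h (some v) = y ∧ clT v = c := by
  rcases om_cases (clT := clT) (c := c) h v with ⟨h2, h1⟩ | ⟨-, h1⟩
  · rw [h1] at e
    exact ⟨Sum.inl.inj e, h2⟩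
  · rw [h1] at e
    simp at e

lemma om_injective {h : Option T → Y} (hh : Function.Injective h) :
    Function.Injective (om clT c h) := by
  intro v w hvw
  rcases om_cases (clT := clT) (c := c) h w with ⟨-, h1⟩ | ⟨-, h1⟩
  · rw [h1] at hvw
    exact Option.some.inj (hh (om_eq_inl hvw).1)
  · rw [h1] at hvw
    exact (om_eq_inr hvw).2.1

lemma eq_of_inr_mem_range_om {h g : Option T → Y} {v : T}
    (hm : Sum.inr (g, v) ∈ Set.range (om clT c h)) : h = g := by
  obtain ⟨w, hw⟩ := hm
  exact (om_eq_inr hw).1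

lemma inl_eq_of_mem_edge (hcl : ∀ t ∈ ET, ∀ i, clT (t i) = i) {h : Option T → Y} {t : ι → T}
    (ht : t ∈ ET) {y y' : Y} (hy : Sum.inl y ∈ Set.range (om clT c h ∘ t))
    (hy' : Sum.inl y' ∈ Set.range (om clT c h ∘ t)) : y = y' := by
  obtain ⟨i, hi⟩ := hy
  obtain ⟨j, hj⟩ := hy'
  obtain ⟨h1, h2⟩ := om_eq_inl hi
  obtain ⟨h3, h4⟩ := om_eq_inl hj
  rw [hcl t ht] at h2 h4
  rw [← h1, ← h3, h2, h4]

lemma eq_of_mem_range_om_inter (hlin : Lin H) {h g : Option T → Y} (hh : h ∈ H) (hg : g ∈ H)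
    {p q : Y ⊕ ((Option T → Y) × T)} (hpq : p ≠ q) (h1 : p ∈ Set.range (om clT c h))
    (h2 : q ∈ Set.range (om clT c h)) (h3 : p ∈ Set.range (om clT c g))
    (h4 : q ∈ Set.range (om clT c g)) : h = g := by
  rcases p with p | ⟨p, v⟩
  · rcases q with q | ⟨q, w⟩
    · obtain ⟨a, ha⟩ := h1
      obtain ⟨b, hb⟩ := h2
      obtain ⟨a', ha'⟩ := h3
      obtain ⟨b', hb'⟩ := h4
      exact hlin h hh g hg p q (fun e => hpq (by rw [e])) ⟨_, (om_eq_inl ha).1⟩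
        ⟨_, (om_eq_inl hb).1⟩ ⟨_, (om_eq_inl ha').1⟩ ⟨_, (om_eq_inl hb').1⟩
    · rw [eq_of_inr_mem_range_om h2, eq_of_inr_mem_range_om h4]
  · rw [eq_of_inr_mem_range_om h1, eq_of_inr_mem_range_om h3]

lemma mem_range_om_of_edge {h : Option T → Y} {p q : Y ⊕ ((Option T → Y) × T)}
    (hst : ∃ t ∈ ET, p ∈ Set.range (om clT c h ∘ t) ∧ q ∈ Set.range (om clT c h ∘ t)) :
    p ∈ Set.range (om clT c h) ∧ q ∈ Set.range (om clT c h) := by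
  obtain ⟨t, -, ⟨i, hi⟩, ⟨j, hj⟩⟩ := hst
  exact ⟨⟨_, hi⟩, ⟨_, hj⟩⟩

lemma sys_om (hinj : ∀ h ∈ H, Function.Injective h)
    (hlin : Lin H) : Sys ET (om clT c '' H) where
  inj := by
    rintro _ ⟨h, hh, rfl⟩
    exact om_injective (hinj h hh)
  strong := by
    rintro _ ⟨h, hh, rfl⟩ _ ⟨_, ⟨g, hg, rfl⟩, t, ht, rfl⟩ p q hpq h1 h2 h3 h4
    obtain ⟨h5, h6⟩ := mem_range_om_of_edge ⟨t, ht, h3, h4⟩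
    obtain rfl := eq_of_mem_range_om_inter hlin hh hg hpq h1 h2 h5 h6
    exact ⟨t, ht, rfl⟩
  link := by
    rintro _ ⟨h, hh, rfl⟩ _ ⟨g, hg, rfl⟩ hne p q hpq h1 h2 h3 h4
    exact absurd (congrArg _ (eq_of_mem_range_om_inter hlin hh hg hpq h1 h2 h3 h4)) hne

lemma om_of_Co2 {p q : Y ⊕ ((Option T → Y) × T)}
    (h : Co2 (eb (Ed (om clT c '' H) ET)) p q) :
    ∃ h ∈ H, ∃ t ∈ ET, p ∈ Set.range (om clT c h ∘ t) ∧ q ∈ Set.range (om clT c h ∘ t) := by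
  obtain ⟨_, ⟨_, ⟨_, ⟨h, hh, rfl⟩, t, ht, rfl⟩, rfl⟩, h1, h2⟩ := h
  exact ⟨h, hh, t, ht, h1, h2⟩

lemma ne_of_no_ear {V : Type} {B : Set (Set V)} {n : ℕ} (hn : 2 ≤ n) {x : ℕ → V}
    (hs : ∀ i < n, Co2 B (x i) (x (i + 1)))
    (hno : ¬ ∃ i, i + 2 ≤ n ∧ Co3 B (x i) (x (i + 1)) (x (i + 2))) :
    ∀ i < n, x i ≠ x (i + 1) := by
  intro i hi he
  apply hno
  rcases Nat.lt_or_ge (i + 1) n with h1 | h1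
  · refine ⟨i, by omega, ?_⟩
    rw [he]
    exact (hs (i + 1) h1).co3_left
  · refine ⟨i - 1, by omega, ?_⟩
    have e1 : i - 1 + 1 = i := by omega
    have e2 : i - 1 + 2 = i + 1 := by omega
    rw [e1, e2, ← he]
    have := hs (i - 1) (by omega)
    rw [e1] at this
    exact this.co3_right

lemma two_mul_le_of_runs {q : ℕ} {k : ℕ → ℕ} (a : ℕ) (h : ∀ j, a ≤ j → j < q → k j + 2 ≤ k (j + 1))
    (b : ℕ) (hab : a ≤ b) (hbq : b ≤ q) : 2 * (b - a) + k a ≤ k b := by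
  induction b with
  | zero =>
    obtain rfl : a = 0 := by omega
    simp
  | succ b ih =>
    rcases hab.lt_or_eq with hab | rfl
    · have := ih (by omega) (by omega)
      have := h b (by omega) (by omega)
      omega
    · simp

/-- A closed walk starting at a shared vertex, without ears, stays in one attached copy. -/
lemma exists_common_om (hcl : ∀ t ∈ ET, ∀ i, clT (t i) = i) (hinj : ∀ h ∈ H, Function.Injective h)
    (hlin : Lin H) {m : ℕ} (hH : PathEar (eb H) m) (hT : PathEar (eb ET) (2 * m)) {n : ℕ}
    (hn : 1 ≤ n) (hnm : n ≤ 2 * m) {x : ℕ → Y ⊕ ((Option T → Y) × T)}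
    (hs : ∀ i < n, Co2 (eb (Ed (om clT c '' H) ET)) (x i) (x (i + 1)))
    (hne : ∀ i < n, x i ≠ x (i + 1))
    (hno : ¬ ∃ i, i + 2 ≤ n ∧ Co3 (eb (Ed (om clT c '' H) ET)) (x i) (x (i + 1)) (x (i + 2)))
    {z : Y} (h0 : x 0 = Sum.inl z) (hxn : x n = Sum.inl z) :
    ∃ h ∈ H, ∀ i < n, ∃ t ∈ ET, x i ∈ Set.range (om clT c h ∘ t) ∧
      x (i + 1) ∈ Set.range (om clT c h ∘ t) := by
  have hsys := sys_om (ET := ET) (clT := clT) (c := c) hinj hlin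
  obtain ⟨h, hh⟩ := exists_common_label (Q := H)
    (fun h p q => ∃ t ∈ ET, p ∈ Set.range (om clT c h.1 ∘ t) ∧ q ∈ Set.range (om clT c h.1 ∘ t))
    (fun h => Set.range (om clT c h.1)) n hn x
    (by
      intro i hi
      obtain ⟨h, hh, ht⟩ := om_of_Co2 (hs i hi)
      exact ⟨⟨h, hh⟩, ht⟩)
    hne
    (by
      intro i j h hij hjn hjin hst
      have hij' : x i ≠ x j := by
        intro he
        have e1 : i + (j - i) = j := by omega
        obtain ⟨s, hs1, hs2⟩ := hsys.ear_of_single hT ⟨h.1, h.2, rfl⟩ (n := j - i)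
          (x := fun s => x (i + s)) (by omega) (by omega)
          (fun s hs' => hst (i + s) (by omega) (by omega)) (Or.inl (by simpa [e1] using he))
        exact hno ⟨i + s, by omega, hs2⟩
      refine ⟨hij', fun g h1 h2 => ?_⟩
      have h3 := (mem_range_om_of_edge (hst i le_rfl (by omega))).1
      have h4 := (mem_range_om_of_edge (hst (j - 1) (by omega) (by omega))).2
      rw [Nat.sub_add_cancel (by omega)] at h4
      exact Subtype.ext (eq_of_mem_range_om_inter hlin g.2 h.2 hij' h1 h2 h3 h4))
    (by
      intro h g i hi hst h1 h2
      have h3 := mem_range_om_of_edge hst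
      obtain rfl := Subtype.ext (eq_of_mem_range_om_inter hlin g.2 h.2 (hne i hi) h1 h2 h3.1 h3.2)
      exact hst)
    (by
      intro q k w hq hk0 hkq hk hst hdist
      have hstart : ∀ j < q, x (k j) ∈ Set.range (om clT c (w j).1) := fun j hj =>
        (mem_range_om_of_edge (hst j hj (k j) le_rfl (hk j hj))).1
      have hend : ∀ j < q, x (k (j + 1)) ∈ Set.range (om clT c (w j).1) := by
        intro j hj
        have h2 := hk j hj
        have := (mem_range_om_of_edge (hst j hj (k (j + 1) - 1) (by omega) (by omega))).2
        rwa [Nat.sub_add_cancel (by omega)] at this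
      by_cases heq : ∃ j, j + 2 ≤ q ∧ w j = w (j + 1)
      · obtain ⟨j, hj, hw⟩ := heq
        refine ⟨j, w j, hj, hstart j (by omega), hend j (by omega), ?_⟩
        rw [hw]
        exact hend (j + 1) (by omega)
      push Not at heq
      have hy : ∀ j, ∃ y, j ≤ q → x (k j) = Sum.inl y := by
        intro j
        by_cases hj : j ≤ q
        · rcases Nat.eq_zero_or_pos j with rfl | hj0
          · exact ⟨z, fun _ => by rw [hk0, h0]⟩
          · rcases hj.lt_or_eq with hjq | rfl
            · have e1 : j - 1 + 1 = j := by omega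
              have h2 := hend (j - 1) (by omega)
              have h3 := heq (j - 1) (by omega)
              rw [e1] at h2 h3
              have h4 := hstart j hjq
              rcases hxj : x (k j) with y | ⟨g, v⟩
              · exact ⟨y, fun _ => rfl⟩
              · rw [hxj] at h2 h4
                exact absurd (Subtype.ext ((eq_of_inr_mem_range_om h2).trans
                  (eq_of_inr_mem_range_om h4).symm)) h3
            · exact ⟨z, fun _ => by rw [hkq, hxn]⟩
        · exact ⟨z, fun hh => absurd hh hj⟩
      choose y hy using hy
      have hlen : ∀ j, 0 ≤ j → j < q → k j + 2 ≤ k (j + 1) := by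
        intro j _ hj
        have hkj := hk j hj
        by_contra hlt
        have e1 : k (j + 1) = k j + 1 := by omega
        obtain ⟨t, ht, h1, h2⟩ := hst j hj (k j) le_rfl hkj
        rw [← e1] at h2
        have h3 := hdist j hj
        rw [hy j (by omega)] at h1 h3
        rw [hy (j + 1) (by omega)] at h2 h3
        exact h3 (by rw [inl_eq_of_mem_edge hcl ht h1 h2])
      have hq2 := two_mul_le_of_runs 0 hlen q (Nat.zero_le q) le_rfl
      have hyst : ∀ j < q, y j ∈ Set.range (w j).1 ∧ y (j + 1) ∈ Set.range (w j).1 := by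
        intro j hj
        obtain ⟨v, hv⟩ := hstart j hj
        obtain ⟨v', hv'⟩ := hend j hj
        rw [hy j (by omega)] at hv
        rw [hy (j + 1) (by omega)] at hv'
        exact ⟨⟨_, (om_eq_inl hv).1⟩, ⟨_, (om_eq_inl hv').1⟩⟩
      have hy0q : y 0 = y q := by
        have h2 := hy 0 (by omega)
        have h3 := hy q le_rfl
        rw [hk0, h0] at h2
        rw [hkq, hxn] at h3
        exact Sum.inl.inj (h2.symm.trans h3)
      rcases Nat.lt_or_ge 2 q with hq3 | hq3
      · exfalso
        have hyne : ∀ j < q, y j ≠ y (j + 1) := by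
          intro j hj he
          apply hdist j hj
          rw [hy j (by omega), hy (j + 1) (by omega), he]
        obtain ⟨j, hj, _, ⟨g, hg, rfl⟩, g1, g2, g3⟩ := hH (q - 1) y (by omega) (by omega)
          (fun j hj => ⟨_, ⟨_, (w j).2, rfl⟩, hyst j (by omega)⟩)
          (by
            have h2 := hyst (q - 1) (by omega)
            rw [Nat.sub_add_cancel (by omega), ← hy0q] at h2
            exact ⟨_, ⟨_, (w (q - 1)).2, rfl⟩, h2.2, h2.1⟩)
        have a1 := hyst j (by omega)
        have a2 := hyst (j + 1) (by omega)
        have h5 := hlin _ (w j).2 g hg _ _ (hyne j (by omega)) a1.1 a1.2 g1 g2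
        have h6 := hlin _ (w (j + 1)).2 g hg _ _ (hyne (j + 1) (by omega)) a2.1 a2.2 g2 g3
        exact heq j (by omega) (Subtype.ext (h5.trans h6.symm))
      · obtain rfl : q = 2 := by omega
        refine ⟨0, w 0, le_rfl, hstart 0 (by omega), hend 0 (by omega), ?_⟩
        have h2 := hstart 0 (by omega)
        rw [hk0, h0, ← hxn, ← hkq] at h2
        exact h2)
  exact ⟨h.1, h.2, hh⟩

theorem pathEar_om (hcl : ∀ t ∈ ET, ∀ i, clT (t i) = i) (hinj : ∀ h ∈ H, Function.Injective h)
    (hlin : Lin H) {m : ℕ} (hH : PathEar (eb H) m) (hT : PathEar (eb ET) (2 * m)) :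
    PathEar (eb (Ed (om clT c '' H) ET)) (2 * m) := by
  apply Cyc.pathEar
  intro n x₀ hn hnm hp₀ hs₀
  by_contra hno₀
  push Not at hno₀
  have hne₀ : ∀ i, x₀ i ≠ x₀ (i + 1) := by
    intro i hi
    apply hno₀ i
    rw [hi]
    exact (hs₀ (i + 1)).co3_left
  have main : ∀ r h, h ∈ H → (∀ i < n, ∃ t ∈ ET, x₀ (r + i) ∈ Set.range (om clT c h ∘ t) ∧
      x₀ (r + i + 1) ∈ Set.range (om clT c h ∘ t)) → False := by
    intro r h hh hst
    have hall := forall_of_forall_lt_of_periodic (P := fun i => ∃ t ∈ ET,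
      x₀ i ∈ Set.range (om clT c h ∘ t) ∧ x₀ (i + 1) ∈ Set.range (om clT c h ∘ t)) hn
      (by
        intro i
        have e1 : x₀ (i + n + 1) = x₀ (i + 1) := by
          rw [← hp₀ (i + 1)]
          congr 1
          omega
        rw [hp₀, e1]) r hst
    choose t ht h1 h2 using hall
    have hv : ∀ i, ∃ v, om clT c h v = x₀ i := fun i => by
      obtain ⟨j, hj⟩ := h1 i
      exact ⟨_, hj⟩
    choose v hv using hv
    have hoi := om_injective (clT := clT) (c := c) (hinj h hh)
    obtain ⟨i, _, ⟨s, hs, rfl⟩, ⟨a, ha⟩, ⟨b, hb⟩, ⟨d, hd⟩⟩ := hT.cyc n v hn hnm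
      (fun i => hoi (by rw [hv, hv, hp₀]))
      (by
        intro i
        have h1 := h1 i
        have h2 := h2 i
        rw [← hv] at h1 h2
        exact Co2_eb_comp hoi (ht i) h1 h2)
    refine hno₀ i ⟨_, ⟨_, ⟨_, ⟨h, hh, rfl⟩, s, hs, rfl⟩, rfl⟩, ⟨a, ?_⟩, ⟨b, ?_⟩, ⟨d, ?_⟩⟩
    · rw [← hv, ← ha]; rfl
    · rw [← hv, ← hb]; rfl
    · rw [← hv, ← hd]; rfl
  by_cases hinl : ∃ r z, x₀ r = Sum.inl z
  · obtain ⟨r, z, hr⟩ := hinl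
    obtain ⟨h, hh, hst⟩ := exists_common_om hcl hinj hlin hH hT hn hnm (x := fun i => x₀ (r + i))
      (fun i _ => hs₀ (r + i)) (fun i _ => hne₀ (r + i))
      (fun ⟨i, _, hi⟩ => hno₀ (r + i) hi) (z := z) hr (by rw [hp₀]; exact hr)
    exact main r h hh hst
  · push Not at hinl
    have hstep : ∀ i h v, x₀ i = Sum.inr (h, v) → (h ∈ H ∧ ∃ t ∈ ET,
        x₀ i ∈ Set.range (om clT c h ∘ t) ∧ x₀ (i + 1) ∈ Set.range (om clT c h ∘ t)) ∧
        ∃ v', x₀ (i + 1) = Sum.inr (h, v') := by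
      intro i h v hi
      obtain ⟨g, hg, hst⟩ := om_of_Co2 (hs₀ i)
      obtain ⟨h1, h2⟩ := mem_range_om_of_edge hst
      rw [hi] at h1
      obtain rfl := eq_of_inr_mem_range_om h1
      refine ⟨⟨hg, hst⟩, ?_⟩
      rcases hx : x₀ (i + 1) with y | ⟨g', v'⟩
      · exact absurd hx (hinl _ y)
      · rw [hx] at h2
        rw [eq_of_inr_mem_range_om h2]
        exact ⟨v', rfl⟩
    obtain ⟨⟨h, v⟩, hgz⟩ : ∃ q, x₀ 0 = Sum.inr q := by
      rcases hx0 : x₀ 0 with q | q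
      · exact absurd hx0 (hinl 0 q)
      · exact ⟨q, rfl⟩
    have hall : ∀ i, ∃ v', x₀ i = Sum.inr (h, v') := by
      intro i
      induction i with
      | zero => exact ⟨v, hgz⟩
      | succ i ih =>
        obtain ⟨z', hz'⟩ := ih
        exact (hstep i h z' hz').2
    refine main 0 h (hstep 0 h v hgz).1.1 fun i _ => ?_
    obtain ⟨z', hz'⟩ := hall (0 + i)
    exact (hstep _ h z' hz').1.2

end

/-! ### Convexity of a copy in the attached hypergraph -/

section
variable {ι T Y : Type} {clT : T → ι} {c : ι} {H : Set (Option T → Y)} {ET : Set (ι → T)}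

theorem conv_om (hcl : ∀ t ∈ ET, ∀ i, clT (t i) = i) (hinj : ∀ h ∈ H, Function.Injective h)
    (hlin : Lin H) {m : ℕ} (hT : PathEar (eb ET) (2 * m)) {ST : Set T} (hconv : Conv (2 * m) ET ST)
    {E₀ : Set (Option T → Y)} {Z Z₀ : Set Y} (hZ₀ : Z₀ ⊆ Z)
    (hZ : ∀ (n : ℕ) (y : ℕ → Y), n + 1 ≤ m → (∀ i < n, Co2 (eb H) (y i) (y (i + 1))) →
      y 0 ∈ Z → y n ∈ Z →
      (∃ i, i + 2 ≤ n ∧ Co3 (eb H) (y i) (y (i + 1)) (y (i + 2))) ∨ ∀ i ≤ n, y i ∈ Z)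
    (hE₀ : ∀ h ∈ H, ∀ y y', y ≠ y' → y ∈ Z₀ → y' ∈ Z → y ∈ Set.range h → y' ∈ Set.range h →
      h ∈ E₀)
    (hran : ∀ h ∈ E₀, Set.range h ⊆ Z₀) {S : Set (Y ⊕ ((Option T → Y) × T))}
    (hmeet : ∀ h ∈ E₀, ∀ g ∈ E₀, h ≠ g → ∀ y, y ∈ Set.range h → y ∈ Set.range g → Sum.inl y ∈ S)
    (hS₁ : ∀ y, Sum.inl y ∈ S → y ∈ Z₀) (hS₂ : ∀ h v, Sum.inr (h, v) ∈ S → h ∈ E₀)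
    (hS₃ : ∀ h ∈ E₀, ∀ v, om clT c h v ∈ S ↔ v ∈ ST) :
    Conv (2 * m) (Ed (om clT c '' H) ET) S := by
  intro n x hnm hs h0 hxn
  by_cases hno : ∃ i, i + 2 ≤ n ∧ Co3 (eb (Ed (om clT c '' H) ET)) (x i) (x (i + 1)) (x (i + 2))
  · exact Or.inl hno
  refine Or.inr ?_
  rcases Nat.lt_or_ge n 2 with hn | hn
  · intro i hi
    rcases Nat.eq_zero_or_pos i with rfl | hi0
    · exact h0
    · rwa [show i = n by omega]
  have hsys := sys_om (ET := ET) (clT := clT) (c := c) hinj hlin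
  have hne := ne_of_no_ear hn hs hno
  obtain ⟨q, k, w, hq, hk0, hkq, hk, hst, hmin⟩ := exists_min_runs (Q := H)
    (fun i h => ∃ t ∈ ET, x i ∈ Set.range (om clT c h.1 ∘ t) ∧
      x (i + 1) ∈ Set.range (om clT c h.1 ∘ t)) n (by omega)
    (by
      intro i hi
      obtain ⟨h, hh, ht⟩ := om_of_Co2 (hs i hi)
      exact ⟨⟨h, hh⟩, ht⟩)
  have hkn : ∀ j ≤ q, k j ≤ n := fun j hj => by
    rw [← hkq]
    exact runs_mono_le hk hj le_rfl
  have hw : ∀ j, j + 1 < q → w j ≠ w (j + 1) := by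
    intro j hj he
    obtain ⟨i, hi1, hi2, hi3⟩ := hmin j hj (w j)
    apply hi3
    rcases Nat.lt_or_ge i (k (j + 1)) with h1 | h1
    · exact hst j (by omega) i hi1 h1
    · rw [he]
      exact hst (j + 1) hj i h1 hi2
  have hstart : ∀ j < q, x (k j) ∈ Set.range (om clT c (w j).1) := fun j hj =>
    (mem_range_om_of_edge (hst j hj (k j) le_rfl (hk j hj))).1
  have hend : ∀ j < q, x (k (j + 1)) ∈ Set.range (om clT c (w j).1) := by
    intro j hj
    have h2 := hk j hj
    have := (mem_range_om_of_edge (hst j hj (k (j + 1) - 1) (by omega) (by omega))).2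
    rwa [Nat.sub_add_cancel (by omega)] at this
  have hdist : ∀ j < q, x (k j) ≠ x (k (j + 1)) := by
    intro j hj he
    have h1 := hk j hj
    have h2 := hkn (j + 1) hj
    rcases Nat.lt_or_ge (k j + 1) (k (j + 1)) with h3 | h3
    · have e1 : k j + (k (j + 1) - k j) = k (j + 1) := by omega
      obtain ⟨s, hs1, hs2⟩ := hsys.ear_of_single hT ⟨(w j).1, (w j).2, rfl⟩
        (n := k (j + 1) - k j) (x := fun s => x (k j + s)) (by omega) (by omega)
        (fun s hs' => hst j hj (k j + s) (by omega) (by omega)) (Or.inl (by simpa [e1] using he))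
      exact hno ⟨k j + s, by omega, hs2⟩
    · exact hne (k j) (by omega) (by rw [he]; congr 1; omega)
  have hrun : ∀ j < q, (w j).1 ∈ E₀ → x (k j) ∈ S → x (k (j + 1)) ∈ S →
      ∀ i, k j ≤ i → i ≤ k (j + 1) → x i ∈ S := by
    intro j hj hwj ha hb i hi1 hi2
    have h1 := hk j hj
    have h2 := hkn (j + 1) hj
    have hoi := om_injective (clT := clT) (c := c) (hinj _ (w j).2)
    have hv : ∀ s, ∃ v, s ≤ k (j + 1) - k j → om clT c (w j).1 v = x (k j + s) := by
      intro s
      rcases Nat.lt_or_ge s (k (j + 1) - k j) with h3 | h3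
      · obtain ⟨v, hv⟩ := (mem_range_om_of_edge (hst j hj (k j + s) (by omega) (by omega))).1
        exact ⟨v, fun _ => hv⟩
      · obtain ⟨v, hv⟩ := hend j hj
        refine ⟨v, fun h4 => ?_⟩
        rw [hv]
        congr 1
        omega
    choose v hv using hv
    have e1 : k j + (k (j + 1) - k j) = k (j + 1) := by omega
    rcases hconv (k (j + 1) - k j) v (by omega)
      (by
        intro s hs'
        obtain ⟨t, ht, h3, h4⟩ := hst j hj (k j + s) (by omega) (by omega)
        rw [← hv s (by omega)] at h3
        rw [add_assoc, ← hv (s + 1) (by omega)] at h4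
        exact Co2_eb_comp hoi ht h3 h4)
      (by
        rw [← hS₃ _ hwj, hv 0 (by omega)]
        exact ha)
      (by
        rw [← hS₃ _ hwj, hv _ le_rfl, e1]
        exact hb) with ⟨s, hs', _, ⟨t, ht, rfl⟩, ⟨a, ha⟩, ⟨b, hb⟩, ⟨d, hd⟩⟩ | hall
    · refine absurd ⟨k j + s, by omega, _, ⟨_, ⟨_, ⟨_, (w j).2, rfl⟩, t, ht, rfl⟩, rfl⟩,
        ⟨a, ?_⟩, ⟨b, ?_⟩, ⟨d, ?_⟩⟩ hno
      · rw [← hv s (by omega), ← ha]; rfl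
      · rw [add_assoc, ← hv (s + 1) (by omega), ← hb]; rfl
      · rw [add_assoc, ← hv (s + 2) (by omega), ← hd]; rfl
    · have := (hS₃ _ hwj _).2 (hall (i - k j) (by omega))
      rw [hv _ (by omega)] at this
      rwa [show k j + (i - k j) = i by omega] at this
  have hmw : ∀ j < q, ∀ y, (x (k j) = Sum.inl y → y ∈ Set.range (w j).1) ∧
      (x (k (j + 1)) = Sum.inl y → y ∈ Set.range (w j).1) := by
    refine fun j hj y => ⟨fun h1 => ?_, fun h1 => ?_⟩
    · obtain ⟨v, hv⟩ := hstart j hj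
      exact ⟨_, (om_eq_inl (hv.trans h1)).1⟩
    · obtain ⟨v, hv⟩ := hend j hj
      exact ⟨_, (om_eq_inl (hv.trans h1)).1⟩
  have hfirst : ∀ g v, x 0 = Sum.inr (g, v) → (w 0).1 ∈ E₀ := by
    intro g v h1
    have h2 := hstart 0 (by omega)
    rw [hk0, h1] at h2
    rw [eq_of_inr_mem_range_om h2]
    exact hS₂ g v (h1 ▸ h0)
  have hlast : ∀ g v, x n = Sum.inr (g, v) → (w (q - 1)).1 ∈ E₀ := by
    intro g v h1
    have h2 := hend (q - 1) (by omega)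
    rw [Nat.sub_add_cancel hq, hkq, h1] at h2
    rw [eq_of_inr_mem_range_om h2]
    exact hS₂ g v (h1 ▸ hxn)
  suffices hw₀ : ∀ j < q, (w j).1 ∈ E₀ by
    have hbd : ∀ j < q, x (k (j + 1)) ∈ S := by
      intro j hj
      rcases Nat.lt_or_ge (j + 1) q with h1 | h1
      · have h2 := hend j hj
        have h3 := hstart (j + 1) h1
        have h4 := hw j h1
        rcases hx : x (k (j + 1)) with y | ⟨g, v⟩
        · exact hmeet _ (hw₀ j hj) _ (hw₀ _ h1) (fun e => h4 (Subtype.ext e)) y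
            ((hmw j hj y).2 hx) ((hmw _ h1 y).1 hx)
        · rw [hx] at h2 h3
          exact absurd (Subtype.ext ((eq_of_inr_mem_range_om h2).trans
            (eq_of_inr_mem_range_om h3).symm)) h4
      · rw [show j + 1 = q by omega, hkq]
        exact hxn
    have hall : ∀ j ≤ q, ∀ i ≤ k j, x i ∈ S := by
      intro j
      induction j with
      | zero =>
        intro _ i hi
        rw [hk0] at hi
        rwa [Nat.le_zero.1 hi]
      | succ j ih =>
        intro hj i hi
        rcases Nat.le_total i (k j) with h1 | h1
        · exact ih (by omega) i h1
        · exact hrun j hj (hw₀ j hj) (ih (by omega) _ le_rfl) (hbd j hj) i h1 hi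
    intro i hi
    exact hall q le_rfl i (by rwa [hkq])
  rcases Nat.lt_or_ge q 2 with hq2 | hq2
  · obtain rfl : q = 1 := by omega
    intro j hj
    obtain rfl : j = 0 := by omega
    rcases hx0 : x 0 with y | ⟨g, v⟩
    · rcases hxn' : x n with y' | ⟨g, v⟩
      · have h2 := hmw 0 hj y
        have h3 := hmw 0 hj y'
        have h4 := hdist 0 hj
        rw [hk0, zero_add, hkq, hx0, hxn'] at h4
        rw [hk0] at h2
        rw [zero_add, hkq] at h3
        exact hE₀ _ (w 0).2 y y' (fun e => h4 (by rw [e])) (hS₁ y (hx0 ▸ h0))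
          (hZ₀ (hS₁ y' (hxn' ▸ hxn))) (h2.1 hx0) (h3.2 hxn')
      · exact hlast g v hxn'
    · exact hfirst g v hx0
  have hin : ∀ j, j + 1 < q → ∃ y, x (k (j + 1)) = Sum.inl y := by
    intro j hj
    have h2 := hend j (by omega)
    have h3 := hstart (j + 1) hj
    rcases hx : x (k (j + 1)) with y | ⟨g, v⟩
    · exact ⟨y, rfl⟩
    · rw [hx] at h2 h3
      exact absurd (Subtype.ext ((eq_of_inr_mem_range_om h2).trans
        (eq_of_inr_mem_range_om h3).symm)) (hw j hj)
  obtain ⟨a, ha1, ⟨ya, hya, hyaZ⟩, hwa⟩ : ∃ a, a ≤ 1 ∧ (∃ y, x (k a) = Sum.inl y ∧ y ∈ Z₀) ∧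
      ∀ j < a, (w j).1 ∈ E₀ := by
    rcases hx0 : x 0 with y | ⟨g, v⟩
    · exact ⟨0, by omega, ⟨y, by rw [hk0, hx0], hS₁ y (hx0 ▸ h0)⟩, by omega⟩
    · have h1 := hfirst g v hx0
      obtain ⟨y, hy⟩ := hin 0 (by omega)
      refine ⟨1, le_rfl, ⟨y, hy, hran _ h1 ((hmw 0 (by omega) y).2 hy)⟩, fun j hj => ?_⟩
      rwa [show j = 0 by omega]
  obtain ⟨b, hb1, hbq, ⟨yb, hyb, hybZ⟩, hwb⟩ : ∃ b, q ≤ b + 1 ∧ b ≤ q ∧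
      (∃ y, x (k b) = Sum.inl y ∧ y ∈ Z₀) ∧ ∀ j, b ≤ j → j < q → (w j).1 ∈ E₀ := by
    rcases hx0 : x n with y | ⟨g, v⟩
    · exact ⟨q, by omega, le_rfl, ⟨y, by rw [hkq, hx0], hS₁ y (hx0 ▸ hxn)⟩, by omega⟩
    · have h1 := hlast g v hx0
      obtain ⟨y, hy⟩ := hin (q - 2) (by omega)
      have e1 : q - 2 + 1 = q - 1 := by omega
      rw [e1] at hy
      refine ⟨q - 1, by omega, by omega,
        ⟨y, hy, hran _ h1 ((hmw (q - 1) (by omega) y).1 hy)⟩, fun j hj hj' => ?_⟩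
      rwa [show j = q - 1 by omega]
  have hyex : ∀ j, ∃ y, a ≤ j → j ≤ b → x (k j) = Sum.inl y := by
    intro j
    by_cases hj : a ≤ j ∧ j ≤ b
    · rcases hj.1.eq_or_lt with rfl | h1
      · exact ⟨ya, fun _ _ => hya⟩
      · rcases hj.2.eq_or_lt with rfl | h2
        · exact ⟨yb, fun _ _ => hyb⟩
        · obtain ⟨y, hy⟩ := hin (j - 1) (by omega)
          rw [Nat.sub_add_cancel (by omega)] at hy
          exact ⟨y, fun _ _ => hy⟩
    · exact ⟨ya, fun h1 h2 => absurd ⟨h1, h2⟩ hj⟩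
  choose y hy using hyex
  have hyw : ∀ j, a ≤ j → j < b → y j ∈ Set.range (w j).1 ∧ y (j + 1) ∈ Set.range (w j).1 ∧
      y j ≠ y (j + 1) := by
    intro j hj1 hj2
    refine ⟨(hmw j (by omega) _).1 (hy j hj1 (by omega)),
      (hmw j (by omega) _).2 (hy (j + 1) (by omega) hj2), fun e => hdist j (by omega) ?_⟩
    rw [hy j hj1 (by omega), hy (j + 1) (by omega) hj2, e]
  have hlen : ∀ j, a ≤ j → j < b → k j + 2 ≤ k (j + 1) := by
    intro j hj1 hj2
    have hkj := hk j (by omega)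
    by_contra hlt
    have e1 : k (j + 1) = k j + 1 := by omega
    obtain ⟨t, ht, h1, h2⟩ := hst j (by omega) (k j) le_rfl hkj
    rw [← e1] at h2
    rw [hy j hj1 (by omega)] at h1
    rw [hy (j + 1) (by omega) hj2] at h2
    exact (hyw j hj1 hj2).2.2 (inl_eq_of_mem_edge hcl ht h1 h2)
  have hab : a ≤ b := by omega
  have hba := two_mul_le_of_runs a hlen b hab le_rfl
  have hbn := hkn b hbq
  have e1 : a + (b - a) = b := by omega
  have hyaa : y a = ya := Sum.inl.inj ((hy a le_rfl hab).symm.trans hya)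
  have hybb : y b = yb := Sum.inl.inj ((hy b hab le_rfl).symm.trans hyb)
  have hyZ : ∀ j, a ≤ j → j ≤ b → y j ∈ Z := by
    rcases hZ (b - a) (fun j => y (a + j)) (by omega)
      (fun j hj => ⟨_, ⟨_, (w (a + j)).2, rfl⟩, (hyw (a + j) (by omega) (by omega)).1,
        (hyw (a + j) (by omega) (by omega)).2.1⟩)
      (by simpa [hyaa] using hZ₀ hyaZ) (by simpa [e1, hybb] using hZ₀ hybZ) with
      ⟨j, hj, _, ⟨g, hg, rfl⟩, g1, g2, g3⟩ | hall
    · exfalso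
      have a1 := hyw (a + j) (by omega) (by omega)
      have a2 := hyw (a + j + 1) (by omega) (by omega)
      have h5 := hlin _ (w (a + j)).2 g hg _ _ a1.2.2 a1.1 a1.2.1 g1 g2
      have h6 := hlin _ (w (a + j + 1)).2 g hg _ _ a2.2.2 a2.1 a2.2.1 g2 g3
      exact hw (a + j) (by omega) (Subtype.ext (h5.trans h6.symm))
    · intro j hj1 hj2
      have := hall (j - a) (by omega)
      beta_reduce at this
      rwa [show a + (j - a) = j by omega] at this
  have hyZ₀ : ∀ j, a + j ≤ b → y (a + j) ∈ Z₀ ∧ ∀ i < j, (w (a + i)).1 ∈ E₀ := by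
    intro j
    induction j with
    | zero =>
      refine fun _ => ⟨?_, by omega⟩
      rwa [add_zero, hyaa]
    | succ j ih =>
      intro hj
      obtain ⟨h1, h2⟩ := ih (by omega)
      have a1 := hyw (a + j) (by omega) (by omega)
      have h3 := hE₀ _ (w (a + j)).2 _ _ a1.2.2 h1 (hyZ (a + j + 1) (by omega) (by omega)) a1.1
        a1.2.1
      refine ⟨hran _ h3 a1.2.1, fun i hi => ?_⟩
      rcases Nat.lt_succ_iff_lt_or_eq.1 hi with h4 | rfl
      · exact h2 i h4
      · exact h3
  intro j hj
  rcases Nat.lt_or_ge j a with h1 | h1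
  · exact hwa j h1
  · rcases Nat.lt_or_ge j b with h2 | h2
    · have := (hyZ₀ (b - a) (by omega)).2 (j - a) (by omega)
      rwa [show a + (j - a) = j by omega] at this
    · exact hwb j h2 hj

end

/-! ### The Ramsey property with girth, and the auxiliary hypergraph of a pasting -/

/-- Every ordered linear hypergraph has a strongly induced Ramsey system of ordered copies without
cycles of length at most `m`. -/
def Ram (m : ℕ) : Prop :=
  ∀ (ι U C : Type) [Finite ι] [Nonempty ι] [Finite U] [Finite C] [Nonempty C] (o : ι → ℕ)
    (F : Set (ι → U)) (ρ : U → ℕ), Function.Injective o → Lin F →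
    (∀ f ∈ F, ∀ i j, o i < o j → ρ (f i) < ρ (f j)) →
    ∃ (V : Type) (_ : Finite V) (Φ : Set (U → V)) (σ : V → ℕ), Sys F Φ ∧ PathEar (eb Φ) m ∧
      (∀ φ ∈ Φ, ∀ x y, ρ x < ρ y → σ (φ x) < σ (φ y)) ∧
      ∀ c : (ι → V) → C, ∃ φ ∈ Φ, ∃ k, ∀ f ∈ F, c (φ ∘ f) = k

open Classical in
/-- The hyperedge recording the `j`-th copy inside the copy `A`. -/
noncomputable def kap {ι V T V₁ J : Type} (ε : J → V → V₁) (D : Set V) (cls : V → ι) (c : ι)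
    (A : V → T) (j : J) (l : Option T) : (V → T) × (V₁ ⊕ (J × Option T)) :=
  (A, if h : ∃ x ∈ D, cls x = c ∧ l = some (A x) then Sum.inl (ε j h.choose) else Sum.inr (j, l))

section
variable {ι V T V₁ J : Type} {ε : J → V → V₁} {D : Set V} {cls : V → ι} {c : ι} {A : V → T}

lemma kap_none (j : J) : kap ε D cls c A j none = (A, Sum.inr (j, none)) := by
  unfold kap
  rw [dif_neg]
  simp

lemma kap_cases (j : J) (l : Option T) :
    (∃ x ∈ D, cls x = c ∧ l = some (A x) ∧ kap ε D cls c A j l = (A, Sum.inl (ε j x))) ∨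
      ((¬ ∃ x ∈ D, cls x = c ∧ l = some (A x)) ∧
        kap ε D cls c A j l = (A, Sum.inr (j, l))) := by
  by_cases h : ∃ x ∈ D, cls x = c ∧ l = some (A x)
  · refine Or.inl ⟨h.choose, h.choose_spec.1, h.choose_spec.2.1, h.choose_spec.2.2, ?_⟩
    unfold kap
    rw [dif_pos h]
  · refine Or.inr ⟨h, ?_⟩
    unfold kap
    rw [dif_neg h]

lemma kap_of_mem (hA : Set.InjOn A D) (j : J) {x : V} (hx : x ∈ D) (hc : cls x = c) :
    kap ε D cls c A j (some (A x)) = (A, Sum.inl (ε j x)) := by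
  rcases kap_cases (ε := ε) (D := D) (cls := cls) (c := c) (A := A) j (some (A x)) with
    ⟨y, hy, -, h1, h2⟩ | ⟨h1, -⟩
  · rw [h2, hA hx hy (Option.some.inj h1)]
  · exact absurd ⟨x, hx, hc, rfl⟩ h1

lemma kap_eq_inl {A' : V → T} {j : J} {l : Option T} {y : V₁}
    (h : kap ε D cls c A j l = (A', Sum.inl y)) :
    ∃ x ∈ D, cls x = c ∧ l = some (A x) ∧ y = ε j x := by
  rcases kap_cases (ε := ε) (D := D) (cls := cls) (c := c) (A := A) j l with
    ⟨x, hx, h1, h2, h3⟩ | ⟨-, h3⟩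
  · rw [h3] at h
    exact ⟨x, hx, h1, h2, (Sum.inl.inj (congrArg Prod.snd h)).symm⟩
  · rw [h3] at h
    simp at h

lemma kap_eq_inr {A' : V → T} {j i : J} {l l' : Option T}
    (h : kap ε D cls c A j l = (A', Sum.inr (i, l'))) : j = i ∧ l = l' := by
  rcases kap_cases (ε := ε) (D := D) (cls := cls) (c := c) (A := A) j l with
    ⟨x, hx, h1, h2, h3⟩ | ⟨-, h3⟩
  · rw [h3] at h
    simp at h
  · rw [h3] at h
    simpa using congrArg Prod.snd h

variable {M : ℕ} {E : Set (ι → V)} {r : V → ℕ} {D₁ : Set V₁} {cls₁ : V₁ → ι} {E₁ : Set (ι → V₁)}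
  {r₁ : V₁ → ℕ} {ord : J → ℕ}

lemma kap_injective (hε : ∀ j, Set.InjOn (ε j) D) (j : J) :
    Function.Injective (kap ε D cls c A j) := by
  intro l l' h
  rcases kap_cases (ε := ε) (D := D) (cls := cls) (c := c) (A := A) j l' with
    ⟨x, hx, -, h2, h3⟩ | ⟨-, h3⟩
  · rw [h3] at h
    obtain ⟨y, hy, -, h4, h5⟩ := kap_eq_inl h
    rw [h4, h2, hε j hx hy h5]
  · rw [h3] at h
    exact (kap_eq_inr h).2

/-- The hyperedges `kap` for a family `𝒜` of maps. -/
def kapEdges {ι V T V₁ J : Type} (ε : J → V → V₁) (D : Set V) (cls : V → ι) (c : ι)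
    (𝒜 : Set (V → T)) : Set (Option T → (V → T) × (V₁ ⊕ (J × Option T))) :=
  {f | ∃ A ∈ 𝒜, ∃ j, f = kap ε D cls c A j}

lemma Pasting.lin_kapEdges (p : Pasting M D cls E r D₁ cls₁ E₁ r₁ ord ε c) (𝒜 : Set (V → T)) :
    Lin (kapEdges ε D cls c 𝒜) := by
  rintro _ ⟨A, hA, j, rfl⟩ _ ⟨A', hA', j', rfl⟩ x y hxy ⟨a, ha⟩ ⟨b, hb⟩ ⟨a', ha'⟩ ⟨b', hb'⟩
  obtain rfl : A = A' := (congrArg Prod.fst ha).trans (congrArg Prod.fst ha').symm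
  by_cases hj : j = j'
  · rw [hj]
  exfalso
  rcases kap_cases (ε := ε) (D := D) (cls := cls) (c := c) (A := A) j a with
    ⟨u, hu, hu1, -, h3⟩ | ⟨-, h3⟩
  · rcases kap_cases (ε := ε) (D := D) (cls := cls) (c := c) (A := A) j b with
      ⟨v, hv, hv1, -, h4⟩ | ⟨-, h4⟩
    · obtain ⟨u', hu', -, -, h5⟩ := kap_eq_inl (ha'.trans (ha.symm.trans h3))
      obtain ⟨v', hv', -, -, h6⟩ := kap_eq_inl (hb'.trans (hb.symm.trans h4))
      have := p.share j j' u hu u' hu' v hv v' hv' hu1 hv1 hj h5 h6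
      apply hxy
      rw [← ha, ← hb, h3, h4, this]
    · exact hj (kap_eq_inr (hb'.trans (hb.symm.trans h4))).1.symm
  · exact hj (kap_eq_inr (ha'.trans (ha.symm.trans h3))).1.symm

lemma Pasting.pathEar_kapEdges (p : Pasting M D cls E r D₁ cls₁ E₁ r₁ ord ε c)
    {𝒜 : Set (V → T)} (h𝒜 : ∀ A ∈ 𝒜, Set.InjOn A D) {m : ℕ} (hm : m ≤ M) :
    PathEar (eb (kapEdges ε D cls c 𝒜)) m := by
  apply Cyc.pathEar
  intro n x hn hnm hp hs
  have hst : ∀ i, ∃ A ∈ 𝒜, ∃ j, x i ∈ Set.range (kap ε D cls c A j) ∧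
      x (i + 1) ∈ Set.range (kap ε D cls c A j) := by
    intro i
    obtain ⟨_, ⟨_, ⟨A, hA, j, rfl⟩, rfl⟩, h1, h2⟩ := hs i
    exact ⟨A, hA, j, h1, h2⟩
  choose A hA j h1 h2 using hst
  have hfst : ∀ i, (x i).1 = A i ∧ (x (i + 1)).1 = A i := by
    intro i
    obtain ⟨a, ha⟩ := h1 i
    obtain ⟨b, hb⟩ := h2 i
    exact ⟨by rw [← ha]; rfl, by rw [← hb]; rfl⟩
  have hA1 : ∀ i, A (i + 1) = A i := fun i => (hfst (i + 1)).1.symm.trans (hfst i).2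
  have hinr : ∀ i i' a, x i = (a, Sum.inr i') → ∃ i, Co3 (eb (kapEdges ε D cls c 𝒜))
      (x i) (x (i + 1)) (x (i + 2)) := by
    intro i i' a hi
    obtain ⟨j₀, l⟩ := i'
    have e1 : i + n - 1 + 1 = i + n := by omega
    have e2 : i + n - 1 + 2 = i + n + 1 := by omega
    have h3 := h1 (i + n)
    have h4 := h2 (i + n - 1)
    have h5 := hA1 (i + n - 1)
    rw [e1] at h4 h5
    have h6 : j (i + n) = j (i + n - 1) := by
      obtain ⟨l3, h3⟩ := h3
      obtain ⟨l4, h4⟩ := h4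
      rw [hp, hi] at h3 h4
      rw [(kap_eq_inr h3).1, (kap_eq_inr h4).1]
    refine ⟨i + n - 1, _, ⟨_, ⟨_, hA (i + n - 1), j (i + n - 1), rfl⟩, rfl⟩, h1 _, h2 _, ?_⟩
    rw [e2, ← h5, ← h6]
    exact h2 (i + n)
  by_cases hex : ∃ i a i', x i = (a, Sum.inr i')
  · obtain ⟨i, a, i', hi⟩ := hex
    exact hinr i i' a hi
  push Not at hex
  have hz : ∀ i, ∃ z, x i = (A i, Sum.inl z) := by
    intro i
    rcases hx : x i with ⟨a, z | z⟩
    · refine ⟨z, ?_⟩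
      rw [← (hfst i).1, hx]
    · exact absurd hx (hex i a z)
  choose z hz using hz
  obtain ⟨i, _, ⟨j', rfl⟩, ⟨a, ha, h3⟩, ⟨b, hb, h4⟩, ⟨d, hd, h5⟩⟩ := p.cyc n z hn (hnm.trans hm)
    (by
      intro i
      have h3 := hp i
      rw [hz, hz] at h3
      exact Sum.inl.inj (congrArg Prod.snd h3))
    (by
      intro i
      obtain ⟨a, ha⟩ := h1 i
      obtain ⟨b, hb⟩ := h2 i
      rw [hz] at ha hb
      obtain ⟨u, hu, hu1, -, hu2⟩ := kap_eq_inl ha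
      obtain ⟨v, hv, hv1, -, hv2⟩ := kap_eq_inl hb
      exact ⟨_, ⟨j i, rfl⟩, ⟨u, ⟨hu, hu1⟩, hu2.symm⟩, ⟨v, ⟨hv, hv1⟩, hv2.symm⟩⟩)
  refine ⟨i, _, ⟨_, ⟨_, hA i, j', rfl⟩, rfl⟩, ⟨some (A i a), ?_⟩, ⟨some (A i b), ?_⟩,
    ⟨some (A i d), ?_⟩⟩
  · rw [kap_of_mem (h𝒜 _ (hA i)) j' ha.1 ha.2, hz, h3]
  · rw [kap_of_mem (h𝒜 _ (hA i)) j' hb.1 hb.2, hz, h4, hA1]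
  · rw [kap_of_mem (h𝒜 _ (hA i)) j' hd.1 hd.2, hz, h5, hA1, hA1]

/-- Orders on the hyperedges `kap` and on their vertices. -/
lemma Pasting.exists_rank [Finite V] [Finite V₁] [Finite J] [Finite T]
    (p : Pasting M D cls E r D₁ cls₁ E₁ r₁ ord ε c) (rT : T → ℕ) {𝒜 : Set (V → T)}
    (h𝒜 : ∀ A ∈ 𝒜, ∀ x ∈ D, ∀ y ∈ D, cls x = cls y → r x < r y → rT (A x) < rT (A y)) :
    ∃ (o : Option T → ℕ) (ρ : (V → T) × (V₁ ⊕ (J × Option T)) → ℕ), Function.Injective o ∧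
      (∀ f ∈ kapEdges ε D cls c 𝒜, ∀ l l', o l < o l' → ρ (f l) < ρ (f l')) ∧
      (∀ A y y', r₁ y < r₁ y' → ρ (A, Sum.inl y) < ρ (A, Sum.inl y')) ∧
      ∀ A j j', ord j < ord j' → ρ (A, Sum.inr (j, none)) < ρ (A, Sum.inr (j', none)) := by
  obtain ⟨o, ho, hkey⟩ := exists_injective_rank fun l : Option T =>
    (l.elim (toLex (1, 0)) (fun v => toLex (0, rT v)) : ℕ ×ₗ ℕ)
  have hot : ∀ v w, rT v < rT w → o (some v) < o (some w) := by
    intro v w h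
    apply hkey
    simp only [Option.elim]
    rw [Prod.Lex.toLex_lt_toLex]
    exact Or.inr ⟨rfl, h⟩
  have hon : ∀ v, o (some v) < o none := by
    intro v
    apply hkey
    simp only [Option.elim]
    rw [Prod.Lex.toLex_lt_toLex]
    exact Or.inl Nat.zero_lt_one
  obtain ⟨N, hN⟩ : ∃ N, ∀ y, r₁ y < N := by
    obtain ⟨N, hN⟩ := (Set.finite_range r₁).bddAbove
    exact ⟨N + 1, fun y => Nat.lt_succ_of_le (hN ⟨y, rfl⟩)⟩
  let B : (V → T) → J → T → Set ℕ := fun A j v =>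
    {n | ∃ x, x ∈ D ∧ cls x = c ∧ o (some (A x)) < o (some v) ∧ n = r₁ (ε j x) + 1}
  have hB : ∀ A j v, N ∈ upperBounds (B A j v) := by
    rintro A j v _ ⟨x, -, -, -, rfl⟩
    exact hN _
  let key : (V → T) × (V₁ ⊕ (J × Option T)) → ℕ ×ₗ ℕ := fun q =>
    Sum.elim (fun y => toLex (r₁ y + 1, 0))
      (fun s => s.2.elim (toLex (N + 1, ord s.1))
        (fun v => toLex (sSup (B q.1 s.1 v), 1 + o (some v)))) q.2
  obtain ⟨ρ, -, hρ⟩ := exists_injective_rank key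
  have hlt : ∀ A ∈ 𝒜, ∀ j, ∀ x ∈ D, ∀ y ∈ D, cls x = cls y → o (some (A x)) < o (some (A y)) →
      r₁ (ε j x) < r₁ (ε j y) := by
    intro A hA j x hx y hy hc h
    apply p.mono j x hx y hy hc
    rcases Nat.lt_trichotomy (r x) (r y) with h1 | h1 | h1
    · exact h1
    · rw [p.rank_inj h1] at h
      exact absurd h (lt_irrefl _)
    · exact absurd h (hot _ _ (h𝒜 A hA y hy x hx hc.symm h1)).not_gt
  refine ⟨o, ρ, ho, ?_, ?_, ?_⟩
  · rintro _ ⟨A, hA, j, rfl⟩ l l' h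
    apply hρ
    rcases kap_cases (ε := ε) (D := D) (cls := cls) (c := c) (A := A) j l with
      ⟨x, hx, hx1, rfl, h3⟩ | ⟨-, h3⟩ <;>
    rcases kap_cases (ε := ε) (D := D) (cls := cls) (c := c) (A := A) j l' with
      ⟨y, hy, hy1, rfl, h4⟩ | ⟨-, h4⟩ <;>
    rw [h3, h4] <;> simp only [key, Sum.elim_inl, Sum.elim_inr]
    · rw [Prod.Lex.toLex_lt_toLex]
      exact Or.inl (Nat.succ_lt_succ (hlt A hA j x hx y hy (hx1.trans hy1.symm) h))
    · rcases l' with - | v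
      · simp only [Option.elim]
        rw [Prod.Lex.toLex_lt_toLex]
        exact Or.inl (Nat.succ_lt_succ (hN _))
      · simp only [Option.elim]
        rw [Prod.Lex.toLex_lt_toLex]
        have h5 : r₁ (ε j x) + 1 ≤ sSup (B A j v) :=
          le_csSup ⟨N, hB A j v⟩ ⟨x, hx, hx1, h, rfl⟩
        rcases h5.lt_or_eq with h6 | h6
        · exact Or.inl h6
        · exact Or.inr ⟨h6, by omega⟩
    · rcases l with - | v
      · exact absurd h (hon _).not_gt
      · simp only [Option.elim]
        rw [Prod.Lex.toLex_lt_toLex]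
        refine Or.inl (Nat.lt_succ_of_le (csSup_le' ?_))
        rintro _ ⟨x, hx, hx1, hx2, rfl⟩
        exact hlt A hA j x hx y hy (hx1.trans hy1.symm) (hx2.trans h)
    · rcases l with - | v
      · rcases l' with - | v'
        · exact absurd h (lt_irrefl _)
        · exact absurd h (hon _).not_gt
      · rcases l' with - | v'
        · simp only [Option.elim]
          rw [Prod.Lex.toLex_lt_toLex]
          exact Or.inl (Nat.lt_succ_of_le (csSup_le' (hB A j v)))
        · simp only [Option.elim]
          rw [Prod.Lex.toLex_lt_toLex]
          have h5 : sSup (B A j v) ≤ sSup (B A j v') := by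
            apply csSup_le'
            rintro _ ⟨x, hx, hx1, hx2, rfl⟩
            exact le_csSup ⟨N, hB A j v'⟩ ⟨x, hx, hx1, hx2.trans h, rfl⟩
          rcases h5.lt_or_eq with h6 | h6
          · exact Or.inl h6
          · exact Or.inr ⟨h6, by omega⟩
  · intro A y y' h
    apply hρ
    simp only [key, Sum.elim_inl]
    rw [Prod.Lex.toLex_lt_toLex]
    exact Or.inl (Nat.succ_lt_succ h)
  · intro A j j' h
    apply hρ
    simp only [key, Sum.elim_inr, Option.elim]
    rw [Prod.Lex.toLex_lt_toLex]
    exact Or.inr ⟨rfl, h⟩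

end

/-! ### Ramsey hypergraphs for pasted hypergraphs -/

open Classical in
/-- The copy of a pasted hypergraph in the attached hypergraph. -/
noncomputable def pasteMap {ι V T V₁ J Y : Type} (ε : J → V → V₁) (D : Set V) (cls : V → ι)
    (clT : T → ι) (c : ι) (Θ : (V → T) × (V₁ ⊕ (J × Option T)) → Y) (A : V → T) (y : V₁) :
    Y ⊕ ((Option T → Y) × T) :=
  if h : ∃ p : J × V, p.2 ∈ D ∧ cls p.2 ≠ c ∧ y = ε p.1 p.2 then
    om clT c (Θ ∘ kap ε D cls c A h.choose.1) (A h.choose.2)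
  else Sum.inl (Θ (A, Sum.inl y))

section
variable {ι V T V₁ J Y : Type} {ε : J → V → V₁} {D : Set V} {cls : V → ι} {c : ι} {clT : T → ι}
  {A : V → T} {Θ : (V → T) × (V₁ ⊕ (J × Option T)) → Y}
  {M : ℕ} {E : Set (ι → V)} {r : V → ℕ} {D₁ : Set V₁} {cls₁ : V₁ → ι} {E₁ : Set (ι → V₁)}
  {r₁ : V₁ → ℕ} {ord : J → ℕ}

lemma pasteMap_inl (p : Pasting M D cls E r D₁ cls₁ E₁ r₁ ord ε c) (j : J) {x : V} (hx : x ∈ D)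
    (hc : cls x = c) :
    pasteMap ε D cls clT c Θ A (ε j x) = Sum.inl (Θ (A, Sum.inl (ε j x))) := by
  unfold pasteMap
  rw [dif_neg]
  rintro ⟨⟨i, z⟩, hz, hz1, hz2⟩
  have := congrArg cls₁ hz2
  rw [p.cls_eq j x hx, p.cls_eq i z hz, hc] at this
  exact hz1 this.symm

lemma pasteMap_apply (p : Pasting M D cls E r D₁ cls₁ E₁ r₁ ord ε c) (hA : Set.InjOn A D)
    (hcl : ∀ x ∈ D, clT (A x) = cls x) (j : J) {x : V} (hx : x ∈ D) :
    pasteMap ε D cls clT c Θ A (ε j x) = om clT c (Θ ∘ kap ε D cls c A j) (A x) := by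
  by_cases hc : cls x = c
  · rw [pasteMap_inl p j hx hc]
    unfold om
    rw [if_pos (by rw [hcl x hx, hc]), Function.comp_apply, kap_of_mem hA j hx hc]
  · have hex : ∃ q : J × V, q.2 ∈ D ∧ cls q.2 ≠ c ∧ ε j x = ε q.1 q.2 := ⟨(j, x), hx, hc, rfl⟩
    unfold pasteMap
    rw [dif_pos hex]
    obtain ⟨h1, h2, h3⟩ := hex.choose_spec
    have h4 := p.priv _ _ _ hx _ h1 hc h3
    rw [← h4] at h3 ⊢
    rw [← p.injOn j hx h1 h3]

lemma pasteMap_eq_inl (p : Pasting M D cls E r D₁ cls₁ E₁ r₁ ord ε c) (hA : Set.InjOn A D)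
    (hcl : ∀ x ∈ D, clT (A x) = cls x) {j : J} {x : V} (hx : x ∈ D) {y : Y}
    (h : pasteMap ε D cls clT c Θ A (ε j x) = Sum.inl y) :
    cls x = c ∧ y = Θ (A, Sum.inl (ε j x)) := by
  have h1 := (om_eq_inl ((pasteMap_apply p hA hcl j hx).symm.trans h)).2
  rw [hcl x hx] at h1
  rw [pasteMap_inl p j hx h1] at h
  exact ⟨h1, (Sum.inl.inj h).symm⟩

lemma pasteMap_eq_inr (p : Pasting M D cls E r D₁ cls₁ E₁ r₁ ord ε c) (hA : Set.InjOn A D)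
    (hcl : ∀ x ∈ D, clT (A x) = cls x) {j : J} {x : V} (hx : x ∈ D) {g : Option T → Y} {v : T}
    (h : pasteMap ε D cls clT c Θ A (ε j x) = Sum.inr (g, v)) :
    Θ ∘ kap ε D cls c A j = g ∧ A x = v ∧ cls x ≠ c := by
  have h1 := om_eq_inr ((pasteMap_apply p hA hcl j hx).symm.trans h)
  rw [hcl x hx] at h1
  exact h1

lemma comp_kap_injective (hΘ : Function.Injective Θ) {j j' : J}
    (h : Θ ∘ kap ε D cls c A j = Θ ∘ kap ε D cls c A j') : j = j' := by
  have := hΘ (congrFun h none)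
  rw [kap_none] at this
  exact ((kap_eq_inr this.symm).1).symm

/-- A vertex of the copy attached to the `j`-th hyperedge that belongs to the pasted copy comes
from the `j`-th copy. -/
lemma exists_of_om_eq (p : Pasting M D cls E r D₁ cls₁ E₁ r₁ ord ε c) (hA : Set.InjOn A D)
    (hcl : ∀ x ∈ D, clT (A x) = cls x) (hΘ : Function.Injective Θ) {j : J} {v : T} {y : V₁}
    (hy : y ∈ D₁) (h : om clT c (Θ ∘ kap ε D cls c A j) v = pasteMap ε D cls clT c Θ A y) :
    ∃ x ∈ D, v = A x ∧ y = ε j x := by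
  obtain ⟨i, z, hz, rfl⟩ := p.exists_eq y hy
  rcases hq : pasteMap ε D cls clT c Θ A (ε i z) with q | ⟨g, w⟩
  · obtain ⟨h1, h2⟩ := pasteMap_eq_inl p hA hcl hz hq
    rw [hq] at h
    obtain ⟨h3, -⟩ := om_eq_inl h
    rw [h2] at h3
    obtain ⟨x, hx, -, h4, h5⟩ := kap_eq_inl (hΘ h3)
    exact ⟨x, hx, Option.some.inj h4, h5⟩
  · obtain ⟨h1, h2, -⟩ := pasteMap_eq_inr p hA hcl hz hq
    rw [hq] at h
    obtain ⟨h3, h4, -⟩ := om_eq_inr h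
    obtain rfl := comp_kap_injective hΘ (h3.trans h1.symm)
    exact ⟨z, hz, h4.trans h2.symm, rfl⟩

lemma om_mem_image_iff (p : Pasting M D cls E r D₁ cls₁ E₁ r₁ ord ε c) (hA : Set.InjOn A D)
    (hcl : ∀ x ∈ D, clT (A x) = cls x) (hΘ : Function.Injective Θ) (j : J) (v : T) :
    om clT c (Θ ∘ kap ε D cls c A j) v ∈ pasteMap ε D cls clT c Θ A '' D₁ ↔ v ∈ A '' D := by
  constructor
  · rintro ⟨y, hy, h⟩
    obtain ⟨x, hx, h1, -⟩ := exists_of_om_eq p hA hcl hΘ hy h.symm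
    exact ⟨x, hx, h1.symm⟩
  · rintro ⟨x, hx, rfl⟩
    exact ⟨_, p.mem j x hx, pasteMap_apply p hA hcl j hx⟩

lemma pasteMap_injOn (p : Pasting M D cls E r D₁ cls₁ E₁ r₁ ord ε c) (hA : Set.InjOn A D)
    (hcl : ∀ x ∈ D, clT (A x) = cls x) (hΘ : Function.Injective Θ) :
    Set.InjOn (pasteMap ε D cls clT c Θ A) D₁ := by
  intro y hy y' hy' h
  obtain ⟨j, x, hx, rfl⟩ := p.exists_eq y hy
  rw [pasteMap_apply p hA hcl j hx] at h
  obtain ⟨x', hx', h1, h2⟩ := exists_of_om_eq p hA hcl hΘ hy' h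
  rw [h2, hA hx hx' h1]

lemma pasteMap_strong (p : Pasting M D cls E r D₁ cls₁ E₁ r₁ ord ε c) {ET : Set (ι → T)}
    {rT : T → ℕ} (hT : ∀ t ∈ ET, ∀ i, clT (t i) = i) (hG : GoodMap M D cls E r clT ET rT A)
    (hΘ : Function.Injective Θ) {H : Set (Option T → Y)} :
    ∀ t ∈ Ed (om clT c '' H) ET, ∀ x ∈ D₁, ∀ y ∈ D₁, x ≠ y →
      pasteMap ε D cls clT c Θ A x ∈ Set.range t → pasteMap ε D cls clT c Θ A y ∈ Set.range t →
      ∃ f ∈ E₁, t = pasteMap ε D cls clT c Θ A ∘ f := by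
  rintro _ ⟨_, ⟨g, hg, rfl⟩, s, hs, rfl⟩ y hy y' hy' hne ⟨i, hi⟩ ⟨i', hi'⟩
  obtain ⟨j, rfl⟩ : ∃ j, g = Θ ∘ kap ε D cls c A j := by
    have aux : ∀ y ∈ D₁, ∀ i, om clT c g (s i) = pasteMap ε D cls clT c Θ A y → i ≠ c →
        ∃ j, g = Θ ∘ kap ε D cls c A j := by
      intro y hy i hi hic
      obtain ⟨j, x, hx, rfl⟩ := p.exists_eq y hy
      rcases om_cases (clT := clT) (c := c) g (s i) with ⟨h1, -⟩ | ⟨-, h1⟩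
      · rw [hT s hs] at h1
        exact absurd h1 hic
      · rw [h1] at hi
        exact ⟨j, (pasteMap_eq_inr p hG.injOn hG.cl hx hi.symm).1.symm⟩
    by_cases hic : i = c
    · refine aux y' hy' i' hi' fun hic' => hne ?_
      apply pasteMap_injOn p hG.injOn hG.cl hΘ hy hy'
      rw [← hi, ← hi', hic, hic']
    · exact aux y hy i hi hic
  obtain ⟨x, hx, h1, rfl⟩ := exists_of_om_eq p hG.injOn hG.cl hΘ hy hi
  obtain ⟨x', hx', h2, rfl⟩ := exists_of_om_eq p hG.injOn hG.cl hΘ hy' hi'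
  obtain ⟨f, hf, rfl⟩ := hG.strong s hs x hx x' hx' (fun e => hne (by rw [e])) ⟨i, h1⟩ ⟨i', h2⟩
  refine ⟨ε j ∘ f, p.edge j f hf, ?_⟩
  funext a
  exact (pasteMap_apply p hG.injOn hG.cl j (p.edge_mem f hf a)).symm

lemma pasteMap_conv {m : ℕ} (p : Pasting (2 * m) D cls E r D₁ cls₁ E₁ r₁ ord ε c)
    {ET : Set (ι → T)} {rT : T → ℕ} (hT : ∀ t ∈ ET, ∀ i, clT (t i) = i)
    (hear : PathEar (eb ET) (2 * m)) {𝒜 : Set (V → T)} (hA : A ∈ 𝒜)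
    (h𝒜 : ∀ A ∈ 𝒜, GoodMap (2 * m) D cls E r clT ET rT A)
    {Φ : Set ((V → T) × (V₁ ⊕ (J × Option T)) → Y)} (hΦ : Sys (kapEdges ε D cls c 𝒜) Φ)
    (hΦm : PathEar (eb Φ) m) (hΘ : Θ ∈ Φ) :
    Conv (2 * m) (Ed (om clT c '' Ed Φ (kapEdges ε D cls c 𝒜)) ET)
      (pasteMap ε D cls clT c Θ A '' D₁) := by
  have hG := h𝒜 A hA
  have hi := hΦ.inj Θ hΘ
  refine conv_om (Z := Set.range Θ) (Z₀ := Θ '' {u | u.1 = A})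
    (E₀ := {h | ∃ j, h = Θ ∘ kap ε D cls c A j}) hT ?_ (hΦ.lin (p.lin_kapEdges 𝒜)) hear hG.conv
    ?_ ?_ ?_ ?_ ?_ ?_ ?_ ?_
  · rintro _ ⟨φ, hφ, _, ⟨A', hA', j, rfl⟩, rfl⟩
    exact (hΦ.inj φ hφ).comp (kap_injective p.injOn j)
  · rintro _ ⟨u, -, rfl⟩
    exact ⟨u, rfl⟩
  · intro n y hn hs h0 hy
    exact hΦ.ear_or_mem_range hΦm (p.pathEar_kapEdges (fun A hA => (h𝒜 A hA).injOn) (by omega))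
      hΘ hn hs h0 hy
  · rintro h hh y y' hne ⟨u, hu, rfl⟩ hy' hyr hyr'
    obtain ⟨_, ⟨A', hA', j, rfl⟩, rfl⟩ := hΦ.strong Θ hΘ h hh _ _ hne ⟨u, rfl⟩ hy' hyr hyr'
    obtain ⟨l, hl⟩ := hyr
    obtain rfl := hi hl
    obtain rfl : A' = A := hu
    exact ⟨j, rfl⟩
  · rintro _ ⟨j, rfl⟩ _ ⟨l, rfl⟩
    exact ⟨_, rfl, rfl⟩
  · rintro _ ⟨j, rfl⟩ _ ⟨j', rfl⟩ hne _ ⟨l, rfl⟩ ⟨l', hl'⟩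
    have h1 := hi hl'
    rcases kap_cases (ε := ε) (D := D) (cls := cls) (c := c) (A := A) j l with
      ⟨x, hx, hx1, -, h3⟩ | ⟨-, h3⟩
    · refine ⟨_, p.mem j x hx, ?_⟩
      rw [pasteMap_inl p j hx hx1, Function.comp_apply, h3]
    · rw [h3] at h1
      exact absurd (by rw [(kap_eq_inr h1).1]) hne
  · rintro y ⟨y₁, hy₁, h⟩
    obtain ⟨j, x, hx, rfl⟩ := p.exists_eq y₁ hy₁
    exact ⟨_, rfl, (pasteMap_eq_inl p hG.injOn hG.cl hx h).2.symm⟩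
  · rintro g v ⟨y₁, hy₁, h⟩
    obtain ⟨j, x, hx, rfl⟩ := p.exists_eq y₁ hy₁
    exact ⟨j, (pasteMap_eq_inr p hG.injOn hG.cl hx h).1.symm⟩
  · rintro _ ⟨j, rfl⟩ v
    exact om_mem_image_iff p hG.injOn hG.cl hi j v

theorem Good.paste [Finite ι] [Finite V] [Finite V₁] [Finite J] {m : ℕ} (hR : Ram m)
    (p : Pasting (2 * m) D cls E r D₁ cls₁ E₁ r₁ ord ε c) (hg : Good (2 * m) D cls E r) :
    Good (2 * m) D₁ cls₁ E₁ r₁ := by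
  intro C _ _
  obtain ⟨T, hTfin, clT, ET, rT, 𝒜, hT, hlin, hear, h𝒜, hram⟩ := hg C
  obtain ⟨o, ρ, ho, hρ, hρ₁, hρ₂⟩ := p.exists_rank rT (𝒜 := 𝒜) (fun A hA => (h𝒜 A hA).mono)
  obtain ⟨Y, hY, Φ, σ, hsys, hΦ, hσ, hΦram⟩ := hR (Option T) _ ((ι → T) → C) o
    (kapEdges ε D cls c 𝒜) ρ ho (p.lin_kapEdges 𝒜) hρ
  have hHlin := hsys.lin (p.lin_kapEdges 𝒜)
  have hHinj : ∀ h ∈ Ed Φ (kapEdges ε D cls c 𝒜), Function.Injective h := by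
    rintro _ ⟨φ, hφ, _, ⟨A', hA', j, rfl⟩, rfl⟩
    exact (hsys.inj φ hφ).comp (kap_injective p.injOn j)
  obtain ⟨ρ₁, -, hkey⟩ := exists_injective_rank fun q : Y ⊕ ((Option T → Y) × T) =>
    (Sum.elim (fun y => toLex (σ y, 0)) (fun q => toLex (σ (q.1 none), rT q.2)) q : ℕ ×ₗ ℕ)
  have hcl₁ : ∀ h v, Sum.elim (fun _ => c) (fun q => clT q.2) (om clT c h v : Y ⊕ _) = clT v := by
    intro h v
    rcases om_cases (clT := clT) (c := c) h v with ⟨h1, h2⟩ | ⟨-, h2⟩ <;> rw [h2]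
    · exact h1.symm
    · rfl
  refine ⟨Y ⊕ ((Option T → Y) × T), inferInstance, Sum.elim (fun _ => c) (fun q => clT q.2),
    Ed (om clT c '' Ed Φ (kapEdges ε D cls c 𝒜)) ET, ρ₁,
    {Q | ∃ Θ ∈ Φ, ∃ A ∈ 𝒜, Q = pasteMap ε D cls clT c Θ A}, ?_, (sys_om hHinj hHlin).lin hlin,
    pathEar_om hT hHinj hHlin (hsys.pathEar_Ed hΦ (p.pathEar_kapEdges
      (fun A hA => (h𝒜 A hA).injOn) (by omega))) hear, ?_, ?_⟩
  · rintro _ ⟨_, ⟨h, hh, rfl⟩, t, ht, rfl⟩ i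
    exact (hcl₁ h (t i)).trans (hT t ht i)
  · rintro _ ⟨Θ, hΘ, A, hA, rfl⟩
    have hG := h𝒜 A hA
    have happ := fun j {x} => pasteMap_apply (Θ := Θ) p hG.injOn hG.cl j (x := x)
    refine ⟨pasteMap_injOn p hG.injOn hG.cl (hsys.inj Θ hΘ), ?_, ?_, ?_,
      pasteMap_strong p hT hG (hsys.inj Θ hΘ), pasteMap_conv p hT hear hA h𝒜 hsys hΦ hΘ⟩
    · intro y hy
      obtain ⟨j, x, hx, rfl⟩ := p.exists_eq y hy
      rw [happ j hx, hcl₁, hG.cl x hx, p.cls_eq j x hx]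
    · intro y hy y' hy' hc hlt
      obtain ⟨j, x, hx, rfl⟩ := p.exists_eq y hy
      obtain ⟨j', x', hx', rfl⟩ := p.exists_eq y' hy'
      rw [p.cls_eq j x hx, p.cls_eq j' x' hx'] at hc
      apply hkey
      by_cases hxc : cls x = c
      · rw [pasteMap_inl p j hx hxc, pasteMap_inl p j' hx' (hc.symm.trans hxc)]
        simp only [Sum.elim_inl]
        rw [Prod.Lex.toLex_lt_toLex]
        exact Or.inl (hσ Θ hΘ _ _ (hρ₁ A _ _ hlt))
      · rw [happ j hx, happ j' hx']
        unfold om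
        rw [if_neg (by rwa [hG.cl x hx]), if_neg (by rwa [hG.cl x' hx', ← hc])]
        simp only [Sum.elim_inr, Function.comp_apply, kap_none]
        rw [Prod.Lex.toLex_lt_toLex]
        rcases Nat.lt_trichotomy (ord j) (ord j') with h1 | h1 | h1
        · exact Or.inl (hσ Θ hΘ _ _ (hρ₂ A j j' h1))
        · obtain rfl := p.ord_inj h1
          refine Or.inr ⟨rfl, hG.mono x hx x' hx' hc ?_⟩
          rcases Nat.lt_trichotomy (r x) (r x') with h2 | h2 | h2
          · exact h2
          · rw [p.rank_inj h2] at hlt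
            exact absurd hlt (lt_irrefl _)
          · exact absurd hlt (p.mono j x' hx' x hx hc.symm h2).not_gt
        · exact absurd hlt (p.ord_mono j' j x' hx' x hx (fun e => hxc (hc.trans e)) hc.symm
            h1).not_gt
    · intro f hf
      obtain ⟨j, f₀, hf₀, rfl⟩ := p.exists_edge f hf
      refine ⟨_, ⟨_, ⟨Θ, hΘ, _, ⟨A, hA, j, rfl⟩, rfl⟩, rfl⟩, A ∘ f₀, hG.edge f₀ hf₀, ?_⟩
      funext a
      exact happ j (p.edge_mem f₀ hf₀ a)
  · intro col
    obtain ⟨Θ, hΘ, k, hk⟩ := hΦram fun h t => col (om clT c h ∘ t)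
    obtain ⟨A, hA, k', hk'⟩ := hram k
    have hG := h𝒜 A hA
    refine ⟨_, ⟨Θ, hΘ, A, hA, rfl⟩, k', fun f hf => ?_⟩
    obtain ⟨j, f₀, hf₀, rfl⟩ := p.exists_edge f hf
    rw [← hk' f₀ hf₀, ← hk _ ⟨A, hA, j, rfl⟩]
    congr 1
    funext a
    exact pasteMap_apply p hG.injOn hG.cl j (p.edge_mem f₀ hf₀ a)

end

/-! ### The initial picture and the Hales–Jewett case -/

section
variable {ι U W : Type} {F : Set (ι → U)} {𝒲 : Set (U → W)}

/-- The projection of the disjoint union of the copies in `𝒲`. -/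
def sumProj {U W : Type} (𝒲 : Set (U → W)) (p : ↥𝒲 × U) : W := p.1.1 p.2

/-- The disjoint copies. -/
def sumCopies {U W : Type} (𝒲 : Set (U → W)) : Set (U → ↥𝒲 × U) :=
  Set.range fun (B : ↥𝒲) u => (B, u)

lemma sys_sumCopies : Sys F (sumCopies 𝒲) where
  inj := by
    rintro _ ⟨B, rfl⟩ u v h
    exact congrArg Prod.snd h
  strong := by
    rintro _ ⟨B, rfl⟩ _ ⟨_, ⟨B', rfl⟩, t, ht, rfl⟩ x y - ⟨u, hu⟩ - ⟨i, hi⟩ -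
    obtain rfl : B = B' := congrArg Prod.fst (hu.trans hi.symm)
    exact ⟨t, ht, rfl⟩
  link := by
    rintro _ ⟨B, rfl⟩ _ ⟨B', rfl⟩ hne x y - ⟨u, hu⟩ - ⟨v, hv⟩ -
    obtain rfl : B = B' := congrArg Prod.fst (hu.trans hv.symm)
    exact absurd rfl hne

lemma fst_eq_of_Co2 {x y : ↥𝒲 × U} (h : Co2 (eb (sumCopies 𝒲)) x y) : x.1 = y.1 := by
  obtain ⟨_, ⟨_, ⟨B, rfl⟩, rfl⟩, ⟨u, hu⟩, ⟨v, hv⟩⟩ := h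
  rw [← hu, ← hv]

lemma mem_range_sumCopies (x : ↥𝒲 × U) (B : ↥𝒲) (h : B = x.1) :
    x ∈ Set.range fun u : U => (B, u) := ⟨x.2, by rw [h]⟩

lemma pathEar_sumCopies (M : ℕ) : PathEar (eb (sumCopies 𝒲)) M := by
  intro n x hn _ hs _
  have h1 := fst_eq_of_Co2 (hs 0 (by omega))
  have h2 := fst_eq_of_Co2 (hs 1 (by omega))
  exact ⟨0, hn, _, ⟨_, ⟨(x 0).1, rfl⟩, rfl⟩, mem_range_sumCopies _ _ rfl,
    mem_range_sumCopies _ _ h1, mem_range_sumCopies _ _ (h1.trans h2)⟩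

lemma conf_sumCopies : Conf (eb (sumCopies 𝒲)) := by
  rintro K ⟨x, hx⟩ hK
  exact ⟨_, ⟨_, ⟨x.1, rfl⟩, rfl⟩, fun y hy =>
    mem_range_sumCopies _ _ (fst_eq_of_Co2 (hK x hx y hy))⟩

lemma exists_strictMono_of_coloring (N : ℕ) (C : Type) [Finite C] [Nonempty C] :
    ∃ L, ∀ c : Fin L → C, ∃ (s : Fin N → Fin L) (k : C), StrictMono s ∧ ∀ i, c (s i) = k := by
  classical
  have := Fintype.ofFinite C
  refine ⟨Fintype.card C * N, fun c => ?_⟩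
  obtain ⟨k, hk⟩ := Fintype.exists_le_card_fiber_of_mul_le_card (f := c) (n := N) (by simp)
  refine ⟨Finset.orderEmbOfCardLe _ hk, k, OrderEmbedding.strictMono _, fun i => ?_⟩
  have := Finset.orderEmbOfCardLe_mem _ hk i
  simpa using this

/-- Over an edge of a strongly induced template, the initial picture is a matching. -/
lemma good_sumCopies [Nonempty ι] [Finite ι] (hF : ∀ f ∈ F, Function.Injective f)
    (hW : Sys F 𝒲) {N : ℕ} (q : ↥𝒲 ≃ Fin N)
    {r : ↥𝒲 × U → ℕ} (hr : ∀ x y, q x.1 < q y.1 → r x < r y) (M : ℕ) {e : ι → W}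
    (he : e ∈ Ed 𝒲 F) :
    Good M (partD (sumProj 𝒲) Set.univ e) (fib (sumProj 𝒲) e)
      (partE (sumProj 𝒲) (sumCopies 𝒲) F e) r := by
  have heinj : Function.Injective e := by
    obtain ⟨B, hB, t, ht, rfl⟩ := he
    exact (hW.inj B hB).comp (hF t ht)
  intro C _ _
  obtain ⟨L, hL⟩ := exists_strictMono_of_coloring N C
  have hco : ∀ x y, Co2 (eb (Set.range fun (l : Fin L) (i : ι) => (l, i))) x y → x.1 = y.1 := by
    rintro x y ⟨_, ⟨_, ⟨l, rfl⟩, rfl⟩, ⟨i, hi⟩, ⟨j, hj⟩⟩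
    rw [← hi, ← hj]
  have hear : ∀ (n : ℕ) (x : ℕ → Fin L × ι), 2 ≤ n →
      (∀ i < n, Co2 (eb (Set.range fun (l : Fin L) (i : ι) => (l, i))) (x i) (x (i + 1))) →
      ∃ i, i + 2 ≤ n ∧ Co3 (eb (Set.range fun (l : Fin L) (i : ι) => (l, i)))
        (x i) (x (i + 1)) (x (i + 2)) := by
    intro n x hn hs
    have h1 := hco _ _ (hs 0 (by omega))
    have h2 := hco _ _ (hs 1 (by omega))
    exact ⟨0, hn, _, ⟨_, ⟨(x 0).1, rfl⟩, rfl⟩, ⟨(x 0).2, rfl⟩,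
      ⟨(x 1).2, by rw [h1]⟩, ⟨(x 2).2, by rw [h1, h2]⟩⟩
  refine ⟨Fin L × ι, inferInstance, Prod.snd, Set.range fun l i => (l, i), fun p => p.1.1,
    {A | ∃ s : Fin N → Fin L, StrictMono s ∧
      A = fun x => (s (q x.1), fib (sumProj 𝒲) e x)}, ?_, ?_, ?_, ?_, ?_⟩
  · rintro _ ⟨l, rfl⟩ i
    rfl
  · rintro _ ⟨l, rfl⟩ _ ⟨l', rfl⟩ x y - ⟨i, hi⟩ - ⟨j, hj⟩ -
    obtain rfl : l = l' := congrArg Prod.fst (hi.trans hj.symm)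
    rfl
  · exact fun n x hn _ hs _ => hear n x hn hs
  · rintro _ ⟨s, hs, rfl⟩
    have hfib : ∀ x ∈ partD (sumProj 𝒲) Set.univ e, ∀ y ∈ partD (sumProj 𝒲) Set.univ e,
        x.1 = y.1 → fib (sumProj 𝒲) e x = fib (sumProj 𝒲) e y → x = y := by
      rintro ⟨B, u⟩ hx ⟨B', v⟩ hy h1 h2
      obtain rfl : B = B' := h1
      have h3 : B.1 u = B.1 v := by
        have h4 := apply_fib hx.2
        rw [h2, apply_fib hy.2] at h4
        exact h4.symm
      rw [hW.inj _ B.2 h3]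
    refine ⟨?_, fun _ _ => rfl, ?_, ?_, ?_, ?_⟩
    · intro x hx y hy h
      exact hfib x hx y hy (q.injective (hs.injective (congrArg Prod.fst h)))
        (congrArg Prod.snd h)
    · intro x hx y hy hc hlt
      have h1 : q x.1 < q y.1 := by
        rcases lt_trichotomy (q x.1) (q y.1) with h1 | h1 | h1
        · exact h1
        · rw [hfib x hx y hy (q.injective h1) hc] at hlt
          exact absurd hlt (lt_irrefl _)
        · exact absurd hlt (hr _ _ h1).not_gt
      exact hs h1
    · rintro _ ⟨⟨_, ⟨B, rfl⟩, t, ht, rfl⟩, hf⟩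
      refine ⟨s (q B), ?_⟩
      funext i
      exact Prod.ext rfl (fib_eq heinj (congrFun hf i)).symm
    · rintro _ ⟨l, rfl⟩ x hx y hy hne ⟨i, hi⟩ ⟨j, hj⟩
      have h1 : s (q x.1) = l := (congrArg Prod.fst hi).symm
      have h2 : s (q y.1) = l := (congrArg Prod.fst hj).symm
      have h3 : x.1 = y.1 := q.injective (hs.injective (h1.trans h2.symm))
      obtain ⟨⟨B, hB⟩, u⟩ := x
      obtain ⟨B', v⟩ := y
      obtain rfl : ⟨B, hB⟩ = B' := h3
      obtain ⟨t, ht, hte⟩ := hW.strong B hB e he (B u) (B v)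
        (fun h => hne (by rw [hW.inj B hB h])) ⟨u, rfl⟩ ⟨v, rfl⟩ hx.2 hy.2
      refine ⟨fun i => (⟨B, hB⟩, t i), ⟨⟨_, ⟨⟨B, hB⟩, rfl⟩, t, ht, rfl⟩, hte.symm⟩, ?_⟩
      funext i
      exact Prod.ext h1.symm (fib_eq heinj (congrFun hte.symm i)).symm
    · intro n x _ hs' h0 hn'
      rcases Nat.lt_or_ge n 2 with hn | hn
      · refine Or.inr fun i hi => ?_
        rcases Nat.eq_zero_or_pos i with rfl | hi0
        · exact h0
        · rwa [show i = n by omega]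
      · exact Or.inl (hear n x hn hs')
  · intro c
    obtain ⟨s, k, hs, hk⟩ := hL fun l => c fun i => (l, i)
    refine ⟨_, ⟨s, hs, rfl⟩, k, ?_⟩
    rintro _ ⟨⟨_, ⟨B, rfl⟩, t, ht, rfl⟩, hf⟩
    rw [← hk (q B)]
    congr 1
    funext i
    exact Prod.ext rfl (fib_eq heinj (congrFun hf i))

end

theorem good_two {ι V : Type} [Finite V] {D : Set V} {cls : V → ι} {E : Set (ι → V)} {r : V → ℕ}
    (hD : ∀ f ∈ E, ∀ i, f i ∈ D) (hcls : ∀ f ∈ E, ∀ i, cls (f i) = i) (hlin : Lin E)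
    [Finite ι] : Good 2 D cls E r := by
  intro C _ _
  have hear : ∀ {V : Type} (B : Set (Set V)), PathEar B 2 := fun B n x h1 h2 => by omega
  have hconv : ∀ {T : Type} (ET : Set (ι → T)) (S : Set T), Conv 2 ET S := by
    intro T ET S n x hn _ h0 _
    refine Or.inr fun i hi => ?_
    rwa [show i = 0 by omega]
  rcases E.eq_empty_or_nonempty with rfl | hE
  · refine ⟨V, inferInstance, cls, ∅, r, {id}, by simp, by simp [Lin], hear _, ?_, ?_⟩
    · rintro _ rfl
      exact ⟨Function.injective_id.injOn, fun _ _ => rfl, fun _ _ _ _ _ h => h, by simp, by simp,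
        hconv _ _⟩
    · exact fun c => ⟨id, rfl, Classical.arbitrary C, by simp⟩
  have : Nonempty ↥E := hE.to_subtype
  obtain ⟨η, hη, hl⟩ := Combinatorics.Line.exists_mono_in_high_dimension ↥E C
  obtain ⟨s₀⟩ : Nonempty η := by
    obtain ⟨l, -⟩ := hl fun _ => Classical.arbitrary C
    exact ⟨l.proper.choose⟩
  have hsep : ∀ f ∈ E, ∀ g ∈ E, ∀ i j, i ≠ j → f i = g i → f j = g j → f = g := by
    intro f hf g hg i j hij hi hj
    refine hlin f hf g hg (f i) (f j) (fun h => hij ?_) ⟨i, rfl⟩ ⟨j, rfl⟩ ⟨i, hi.symm⟩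
      ⟨j, hj.symm⟩
    rw [← hcls f hf i, h, hcls f hf j]
  refine ⟨η → V, inferInstance, fun z => cls (z s₀),
    Set.range fun (h : η → ↥E) i s => (h s).1 i, fun z => ∑ s, r (z s),
    Set.range fun (l : Combinatorics.Line ↥E η) x s => (l.idxFun s).elim x fun e => e.1 (cls x),
    ?_, ?_, hear _, ?_, ?_⟩
  · rintro _ ⟨h, rfl⟩ i
    exact hcls _ (h s₀).2 i
  · rintro _ ⟨h, rfl⟩ _ ⟨h', rfl⟩ _ _ hxy ⟨i, rfl⟩ ⟨j, rfl⟩ ⟨i', hi⟩ ⟨j', hj⟩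
    have hi1 : ∀ s, (h' s).1 i' = (h s).1 i := congrFun hi
    have hj1 : ∀ s, (h' s).1 j' = (h s).1 j := congrFun hj
    have e1 := hcls _ (h s₀).2 i
    have e2 := hcls _ (h s₀).2 j
    rw [← hi1, hcls _ (h' s₀).2] at e1
    rw [← hj1, hcls _ (h' s₀).2] at e2
    subst e1 e2
    have hij : i' ≠ j' := fun e => hxy (by rw [e])
    funext a s
    have := hsep _ (h s).2 _ (h' s).2 i' j' hij (hi1 s).symm (hj1 s).symm
    exact congrFun this a
  · rintro _ ⟨l, rfl⟩
    obtain ⟨s₁, hs₁⟩ := l.proper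
    have hcl : ∀ x ∈ D, ∀ s, cls ((l.idxFun s).elim x fun e => e.1 (cls x)) = cls x := by
      intro x _ s
      rcases l.idxFun s with - | e
      · rfl
      · exact hcls _ e.2 _
    refine ⟨?_, fun x hx => hcl x hx s₀, ?_, ?_, ?_, hconv _ _⟩
    · intro x _ y _ h
      have := congrFun h s₁
      simpa [hs₁] using this
    · intro x hx y hy hc hlt
      refine Finset.sum_lt_sum (fun s _ => ?_) ⟨s₁, Finset.mem_univ _, ?_⟩
      · beta_reduce
        rw [hc]
        rcases l.idxFun s with - | e
        · exact hlt.le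
        · exact le_rfl
      · simpa [hs₁] using hlt
    · intro f hf
      refine ⟨fun s => (l.idxFun s).elim ⟨f, hf⟩ id, ?_⟩
      funext i s
      simp only [Function.comp_apply, hcls f hf]
      rcases l.idxFun s with - | e <;> rfl
    · rintro _ ⟨h, rfl⟩ x hx y hy hxy ⟨i, hi⟩ ⟨j, hj⟩
      have hi1 : ∀ s, (h s).1 i = (l.idxFun s).elim x fun e => e.1 (cls x) := congrFun hi
      have hj1 : ∀ s, (h s).1 j = (l.idxFun s).elim y fun e => e.1 (cls y) := congrFun hj
      have hi2 : cls x = i := by rw [← hcl x hx s₁, ← hi1, hcls _ (h s₁).2]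
      have hj2 : cls y = j := by rw [← hcl y hy s₁, ← hj1, hcls _ (h s₁).2]
      have hix := hi1 s₁
      have hjx := hj1 s₁
      rw [hs₁] at hix hjx
      have hij : i ≠ j := by
        rintro rfl
        exact hxy (hix.symm.trans hjx)
      refine ⟨(h s₁).1, (h s₁).2, ?_⟩
      funext a s
      have h3 := hi1 s
      have h4 := hj1 s
      simp only [Function.comp_apply, hcls _ (h s₁).2]
      rcases hls : l.idxFun s with - | e
      · rw [hls] at h3 h4
        rw [hsep _ (h s).2 _ (h s₁).2 i j hij (h3.trans hix.symm) (h4.trans hjx.symm)]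
        rfl
      · rw [hls] at h3 h4
        rw [hi2] at h3
        rw [hj2] at h4
        rw [hsep _ (h s).2 _ e.2 i j hij h3 h4]
        rfl
  · intro c
    obtain ⟨l, k, hk⟩ := hl fun h => c fun i s => (h s).1 i
    refine ⟨_, ⟨l, rfl⟩, k, fun f hf => ?_⟩
    rw [← hk ⟨f, hf⟩]
    congr 1
    funext i s
    simp only [Function.comp_apply, hcls f hf]
    rw [Combinatorics.Line.apply_def]
    beta_reduce
    rcases l.idxFun s with - | e <;> rfl

/-! ### Ramsey's theorem for ordered sets -/

lemma exists_homogeneous_finset (C : Type) [Finite C] [Nonempty C] (k : ℕ) :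
    ∀ m : ℕ, ∃ N : ℕ, ∀ S : Finset ℕ, N ≤ S.card → ∀ c : Finset ℕ → C,
      ∃ T ⊆ S, T.card = m ∧ ∃ a, ∀ K ⊆ T, K.card = k → c K = a := by
  classical
  have := Fintype.ofFinite C
  induction k with
  | zero =>
    intro m
    refine ⟨m, fun S hS c => ?_⟩
    obtain ⟨T, hT, hm⟩ := Finset.exists_subset_card_eq hS
    refine ⟨T, hT, hm, c ∅, fun K _ hK => ?_⟩
    rw [Finset.card_eq_zero.mp hK]
  | succ k ih =>
    have pre : ∀ p : ℕ, ∃ N : ℕ, ∀ S : Finset ℕ, N ≤ S.card → ∀ c : Finset ℕ → C,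
        ∃ T ⊆ S, T.card = p ∧ ∃ g : ℕ → C, ∀ K ⊆ T, K.card = k → ∀ x ∈ T, (∀ y ∈ K, x < y) →
          c (insert x K) = g x := by
      intro p
      induction p with
      | zero =>
        exact ⟨0, fun S _ c => ⟨∅, by simp, rfl, fun _ => Classical.arbitrary C, by simp⟩⟩
      | succ p ihp =>
        obtain ⟨N, hN⟩ := ihp
        obtain ⟨N', hN'⟩ := ih N
        refine ⟨N' + 1, fun S hS c => ?_⟩
        have hne : S.Nonempty := Finset.card_pos.mp (by omega)
        set x := S.min' hne with hx
        have hxS : x ∈ S := S.min'_mem hne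
        obtain ⟨T, hT, hTN, a, ha⟩ := hN' (S.erase x)
          (by rw [Finset.card_erase_of_mem hxS]; omega) fun K => c (insert x K)
        obtain ⟨R, hR, hRp, g, hg⟩ := hN T hTN.ge c
        have hlt : ∀ y ∈ R, x < y := fun y hy => by
          have h1 := hT (hR hy)
          exact lt_of_le_of_ne (S.min'_le y (Finset.mem_of_mem_erase h1))
            (Finset.ne_of_mem_erase h1).symm
        have hxR : x ∉ R := fun h => lt_irrefl _ (hlt x h)
        refine ⟨insert x R, ?_, by rw [Finset.card_insert_of_notMem hxR, hRp],
          Function.update g x a, ?_⟩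
        · intro y hy
          rcases Finset.mem_insert.mp hy with rfl | hy
          · exact hxS
          · exact Finset.mem_of_mem_erase (hT (hR hy))
        · intro K hK hKc z hz hzK
          have hKR : K ⊆ R := by
            intro y hy
            rcases Finset.mem_insert.mp (hK hy) with rfl | h
            · rcases Finset.mem_insert.mp hz with h1 | h1
              · exact absurd (hzK _ hy) (by simp [h1])
              · exact absurd (hzK _ hy) (hlt z h1).not_gt
            · exact h
          rcases Finset.mem_insert.mp hz with rfl | hz
          · rw [Function.update_self]
            exact ha K (hKR.trans hR) hKc
          · have hzx : z ≠ x := by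
              rintro rfl
              exact hxR hz
            rw [Function.update_of_ne hzx]
            exact hg K hKR hKc z hz hzK
    intro m
    obtain ⟨N, hN⟩ := pre (Fintype.card C * m)
    refine ⟨N, fun S hS c => ?_⟩
    obtain ⟨T, hT, hTc, g, hg⟩ := hN S hS c
    obtain ⟨a, -, ha⟩ := Finset.exists_le_card_fiber_of_mul_le_card_of_maps_to
      (s := T) (t := (Finset.univ : Finset C)) (f := g) (n := m) (fun _ _ => Finset.mem_univ _)
      Finset.univ_nonempty (by simp [hTc])
    obtain ⟨R, hR, hRm⟩ := Finset.exists_subset_card_eq ha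
    have hRT : R ⊆ T := hR.trans (Finset.filter_subset _ _)
    refine ⟨R, hRT.trans hT, hRm, a, fun K hK hKc => ?_⟩
    have hne : K.Nonempty := Finset.card_pos.mp (by omega)
    have hx := K.min'_mem hne
    rw [← Finset.insert_erase hx, hg (K.erase (K.min' hne))
      ((Finset.erase_subset _ _).trans (hK.trans hRT))
      (by rw [Finset.card_erase_of_mem hx, hKc]; rfl) _ (hRT (hK hx))]
    · exact (Finset.mem_filter.mp (hR (hK hx))).2
    · intro y hy
      exact lt_of_le_of_ne (K.min'_le y (Finset.mem_of_mem_erase hy))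
        (Finset.ne_of_mem_erase hy).symm

/-- The complete ordered template. -/
lemma exists_ordered_template {ι U : Type} (C : Type) [Finite ι] [Finite U] [Finite C]
    [Nonempty C] {o : ι → ℕ} (ho : Function.Injective o) (ρ : U → ℕ) :
    ∃ N : ℕ, ∀ c : (ι → Fin N) → C, ∃ A : U → Fin N, Function.Injective A ∧
      (∀ x y, ρ x < ρ y → A x < A y) ∧
      ∃ k, ∀ f : ι → U, (∀ i j, o i < o j → ρ (f i) < ρ (f j)) → c (A ∘ f) = k := by
  classical
  have := Fintype.ofFinite U
  have := Fintype.ofFinite ι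
  obtain ⟨ρ', hρ', hρ⟩ := exists_injective_rank ρ
  let _ : LinearOrder U := LinearOrder.lift' ρ' hρ'
  let _ : LinearOrder ι := LinearOrder.lift' o ho
  have hU : ∀ x y : U, ρ x < ρ y → x < y := hρ
  have hι : ∀ i j : ι, i < j → o i < o j := fun _ _ h => h
  have huniq : ∀ {N : ℕ} (g g' : ι → Fin N), StrictMono g → StrictMono g' →
      Finset.univ.image (fun i => (g i : ℕ)) = Finset.univ.image (fun i => (g' i : ℕ)) →
      g = g' := by
    intro N g g' hg hg' h
    rw [← StrictMono.range_inj hg hg']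
    apply (Set.image_injective.mpr (Fin.val_injective (n := N)))
    have h1 := congrArg (fun K : Finset ℕ => (K : Set ℕ)) h
    simpa [← Set.range_comp, Function.comp_def] using h1
  obtain ⟨N, hN⟩ := exists_homogeneous_finset C (Fintype.card ι) (Fintype.card U)
  refine ⟨N, fun c => ?_⟩
  obtain ⟨T, hT, hTc, a, ha⟩ := hN (Finset.range N) (by simp) fun K =>
    if h : ∃ f : ι → Fin N, StrictMono f ∧ Finset.univ.image (fun i => (f i : ℕ)) = K then
      c h.choose else Classical.arbitrary C
  let s : U → Fin (Fintype.card U) := (Fintype.orderIsoFinOfCardEq U rfl).symm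
  have hs : StrictMono s := OrderIso.strictMono _
  let A : U → Fin N := fun u =>
    ⟨T.orderEmbOfFin hTc (s u), Finset.mem_range.mp (hT (T.orderEmbOfFin_mem hTc _))⟩
  have hA : StrictMono A := fun x y h => (T.orderEmbOfFin hTc).strictMono (hs h)
  refine ⟨A, hA.injective, fun x y h => hA (hU x y h), a, fun f hf => ?_⟩
  have hAf : StrictMono (A ∘ f) := fun i j h => hA (hU _ _ (hf i j (hι i j h)))
  have hex : ∃ g : ι → Fin N, StrictMono g ∧ Finset.univ.image (fun i => (g i : ℕ)) =
      Finset.univ.image (fun i => ((A ∘ f) i : ℕ)) := ⟨_, hAf, rfl⟩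
  have h1 := ha (Finset.univ.image fun i => ((A ∘ f) i : ℕ))
    (by
      intro y hy
      obtain ⟨i, -, rfl⟩ := Finset.mem_image.mp hy
      exact T.orderEmbOfFin_mem hTc _)
    (Finset.card_image_of_injective _ (Fin.val_injective.comp hAf.injective))
  rw [dif_pos hex] at h1
  rwa [huniq _ _ hex.choose_spec.1 hAf hex.choose_spec.2] at h1

/-! ### The partite construction and its iteration -/

section
variable {ι U V W : Type} {C : Type} {M : ℕ} {F : Set (ι → U)}
    {𝒲 : Set (U → W)} {π : V → W} {Φ : Set (U → V)} {D : Set V} {r : V → ℕ}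

lemma exists_start_rank [Finite U] [Finite W] (𝒲 : Set (U → W)) :
    ∃ (N : ℕ) (q : ↥𝒲 ≃ Fin N) (r : ↥𝒲 × U → ℕ), Function.Injective r ∧
      ∀ x y, q x.1 < q y.1 → r x < r y := by
  have := Fintype.ofFinite ↥𝒲
  obtain ⟨r, hr, hkey⟩ := exists_injective_rank fun x : ↥𝒲 × U => Fintype.equivFin ↥𝒲 x.1
  exact ⟨_, Fintype.equivFin ↥𝒲, r, hr, hkey⟩

lemma rs_sumCopies [Nonempty C] : RS C F 𝒲 (sumProj 𝒲) (sumCopies 𝒲) ∅ := fun _ =>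
  ⟨fun _ => Classical.arbitrary C, fun B hB => ⟨_, ⟨⟨B, hB⟩, rfl⟩, rfl, fun _ _ h => h.elim⟩⟩

lemma Pic.ramsey [Nonempty ι] (P : Pic C M F 𝒲 (Ed 𝒲 F) π Φ D r)
    (hram : ∀ κ : (ι → W) → C, ∃ B ∈ 𝒲, ∃ k, ∀ f ∈ F, κ (B ∘ f) = k) (c : (ι → V) → C) :
    ∃ φ ∈ Φ, ∃ k, ∀ f ∈ F, c (φ ∘ f) = k := by
  obtain ⟨κ, hκ⟩ := P.rs c
  obtain ⟨B, hB, k, hk⟩ := hram κ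
  obtain ⟨φ, hφ, -, h⟩ := hκ B hB
  exact ⟨φ, hφ, k, fun f hf => (h f hf ⟨B, hB, f, hf, rfl⟩).trans (hk f hf)⟩

lemma edge_injective (hF : ∀ f ∈ F, Function.Injective f) (hW : ∀ B ∈ 𝒲, Function.Injective B)
    {e : ι → W} (he : e ∈ Ed 𝒲 F) : Function.Injective e := by
  obtain ⟨B, hB, t, ht, rfl⟩ := he
  exact (hW B hB).comp (hF t ht)

lemma good_two_of_sys [Finite ι] [Nonempty ι] [Finite V] (hF : Lin F) (hΦ : Sys F Φ)
    (hmem : ∀ φ ∈ Φ, ∀ u, φ u ∈ D) {e : ι → W} (he : Function.Injective e) :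
    Good 2 (partD π D e) (fib π e) (partE π Φ F e) r := by
  refine good_two ?_ (fun f hf i => fib_eq he (congrFun hf.2 i))
    (fun f hf g hg => hΦ.lin hF f hf.1 g hg.1)
  rintro f ⟨⟨φ, hφ, t, ht, rfl⟩, hfe⟩ i
  exact ⟨hmem φ hφ _, i, (congrFun hfe i).symm⟩

/-- The partite construction without girth. -/
theorem exists_full_pic_two [Finite ι] [Nonempty ι] [Finite U] [Finite W] [Finite C] [Nonempty C]
    (hF : Lin F) (hFinj : ∀ f ∈ F, Function.Injective f)
    (hW : ∀ B ∈ 𝒲, Function.Injective B) :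
    ∃ (V : Type) (_ : Finite V) (π : V → W) (Φ : Set (U → V)) (D : Set V) (r : V → ℕ),
      Pic C 2 F 𝒲 (Ed 𝒲 F) π Φ D r := by
  refine Set.Finite.induction_on_subset (motive := fun 𝒰 _ => ∃ (V : Type) (_ : Finite V)
    (π : V → W) (Φ : Set (U → V)) (D : Set V) (r : V → ℕ), Pic C 2 F 𝒲 𝒰 π Φ D r)
    (Ed 𝒲 F) (Set.toFinite _) ?_ ?_
  · obtain ⟨N, q, r, hr, -⟩ := exists_start_rank 𝒲
    refine ⟨_, inferInstance, sumProj 𝒲, sumCopies 𝒲, Set.univ, r, sys_sumCopies, ?_,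
      fun _ _ _ => trivial, hr, rs_sumCopies, fun e he _ => ?_⟩
    · rintro _ ⟨B, rfl⟩
      exact B.2
    · exact good_two_of_sys hF sys_sumCopies (fun _ _ _ => Set.mem_univ _) (edge_injective hFinj hW he)
  · rintro e 𝒰 he - heU ⟨V, _, π, Φ, D, r, P⟩
    obtain ⟨T, _, G, _, X, _, clT, ET, τ, A, ord, r', ham, hrs, -, hr', -, -⟩ :=
      P.exists_amalg hF (by omega) hFinj hW he heU
    exact ⟨_, inferInstance, _, _, _, r', ham.sys', ham.hproj', ham.mem', hr', hrs,
      fun e' he' _ => good_two_of_sys hF ham.sys' ham.mem' (edge_injective hFinj hW he')⟩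

/-- The partite construction over a strongly induced template, which doubles the girth. -/
theorem exists_full_pic {m : ℕ} (hR : Ram m) (hm : 2 ≤ m) [Finite ι] [Nonempty ι] [Finite U]
    [Finite W] [Finite C] [Nonempty C] (hF : Lin F) (hFinj : ∀ f ∈ F, Function.Injective f)
    (hW : Sys F 𝒲) :
    ∃ (V : Type) (_ : Finite V) (π : V → W) (Φ : Set (U → V)) (D : Set V) (r : V → ℕ),
      Pic C (2 * m) F 𝒲 (Ed 𝒲 F) π Φ D r ∧ PathEar (eb Φ) (2 * m) ∧ Conf (eb Φ) := by
  refine Set.Finite.induction_on_subset (motive := fun 𝒰 _ => ∃ (V : Type) (_ : Finite V)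
    (π : V → W) (Φ : Set (U → V)) (D : Set V) (r : V → ℕ), Pic C (2 * m) F 𝒲 𝒰 π Φ D r ∧
      PathEar (eb Φ) (2 * m) ∧ Conf (eb Φ)) (Ed 𝒲 F) (Set.toFinite _) ?_ ?_
  · obtain ⟨N, q, r, hr, hq⟩ := exists_start_rank 𝒲
    refine ⟨_, inferInstance, sumProj 𝒲, sumCopies 𝒲, Set.univ, r, ⟨sys_sumCopies, ?_,
      fun _ _ _ => trivial, hr, rs_sumCopies, fun e he _ => ?_⟩, pathEar_sumCopies _,
      conf_sumCopies⟩
    · rintro _ ⟨B, rfl⟩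
      exact B.2
    · exact good_sumCopies hFinj hW q hq _ he
  · rintro e 𝒰 he - heU ⟨V, _, π, Φ, D, r, P, hear, hconf⟩
    obtain ⟨T, _, G, _, X, _, clT, ET, τ, A, ord, r', ham, hrs, ho, hr', hmono, hord⟩ :=
      P.exists_amalg hF (by omega) hFinj hW.inj he heU
    have hear' := ham.pathEar hW he hear
    refine ⟨_, inferInstance, _, _, _, r', ⟨ham.sys', ham.hproj', ham.mem', hr', hrs,
      fun e' he' heU' => ?_⟩, hear', ham.conf hW he (by omega) hear' hconf⟩
    obtain ⟨hne, hU⟩ : e' ≠ e ∧ e' ∉ 𝒰 := by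
      simpa [Set.mem_insert_iff, not_or] using heU'
    obtain ⟨c, hp⟩ := ham.exists_pasting (hW.lin hF) he he' hne (edge_injective hFinj hW.inj he')
      P.rank_inj ho hmono hord
    exact Good.paste hR hp (P.good e' he' hU)

end

/-- The property `Ram m`, where moreover every clique is contained in a copy. -/
def RamConf (m : ℕ) : Prop :=
  ∀ (ι U C : Type) [Finite ι] [Nonempty ι] [Finite U] [Finite C] [Nonempty C] (o : ι → ℕ)
    (F : Set (ι → U)) (ρ : U → ℕ), Function.Injective o → Lin F →
    (∀ f ∈ F, ∀ i j, o i < o j → ρ (f i) < ρ (f j)) →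
    ∃ (V : Type) (_ : Finite V) (Φ : Set (U → V)) (σ : V → ℕ), Sys F Φ ∧ PathEar (eb Φ) m ∧
      Conf (eb Φ) ∧ (∀ φ ∈ Φ, ∀ x y, ρ x < ρ y → σ (φ x) < σ (φ y)) ∧
      ∀ c : (ι → V) → C, ∃ φ ∈ Φ, ∃ k, ∀ f ∈ F, c (φ ∘ f) = k

lemma RamConf.ram {m : ℕ} (h : RamConf m) : Ram m := by
  intro ι U C _ _ _ _ _ o F ρ ho hF hρ
  obtain ⟨V, hV, Φ, σ, h1, h2, -, h3⟩ := h ι U C o F ρ ho hF hρ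
  exact ⟨V, hV, Φ, σ, h1, h2, h3⟩

lemma RamConf.mono {m m' : ℕ} (h : RamConf m) (hm : m' ≤ m) : RamConf m' := by
  intro ι U C _ _ _ _ _ o F ρ ho hF hρ
  obtain ⟨V, hV, Φ, σ, h1, h2, h3⟩ := h ι U C o F ρ ho hF hρ
  exact ⟨V, hV, Φ, σ, h1, h2.mono hm, h3⟩

lemma injective_of_ordered {ι U : Type} {o : ι → ℕ} {ρ : U → ℕ} (ho : Function.Injective o)
    {f : ι → U} (hf : ∀ i j, o i < o j → ρ (f i) < ρ (f j)) : Function.Injective f := by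
  intro i j hij
  by_contra hne
  rcases lt_or_gt_of_ne fun h => hne (ho h) with h | h
  · exact absurd (hf _ _ h) (by rw [hij]; exact lt_irrefl _)
  · exact absurd (hf _ _ h) (by rw [hij]; exact lt_irrefl _)

theorem ram_two : Ram 2 := by
  intro ι U C _ _ _ _ _ o F ρ ho hF hρ
  obtain ⟨N, hN⟩ := exists_ordered_template C ho ρ
  obtain ⟨V, hV, π, Φ, D, r, P⟩ := exists_full_pic_two (C := C)
    (𝒲 := {A : U → Fin N | Function.Injective A ∧ ∀ x y, ρ x < ρ y → A x < A y}) hF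
    (fun f hf => injective_of_ordered ho (hρ f hf)) (fun A hA => hA.1)
  refine ⟨V, hV, Φ, fun x => (π x : ℕ), P.sys, fun n x h1 h2 => by omega, ?_, P.ramsey ?_⟩
  · intro φ hφ x y hxy
    exact (P.hproj φ hφ).2 x y hxy
  · intro c
    obtain ⟨A, h1, h2, k, h3⟩ := hN c
    exact ⟨A, ⟨h1, h2⟩, k, fun f hf => h3 f (hρ f hf)⟩

theorem Ram.conf_two_mul {m : ℕ} (h : Ram m) (hm : 2 ≤ m) : RamConf (2 * m) := by
  intro ι U C _ _ _ _ _ o F ρ ho hF hρ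
  obtain ⟨W, _, 𝒲, σ, hW, -, hσ, hram⟩ := h ι U C o F ρ ho hF hρ
  obtain ⟨V, hV, π, Φ, D, r, P, hear, hconf⟩ := exists_full_pic (C := C) h hm hF
    (fun f hf => injective_of_ordered ho (hρ f hf)) hW
  refine ⟨V, hV, Φ, fun x => σ (π x), P.sys, hear, hconf, ?_, P.ramsey hram⟩
  intro φ hφ x y hxy
  exact hσ _ (P.hproj φ hφ) x y hxy

theorem ramConf (m : ℕ) : RamConf m := by
  have h : ∀ k, RamConf (2 * (k + 2)) := by
    intro k
    induction k with
    | zero => exact ram_two.conf_two_mul le_rfl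
    | succ k ih => exact (ih.ram.conf_two_mul (by omega)).mono (by omega)
  exact (h m).mono (by omega)

/-! ### Simplicial vertices -/

section
variable {V : Type}

lemma exists_walk_of_reflTransGen {R : V → V → Prop} {s t : V} (h : Relation.ReflTransGen R s t) :
    ∃ (n : ℕ) (x : ℕ → V), x 0 = s ∧ x n = t ∧ ∀ i < n, R (x i) (x (i + 1)) := by
  induction h with
  | refl => exact ⟨0, fun _ => s, rfl, rfl, fun i hi => absurd hi (Nat.not_lt_zero i)⟩
  | @tail b c _ hbc ih =>
    obtain ⟨n, x, h0, hn, hx⟩ := ih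
    refine ⟨n + 1, fun i => if i ≤ n then x i else c, by simp [h0], by simp, fun i hi => ?_⟩
    rcases Nat.lt_or_ge i n with h | h
    · simpa [h.le, Nat.succ_le_iff.mpr h] using hx i h
    · obtain rfl : i = n := by omega
      simpa [hn] using hbc

lemma shorten_walk {R : V → V → Prop} {n : ℕ} {x : ℕ → V} (hx : ∀ i < n, R (x i) (x (i + 1)))
    {i d : ℕ} (hi : i + d ≤ n) (h1 : i + d < n → R (x i) (x (i + 1 + d)))
    (h2 : i + d = n → x i = x n) :
    ∃ y : ℕ → V, y 0 = x 0 ∧ y (n - d) = x n ∧ ∀ k < n - d, R (y k) (y (k + 1)) := by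
  refine ⟨fun k => if k ≤ i then x k else x (k + d), by simp, ?_, fun k hk => ?_⟩
  · beta_reduce
    rcases hi.lt_or_eq with h | h
    · rw [if_neg (by omega), Nat.sub_add_cancel (by omega)]
    · rw [if_pos (by omega), ← h2 h, ← h, Nat.add_sub_cancel]
  · beta_reduce
    rcases lt_trichotomy k i with h | rfl | h
    · rw [if_pos h.le, if_pos (by omega)]
      exact hx k (by omega)
    · rw [if_pos le_rfl, if_neg (by omega)]
      exact h1 (by omega)
    · rw [if_neg (by omega), if_neg (by omega), show k + 1 + d = k + d + 1 by omega]
      exact hx (k + d) (by omega)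

lemma exists_induced_walk {R : V → V → Prop} {s t : V} (h : Relation.ReflTransGen R s t) :
    ∃ (n : ℕ) (x : ℕ → V), x 0 = s ∧ x n = t ∧ (∀ i < n, R (x i) (x (i + 1))) ∧
      (∀ i j, i + 1 < j → j ≤ n → ¬ R (x i) (x j)) ∧ ∀ i j, i < j → j ≤ n → x i ≠ x j := by
  classical
  have hex := exists_walk_of_reflTransGen h
  obtain ⟨x, h0, hn, hx⟩ := Nat.find_spec hex
  have hmin : ∀ d, 1 ≤ d → d ≤ Nat.find hex →
      ¬ ∃ y : ℕ → V, y 0 = x 0 ∧ y (Nat.find hex - d) = x (Nat.find hex) ∧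
        ∀ k < Nat.find hex - d, R (y k) (y (k + 1)) := by
    rintro d hd hdn ⟨y, hy0, hy1, hy⟩
    exact Nat.find_min hex (show Nat.find hex - d < Nat.find hex by omega)
      ⟨y, hy0.trans h0, hy1.trans hn, hy⟩
  refine ⟨Nat.find hex, x, h0, hn, hx, fun i j hij hj hR => ?_, fun i j hij hj he => ?_⟩
  · refine hmin (j - i - 1) (by omega) (by omega)
      (shorten_walk hx (i := i) (by omega) (fun _ => ?_) (by omega))
    rwa [show i + 1 + (j - i - 1) = j by omega]
  · refine hmin (j - i) (by omega) (by omega)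
      (shorten_walk hx (i := i) (by omega) (fun hlt => ?_) fun heq => ?_)
    · rw [he, show i + 1 + (j - i) = j + 1 by omega]
      exact hx j (by omega)
    · rw [he, ← heq, show i + (j - i) = j by omega]

/-- The neighbours of `u` in `U` are pairwise adjacent. -/
def Simp (B : Set (Set V)) (U : Set V) (u : V) : Prop :=
  ∀ x ∈ U, ∀ y ∈ U, Co2 B u x → Co2 B u y → Co2 B x y

lemma exists_simp_of_not_adj [Finite V] {B : Set (Set V)} {M : ℕ} (hB : PathEar B M) (k : ℕ) :
    ∀ U : Set V, U.ncard = k → k ≤ M → (∀ x ∈ U, Co2 B x x) → ∀ v ∈ U, ∀ w ∈ U, ¬ Co2 B v w →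
      ∃ u ∈ U, Simp B U u ∧ ¬ Co2 B v u := by
  induction k using Nat.strong_induction_on with
  | _ k ih =>
  intro U hU hk hself v hv w hw hvw
  let N : Set V := {z | z ∈ U ∧ ¬ Co2 B v z}
  let C : Set V := {c | Relation.ReflTransGen (fun a b => Co2 B a b ∧ a ∈ N ∧ b ∈ N) w c}
  let S : Set V := {s | s ∈ U ∧ Co2 B v s ∧ ∃ c ∈ C, Co2 B c s}
  have hCN : ∀ c ∈ C, c ∈ N := by
    intro c hc
    rcases Relation.ReflTransGen.cases_tail hc with h | ⟨b, -, hb⟩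
    · rw [h]
      exact ⟨hw, hvw⟩
    · exact hb.2.2
  have hwC : w ∈ C := Relation.ReflTransGen.refl
  have hstep : ∀ c ∈ C, ∀ z ∈ N, Co2 B c z → z ∈ C := fun c hc z hz h =>
    Relation.ReflTransGen.tail hc ⟨h, hCN c hc, hz⟩
  have hnb : ∀ c ∈ C, ∀ z ∈ U, Co2 B c z → z ∈ C ∪ S := by
    intro c hc z hz h
    by_cases hvz : Co2 B v z
    · exact Or.inr ⟨hz, hvz, c, hc, h⟩
    · exact Or.inl (hstep c hc z ⟨hz, hvz⟩ h)
  have hsub : C ∪ S ⊆ U := by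
    rintro z (hz | hz)
    · exact (hCN z hz).1
    · exact hz.1
  have hvn : v ∉ C ∪ S := by
    rintro (h | ⟨-, -, c, hc, h⟩)
    · exact (hCN v h).2 (hself v hv)
    · exact (hCN c hc).2 h.symm
  have hlt : (C ∪ S).ncard < k := by
    rw [← hU]
    exact Set.ncard_lt_ncard ⟨hsub, fun h => hvn (h hv)⟩
  have hS : ∀ s ∈ S, ∀ t ∈ S, Co2 B s t := by
    intro s hs t ht
    by_contra hst
    have hne : s ≠ t := by
      rintro rfl
      exact hst (hself s hs.1)
    let X : Set V := C ∪ {s, t}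
    let R : V → V → Prop := fun a b => Co2 B a b ∧ a ∈ X ∧ b ∈ X
    have hw' : ∀ c ∈ C, Relation.ReflTransGen R w c ∧ Relation.ReflTransGen R c w := by
      intro c hc
      induction hc with
      | refl => exact ⟨Relation.ReflTransGen.refl, Relation.ReflTransGen.refl⟩
      | tail h1 h2 ih' =>
        exact ⟨ih'.1.tail ⟨h2.1, Or.inl h1, Or.inl (h1.tail h2)⟩,
          ih'.2.head ⟨h2.1.symm, Or.inl (h1.tail h2), Or.inl h1⟩⟩
    obtain ⟨c, hc, hcs⟩ := hs.2.2
    obtain ⟨c', hc', hct⟩ := ht.2.2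
    have hgen : Relation.ReflTransGen R s t :=
      ((Relation.ReflTransGen.single (show R s c from
        ⟨hcs.symm, Or.inr (Or.inl rfl), Or.inl hc⟩)).trans
        ((hw' c hc).2.trans (hw' c' hc').1)).tail
        ⟨hct, Or.inl hc', Or.inr (Or.inr rfl)⟩
    obtain ⟨n, x, h0, hn, hx, hind, hinj⟩ := exists_induced_walk hgen
    have hn2 : 2 ≤ n := by
      rcases n with - | - | n
      · exact absurd (h0.symm.trans hn) hne
      · have := (hx 0 (by omega)).1
        rw [h0] at this
        exact absurd (hn ▸ this) hst
      · omega
    have hxX : ∀ i ≤ n, x i ∈ X := by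
      intro i hi
      rcases hi.lt_or_eq with h | rfl
      · exact (hx i h).2.1
      · rw [hn]
        exact Or.inr (Or.inr rfl)
    have hXU : ∀ z ∈ X, z ∈ U \ {v} := by
      have hSv : ∀ z ∈ C ∪ S, z ∈ U \ {v} := fun z hz => ⟨hsub hz, fun h => hvn (h ▸ hz)⟩
      rintro z (hz | rfl | rfl)
      · exact hSv z (Or.inl hz)
      · exact hSv z (Or.inr hs)
      · exact hSv z (Or.inr ht)
    have hcard : n + 2 ≤ k := by
      have h1 : (x '' Set.Iic n).ncard = n + 1 := by
        rw [Set.InjOn.ncard_image, Set.ncard_eq_toFinset_card', Set.toFinset_Iic, Nat.card_Iic]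
        intro i hi j hj hij
        by_contra hne'
        rcases lt_or_gt_of_ne hne' with h | h
        · exact hinj i j h hj hij
        · exact hinj j i h hi hij.symm
      have h2 : (x '' Set.Iic n).ncard ≤ (U \ {v}).ncard := by
        refine Set.ncard_le_ncard ?_ (Set.toFinite _)
        rintro _ ⟨i, hi, rfl⟩
        exact hXU _ (hxX i hi)
      have h3 := Set.ncard_sdiff_singleton_add_one hv
      omega
    obtain ⟨i, hi, hear⟩ := hB (n + 1) (fun i => if i ≤ n then x i else v) (by omega) (by omega)
      (fun i hi => by
        rcases Nat.lt_or_ge i n with h | h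
        · simpa [h.le, Nat.succ_le_iff.mpr h] using (hx i h).1
        · obtain rfl : i = n := by omega
          simpa [hn] using ht.2.1.symm)
      (by simpa [h0] using hs.2.1.symm)
    obtain ⟨b, hb, h1, -, h3⟩ := hear
    rcases Nat.lt_or_ge n (i + 2) with h | h
    · obtain rfl : n = i + 1 := by omega
      rw [if_pos (by omega)] at h1
      rw [if_neg (by omega)] at h3
      have hxi : x i ∈ C := by
        rcases hxX i (by omega) with hc | hs' | ht'
        · exact hc
        · exact absurd (h0.trans hs'.symm) (hinj 0 i (by omega) (by omega))
        · exact absurd (ht'.trans hn.symm) (hinj i (i + 1) (by omega) (by omega))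
      exact (hCN _ hxi).2 ⟨b, hb, h3, h1⟩
    · rw [if_pos (by omega)] at h1
      rw [if_pos h] at h3
      exact hind i (i + 2) (by omega) h ⟨⟨b, hb, h1, h3⟩, hxX _ (by omega), hxX _ h⟩
  have hfin : ∀ u ∈ C, Simp B (C ∪ S) u → ∃ u ∈ U, Simp B U u ∧ ¬ Co2 B v u :=
    fun u hu h => ⟨u, (hCN u hu).1, fun x hx y hy hux huy =>
      h x (hnb u hu x hx hux) y (hnb u hu y hy huy) hux huy, (hCN u hu).2⟩
  have hself' : ∀ x ∈ C ∪ S, Co2 B x x := fun x hx => hself x (hsub hx)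
  by_cases h1 : ∃ s ∈ S, ∃ z ∈ C ∪ S, ¬ Co2 B s z
  · obtain ⟨s, hs, z, hz, hsz⟩ := h1
    obtain ⟨u, hu, hu1, hu2⟩ := ih _ hlt _ rfl (by omega) hself' s (Or.inr hs) z hz hsz
    rcases hu with hu | hu
    · exact hfin u hu hu1
    · exact absurd (hS s hs u hu) hu2
  push Not at h1
  by_cases h2 : ∃ s ∈ C, ∃ z ∈ C ∪ S, ¬ Co2 B s z
  · obtain ⟨s, hs, z, hz, hsz⟩ := h2
    obtain ⟨u, hu, hu1, hu2⟩ := ih _ hlt _ rfl (by omega) hself' s (Or.inl hs) z hz hsz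
    rcases hu with hu | hu
    · exact hfin u hu hu1
    · exact absurd (h1 u hu s (Or.inl hs)).symm hu2
  push Not at h2
  refine hfin w hwC fun x hx y hy _ _ => ?_
  rcases hx with hx | hx
  · exact h2 x hx y hy
  · exact h1 x hx y hy

/-- In a small nonempty set of vertices, all neighbours of a suitable vertex lie in one block. -/
theorem exists_block_of_small [Finite V] {B : Set (Set V)} {M : ℕ} (hB : PathEar B M)
    (hconf : Conf B) {U : Set V} (hU : U.ncard ≤ M) (hne : U.Nonempty)
    (hself : ∀ x ∈ U, Co2 B x x) :
    ∃ u ∈ U, ∃ b ∈ B, ∀ x ∈ U, Co2 B u x → x ∈ b := by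
  obtain ⟨u, hu, hs⟩ : ∃ u ∈ U, Simp B U u := by
    by_cases h : ∃ v ∈ U, ∃ w ∈ U, ¬ Co2 B v w
    · obtain ⟨v, hv, w, hw, hvw⟩ := h
      obtain ⟨u, hu, h1, -⟩ := exists_simp_of_not_adj hB _ U rfl hU hself v hv w hw hvw
      exact ⟨u, hu, h1⟩
    · push Not at h
      obtain ⟨u, hu⟩ := hne
      exact ⟨u, hu, fun x hx y hy _ _ => h x hx y hy⟩
  obtain ⟨b, hb, hsub⟩ := hconf {x | x ∈ U ∧ Co2 B u x} ⟨u, hu, hself u hu⟩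
    (fun x hx y hy => hs x hx.1 y hy.1 hx.2 hy.2)
  exact ⟨u, hu, b, hb, fun x hx hux => hsub ⟨hx, hux⟩⟩

end

/-! ### Completing small families of blocks to forests -/

section
variable {V : Type}

/-- A block meeting the union of the family `𝒯` at most in a vertex or in part of a member. -/
def Leaf (𝒯 : Set (Set V)) (A : Set V) : Prop :=
  (A ∩ ⋃₀ 𝒯).Subsingleton ∨ ∃ B ∈ 𝒯, A ∩ ⋃₀ 𝒯 ⊆ B

/-- Families of blocks built by successively adding leaves. -/
inductive BlockForest : Set (Set V) → Prop
  | empty : BlockForest ∅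
  | insert {𝒯 : Set (Set V)} {A : Set V} : BlockForest 𝒯 → A ∉ 𝒯 → Leaf 𝒯 A →
      BlockForest (insert A 𝒯)

/-- Two members of the family `𝒯` sharing two vertices. -/
def Link (𝒯 : Set (Set V)) (A B : Set V) : Prop :=
  A ∈ 𝒯 ∧ B ∈ 𝒯 ∧ ∃ x y, x ≠ y ∧ x ∈ A ∧ y ∈ A ∧ x ∈ B ∧ y ∈ B

lemma Link.symm {𝒯 : Set (Set V)} {A B : Set V} (h : Link 𝒯 A B) : Link 𝒯 B A := by
  obtain ⟨hA, hB, x, y, hxy, h1, h2, h3, h4⟩ := h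
  exact ⟨hB, hA, x, y, hxy, h3, h4, h1, h2⟩

lemma Link.mono {𝒯 𝒯' : Set (Set V)} (h : 𝒯 ⊆ 𝒯') {A B : Set V} (hl : Link 𝒯 A B) :
    Link 𝒯' A B := ⟨h hl.1, h hl.2.1, hl.2.2⟩

/-- The labels of the members of `𝒯` refine its partition into linked components. -/
def Labelled {L : Type} (𝒯 : Set (Set V)) (lab : Set V → L) : Prop :=
  ∀ A ∈ 𝒯, ∀ B ∈ 𝒯, lab A = lab B → Relation.ReflTransGen (Link 𝒯) A B

/-- Two distinct blocks of `ℬ` meet in at most two vertices. -/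
def AlmostDisjoint (ℬ : Set (Set V)) : Prop :=
  ∀ A ∈ ℬ, ∀ B ∈ ℬ, A ≠ B → ∀ x ∈ A ∩ B, ∀ y ∈ A ∩ B, x ≠ y → A ∩ B ⊆ {x, y}

lemma Labelled.diff_leaf {L : Type} {𝒯 : Set (Set V)} {lab : Set V → L} (h : Labelled 𝒯 lab)
    {A : Set V} (hA : Leaf (𝒯 \ {A}) A) : Labelled (𝒯 \ {A}) lab := by
  classical
  obtain ⟨B, hB⟩ : ∃ B, ∀ W ∈ 𝒯 \ {A}, ∀ x y, x ≠ y → x ∈ A → y ∈ A → x ∈ W → y ∈ W →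
      Link (𝒯 \ {A}) B W := by
    rcases hA with hA | ⟨B, hB, hA⟩
    · exact ⟨A, fun W hW x y hxy h1 h2 h3 h4 =>
        absurd (hA ⟨h1, W, hW, h3⟩ ⟨h2, W, hW, h4⟩) hxy⟩
    · exact ⟨B, fun W hW x y hxy h1 h2 h3 h4 =>
        ⟨hB, hW, x, y, hxy, hA ⟨h1, W, hW, h3⟩, hA ⟨h2, W, hW, h4⟩, h3, h4⟩⟩
  have key : ∀ X Y, Relation.ReflTransGen (Link 𝒯) X Y → Relation.ReflTransGen (Link (𝒯 \ {A}))
      (if X = A then B else X) (if Y = A then B else Y) := by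
    intro X Y hXY
    induction hXY with
    | refl => exact Relation.ReflTransGen.refl
    | @tail Y Z _ hYZ ih =>
      refine ih.trans ?_
      obtain ⟨hY, hZ, x, y, hxy, h1, h2, h3, h4⟩ := hYZ
      by_cases hYA : Y = A <;> by_cases hZA : Z = A
      · rw [if_pos hYA, if_pos hZA]
      · rw [if_pos hYA, if_neg hZA]
        rw [hYA] at h1 h2
        exact Relation.ReflTransGen.single (hB Z ⟨hZ, hZA⟩ x y hxy h1 h2 h3 h4)
      · rw [if_neg hYA, if_pos hZA]
        rw [hZA] at h3 h4
        exact Relation.ReflTransGen.single (hB Y ⟨hY, hYA⟩ x y hxy h3 h4 h1 h2).symm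
      · rw [if_neg hYA, if_neg hZA]
        exact Relation.ReflTransGen.single ⟨⟨hY, hYA⟩, ⟨hZ, hZA⟩, x, y, hxy, h1, h2, h3, h4⟩
  intro X hX Y hY hXY
  have := key X Y (h X hX.1 Y hY.1 hXY)
  have hXA : X ≠ A := hX.2
  have hYA : Y ≠ A := hY.2
  rwa [if_neg hXA, if_neg hYA] at this

/-- A new block joining two differently labelled members of `𝒯`. -/
def Joint {L : Type} (ℬ 𝒯 : Set (Set V)) (lab : Set V → L) : Prop :=
  3 ≤ (lab '' 𝒯).ncard ∧ ∃ D ∈ ℬ, D ∉ 𝒯 ∧ ∃ A₁ ∈ 𝒯, ∃ A₂ ∈ 𝒯, lab A₁ ≠ lab A₂ ∧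
    ∃ u x z, u ≠ x ∧ u ≠ z ∧ x ≠ z ∧ u ∈ D ∧ x ∈ D ∧ z ∈ D ∧ u ∈ A₁ ∧ x ∈ A₁ ∧ u ∈ A₂ ∧ z ∈ A₂

variable [Finite V] {ℬ : Set (Set V)} {M : ℕ}

lemma joint_of_no_leaf (hℬ : AlmostDisjoint ℬ) (hear : PathEar ℬ M) (hconf : Conf ℬ) {L : Type}
    {𝒯 : Set (Set V)} (h𝒯 : 𝒯 ⊆ ℬ) (hne : 𝒯.Nonempty) (hM : (⋃₀ 𝒯).ncard ≤ M)
    {lab : Set V → L} (hlab : Labelled 𝒯 lab) (hleaf : ∀ A ∈ 𝒯, ¬ Leaf (𝒯 \ {A}) A) :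
    Joint ℬ 𝒯 lab := by
  let U : Set V := {v | ∃ A ∈ 𝒯, ∃ B ∈ 𝒯, A ≠ B ∧ v ∈ A ∧ v ∈ B}
  have hAU : ∀ A ∈ 𝒯, ∀ v ∈ A ∩ ⋃₀ (𝒯 \ {A}), v ∈ U := by
    rintro A hA v ⟨hv, B, hB, hvB⟩
    exact ⟨A, hA, B, hB.1, fun h => hB.2 h.symm, hv, hvB⟩
  have hUne : U.Nonempty := by
    obtain ⟨A, hA⟩ := hne
    by_contra hU
    refine hleaf A hA (Or.inl fun v hv => ?_)
    exact absurd ⟨v, hAU A hA v hv⟩ hU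
  have hUM : U.ncard ≤ M := by
    refine le_trans (Set.ncard_le_ncard ?_ (Set.toFinite _)) hM
    rintro v ⟨A, hA, -, -, -, hv, -⟩
    exact ⟨A, hA, hv⟩
  obtain ⟨u, ⟨A₁, hA₁, A₂, hA₂, hne12, hu1, hu2⟩, D, hD, huD⟩ :=
    exists_block_of_small hear hconf hUM hUne
      (by
        rintro v ⟨A, hA, -, -, -, hv, -⟩
        exact ⟨A, h𝒯 hA, hv, hv⟩)
  have hID : ∀ A ∈ 𝒯, u ∈ A → A ∩ ⋃₀ (𝒯 \ {A}) ⊆ D := fun A hA hu v hv =>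
    huD v (hAU A hA v hv) ⟨A, h𝒯 hA, hu, hv.1⟩
  have huD' : u ∈ D := huD u ⟨A₁, hA₁, A₂, hA₂, hne12, hu1, hu2⟩ ⟨A₁, h𝒯 hA₁, hu1, hu1⟩
  have hD𝒯 : D ∉ 𝒯 := by
    intro h
    by_cases h1 : A₁ = D
    · exact hleaf A₂ hA₂ (Or.inr ⟨D, ⟨h, fun h2 => hne12 (h1.trans h2)⟩, hID A₂ hA₂ hu2⟩)
    · exact hleaf A₁ hA₁ (Or.inr ⟨D, ⟨h, fun h2 => h1 h2.symm⟩, hID A₁ hA₁ hu1⟩)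
  have hpair : ∀ A ∈ 𝒯, u ∈ A → ∃ x, u ≠ x ∧ x ∈ A ∧ x ∈ D ∧ x ∈ ⋃₀ (𝒯 \ {A}) ∧
      A ∩ ⋃₀ (𝒯 \ {A}) ⊆ {u, x} ∧ ∀ B ∈ 𝒯, B ≠ A → u ∈ B → x ∉ B := by
    intro A hA hu
    obtain ⟨x, hx, hxu⟩ : ∃ x ∈ A ∩ ⋃₀ (𝒯 \ {A}), u ≠ x := by
      by_contra hno
      push Not at hno
      exact hleaf A hA (Or.inl fun v hv w hw => (hno v hv).symm.trans (hno w hw))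
    have hxD := hID A hA hu hx
    have hsub : A ∩ ⋃₀ (𝒯 \ {A}) ⊆ {u, x} := fun v hv =>
      hℬ A (h𝒯 hA) D hD (fun h => hD𝒯 (h ▸ hA)) u ⟨hu, huD'⟩ x ⟨hx.1, hxD⟩ hxu
        ⟨hv.1, hID A hA hu hv⟩
    refine ⟨x, hxu, hx.1, hxD, hx.2, hsub, fun B hB hBA huB hxB => ?_⟩
    refine hleaf A hA (Or.inr ⟨B, ⟨hB, hBA⟩, fun v hv => ?_⟩)
    rcases hsub hv with rfl | rfl
    · exact huB
    · exact hxB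
  have hiso : ∀ A ∈ 𝒯, u ∈ A → ∀ B ∈ 𝒯, lab A = lab B → B = A := by
    intro A hA hu B hB hAB
    obtain ⟨x, hxu, -, -, -, hsub, hx⟩ := hpair A hA hu
    have hgen := hlab A hA B hB hAB
    clear hAB hB
    induction hgen with
    | refl => rfl
    | @tail Y Z _ hYZ ih =>
      rw [ih] at hYZ
      obtain ⟨-, hZ, p, q, hpq, hp, hq, hpZ, hqZ⟩ := hYZ
      by_contra hZA
      have h1 := hsub ⟨hp, Z, ⟨hZ, hZA⟩, hpZ⟩
      have h2 := hsub ⟨hq, Z, ⟨hZ, hZA⟩, hqZ⟩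
      rcases h1 with rfl | rfl <;> rcases h2 with rfl | rfl
      · exact hpq rfl
      · exact hx Z hZ hZA hpZ hqZ
      · exact hx Z hZ hZA hqZ hpZ
      · exact hpq rfl
  obtain ⟨x, hux, hxA, hxD, ⟨B, hB, hxB⟩, -, hx⟩ := hpair A₁ hA₁ hu1
  obtain ⟨z, huz, hzA, hzD, -, -, -⟩ := hpair A₂ hA₂ hu2
  have hlab12 : lab A₁ ≠ lab A₂ := fun h => hne12 (hiso A₁ hA₁ hu1 A₂ hA₂ h).symm
  refine ⟨?_, D, hD, hD𝒯, A₁, hA₁, A₂, hA₂, hlab12, u, x, z, hux, huz, ?_, huD', hxD, hzD, hu1,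
    hxA, hu2, hzA⟩
  · have h𝒯fin : (lab '' 𝒯).Finite := Set.toFinite _
    refine (Set.two_lt_ncard h𝒯fin).mpr ⟨_, ⟨A₁, hA₁, rfl⟩, _, ⟨A₂, hA₂, rfl⟩, _, ⟨B, hB.1, rfl⟩,
      hlab12, fun h => hB.2 (hiso A₁ hA₁ hu1 B hB.1 h), fun h => ?_⟩
    have hBA := hiso A₂ hA₂ hu2 B hB.1 h
    rw [hBA] at hxB
    exact hx A₂ hA₂ hne12.symm hu2 hxB
  · rintro rfl
    exact hx A₂ hA₂ hne12.symm hu2 hzA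

lemma forest_or_joint (hℬ : AlmostDisjoint ℬ) (hear : PathEar ℬ M) (hconf : Conf ℬ) {L : Type}
    (k : ℕ) : ∀ 𝒯 : Set (Set V), 𝒯.ncard = k → 𝒯 ⊆ ℬ → (⋃₀ 𝒯).ncard ≤ M →
      ∀ lab : Set V → L, Labelled 𝒯 lab → BlockForest 𝒯 ∨ Joint ℬ 𝒯 lab := by
  induction k with
  | zero =>
    intro 𝒯 hk _ _ lab _
    rw [(Set.ncard_eq_zero (Set.toFinite _)).mp hk]
    exact Or.inl BlockForest.empty
  | succ k ih =>
    intro 𝒯 hk h𝒯 hM lab hlab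
    by_cases hleaf : ∃ A ∈ 𝒯, Leaf (𝒯 \ {A}) A
    swap
    · push Not at hleaf
      exact Or.inr (joint_of_no_leaf hℬ hear hconf h𝒯
        (Set.nonempty_of_ncard_ne_zero (by omega)) hM hlab hleaf)
    obtain ⟨A, hA, hleaf⟩ := hleaf
    have hsub : 𝒯 \ {A} ⊆ 𝒯 := Set.sdiff_subset
    have hk' : (𝒯 \ {A}).ncard = k := by
      have := Set.ncard_sdiff_singleton_add_one hA
      omega
    rcases ih _ hk' (hsub.trans h𝒯)
      ((Set.ncard_le_ncard (Set.sUnion_subset_sUnion hsub) (Set.toFinite _)).trans hM) lab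
      (hlab.diff_leaf hleaf) with h | ⟨h3, D, hD, hD𝒯, A₁, hA₁, A₂, hA₂, hne, u, x, z, hux, huz,
        hxz, huD, hxD, hzD, hu1, hx1, hu2, hz2⟩
    · left
      have := h.insert (fun h => h.2 rfl) hleaf
      rwa [Set.insert_sdiff_singleton, Set.insert_eq_of_mem hA] at this
    · right
      refine ⟨h3.trans (Set.ncard_le_ncard (Set.image_mono hsub) (Set.toFinite _)), D, hD, ?_,
        A₁, hA₁.1, A₂, hA₂.1, hne, u, x, z, hux, huz, hxz, huD, hxD, hzD, hu1, hx1, hu2, hz2⟩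
      intro hD'
      obtain rfl : D = A := by
        by_contra h
        exact hD𝒯 ⟨hD', h⟩
      rcases hleaf with hl | ⟨B, hB, hl⟩
      · exact hux (hl ⟨huD, A₁, hA₁, hu1⟩ ⟨hxD, A₁, hA₁, hx1⟩)
      · have huB := hl ⟨huD, A₁, hA₁, hu1⟩
        have hxB := hl ⟨hxD, A₁, hA₁, hx1⟩
        have hzB := hl ⟨hzD, A₂, hA₂, hz2⟩
        rcases hℬ D hD B (h𝒯 hB.1) (fun h => hB.2 h.symm) u ⟨huD, huB⟩ x ⟨hxD, hxB⟩ hux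
          ⟨hzD, hzB⟩ with h | h
        · exact huz h.symm
        · exact hxz h.symm

lemma ncard_sUnion_le {k : ℕ} (hk : ∀ B ∈ ℬ, B.ncard ≤ k) {𝒯 : Set (Set V)} (h𝒯 : 𝒯 ⊆ ℬ) :
    (⋃₀ 𝒯).ncard ≤ k * 𝒯.ncard := by
  induction 𝒯, Set.toFinite 𝒯 using Set.Finite.induction_on with
  | empty => simp
  | @insert A 𝒯 hA h𝒯' ih =>
    rw [Set.sUnion_insert, Set.ncard_insert_of_notMem hA (Set.toFinite _), Nat.mul_add_one]
    have h1 := Set.ncard_union_le A (⋃₀ 𝒯)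
    have h2 := ih fun B hB => h𝒯 (Or.inr hB)
    have h3 := hk A (h𝒯 (Or.inl rfl))
    omega

/-- A family of blocks with few linked components can be completed to a forest. -/
theorem exists_forest {L : Type} (hℬ : AlmostDisjoint ℬ) (hear : PathEar ℬ M) (hconf : Conf ℬ)
    {k l : ℕ} (hk : ∀ B ∈ ℬ, B.ncard ≤ k) (hM : k * l ≤ M) (c : ℕ) :
    ∀ (𝒯 : Set (Set V)) (lab : Set V → L), 𝒯 ⊆ ℬ → Labelled 𝒯 lab → (lab '' 𝒯).ncard ≤ c →
      𝒯.ncard + c ≤ l → ∃ 𝒳 ⊆ ℬ, 𝒳.ncard ≤ c - 2 ∧ BlockForest (𝒯 ∪ 𝒳) := by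
  classical
  induction c with
  | zero =>
    intro 𝒯 lab h𝒯 hlab hc hl
    have h1 : (⋃₀ 𝒯).ncard ≤ M :=
      ((ncard_sUnion_le hk h𝒯).trans (Nat.mul_le_mul_left k (by omega))).trans hM
    rcases forest_or_joint hℬ hear hconf _ 𝒯 rfl h𝒯 h1 lab hlab with h | h
    · exact ⟨∅, Set.empty_subset _, by simp, by simpa using h⟩
    · exact absurd h.1 (by omega)
  | succ c ih =>
    intro 𝒯 lab h𝒯 hlab hc hl
    have h1 : (⋃₀ 𝒯).ncard ≤ M :=
      ((ncard_sUnion_le hk h𝒯).trans (Nat.mul_le_mul_left k (by omega))).trans hM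
    rcases forest_or_joint hℬ hear hconf _ 𝒯 rfl h𝒯 h1 lab hlab with h | ⟨h3, D, hD, hD𝒯, A₁, hA₁,
      A₂, hA₂, hne, u, x, z, hux, huz, hxz, huD, hxD, hzD, hu1, hx1, hu2, hz2⟩
    · exact ⟨∅, Set.empty_subset _, by simp, by simpa using h⟩
    let lab' : Set V → L := fun X => if X = D ∨ lab X = lab A₂ then lab A₁ else lab X
    have hsub : 𝒯 ⊆ insert D 𝒯 := Set.subset_insert _ _
    have hsub' : insert D 𝒯 ⊆ ℬ := Set.insert_subset hD h𝒯
    have hsymm : ∀ X Y, Relation.ReflTransGen (Link (insert D 𝒯)) X Y →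
        Relation.ReflTransGen (Link (insert D 𝒯)) Y X := by
      intro X Y h
      induction h with
      | refl => exact Relation.ReflTransGen.refl
      | tail _ h ih' => exact ih'.head h.symm
    have hold : ∀ X ∈ 𝒯, ∀ Y ∈ 𝒯, lab X = lab Y →
        Relation.ReflTransGen (Link (insert D 𝒯)) X Y := fun X hX Y hY hXY =>
      (hlab X hX Y hY hXY).lift _root_.id fun _ _ h => h.mono hsub
    have hD1 : Link (insert D 𝒯) A₁ D :=
      ⟨Or.inr hA₁, Or.inl rfl, u, x, hux, hu1, hx1, huD, hxD⟩
    have hD2 : Link (insert D 𝒯) A₂ D :=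
      ⟨Or.inr hA₂, Or.inl rfl, u, z, huz, hu2, hz2, huD, hzD⟩
    have hcon : ∀ X ∈ insert D 𝒯, lab' X = lab A₁ →
        Relation.ReflTransGen (Link (insert D 𝒯)) X D := by
      rintro X (rfl | hX) hX1
      · exact Relation.ReflTransGen.refl
      · by_cases h : X = D ∨ lab X = lab A₂
        · rcases h with rfl | h
          · exact Relation.ReflTransGen.refl
          · exact (hold X hX A₂ hA₂ h).tail hD2
        · have h2 : lab X = lab A₁ := by
            rwa [show lab' X = lab X from if_neg h] at hX1
          exact (hold X hX A₁ hA₁ h2).tail hD1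
    have hlab' : Labelled (insert D 𝒯) lab' := by
      intro X hX Y hY hXY
      by_cases h : lab' X = lab A₁
      · exact (hcon X hX h).trans (hsymm _ _ (hcon Y hY (hXY.symm.trans h)))
      · have hX' : ¬ (X = D ∨ lab X = lab A₂) := fun h' => h (if_pos h')
        have hY' : ¬ (Y = D ∨ lab Y = lab A₂) := fun h' => h (hXY.trans (if_pos h'))
        rw [show lab' X = lab X from if_neg hX', show lab' Y = lab Y from if_neg hY'] at hXY
        exact hold X (hX.resolve_left fun h' => hX' (Or.inl h')) Y
          (hY.resolve_left fun h' => hY' (Or.inl h')) hXY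
    have himg : lab' '' insert D 𝒯 ⊆ lab '' 𝒯 \ {lab A₂} := by
      rintro _ ⟨X, hX, rfl⟩
      by_cases h : X = D ∨ lab X = lab A₂
      · rw [show lab' X = lab A₁ from if_pos h]
        exact ⟨⟨A₁, hA₁, rfl⟩, hne⟩
      · rw [show lab' X = lab X from if_neg h]
        exact ⟨⟨X, hX.resolve_left fun h' => h (Or.inl h'), rfl⟩, fun h' => h (Or.inr h')⟩
    have hcard : (lab' '' insert D 𝒯).ncard ≤ c := by
      have h4 := Set.ncard_le_ncard himg (Set.toFinite _)
      have h5 := Set.ncard_sdiff_singleton_add_one (s := lab '' 𝒯) ⟨A₂, hA₂, rfl⟩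
      omega
    obtain ⟨𝒳, h𝒳, h𝒳c, hfor⟩ := ih (insert D 𝒯) lab' hsub' hlab' hcard
      (by rw [Set.ncard_insert_of_notMem hD𝒯 (Set.toFinite _)]; omega)
    refine ⟨insert D 𝒳, Set.insert_subset hD h𝒳, ?_, ?_⟩
    · have := Set.ncard_insert_le D 𝒳
      omega
    · rwa [Set.union_insert, ← Set.insert_union]

theorem exists_forest_of_small (hℬ : AlmostDisjoint ℬ) (hear : PathEar ℬ M) (hconf : Conf ℬ)
    {k l : ℕ} (hk : ∀ B ∈ ℬ, B.ncard ≤ k) (hM : k * (2 * l) ≤ M) {𝒯 : Set (Set V)} (h𝒯 : 𝒯 ⊆ ℬ)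
    (hl : 𝒯.ncard ≤ l) : ∃ 𝒳 ⊆ ℬ, 𝒳.ncard ≤ 𝒯.ncard - 2 ∧ BlockForest (𝒯 ∪ 𝒳) := by
  refine exists_forest hℬ hear hconf hk hM 𝒯.ncard 𝒯 id h𝒯 ?_ (by simp) (by omega)
  rintro A _ B _ rfl
  exact Relation.ReflTransGen.refl

end

/-! ### Graphs and forests of copies -/

section
variable {V : Type}

lemma BlockForest.exists_enum {𝒯 : Set (Set V)} (h : BlockForest 𝒯) :
    ∃ (m : ℕ) (b : ℕ → Set V), (∀ i < m, ∀ j < m, b i = b j → i = j) ∧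
      (∀ B, B ∈ 𝒯 ↔ ∃ i < m, b i = B) ∧ ∀ j < m, Leaf {B | ∃ i < j, b i = B} (b j) := by
  induction h with
  | empty => exact ⟨0, fun _ => ∅, by simp, by simp, by simp⟩
  | @insert 𝒯 A _ hA hleaf ih =>
    obtain ⟨m, b, hinj, hmem, hb⟩ := ih
    have hold : ∀ i < m, Function.update b m A i = b i := fun i hi =>
      Function.update_of_ne (by omega) _ _
    have hnew : Function.update b m A m = A := Function.update_self _ _ _
    have hne : ∀ i < m, b i ≠ A := fun i hi h => hA ((hmem A).mpr ⟨i, hi, h⟩)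
    have hset : ∀ j ≤ m, {B | ∃ i < j, Function.update b m A i = B} = {B | ∃ i < j, b i = B} := by
      intro j hj
      ext B
      constructor <;> rintro ⟨i, hi, h⟩
      · exact ⟨i, hi, by rwa [hold i (by omega)] at h⟩
      · exact ⟨i, hi, by rwa [hold i (by omega)]⟩
    refine ⟨m + 1, Function.update b m A, ?_, ?_, ?_⟩
    · intro i hi j hj hij
      rcases Nat.lt_succ_iff_lt_or_eq.mp hi with hi | rfl <;>
        rcases Nat.lt_succ_iff_lt_or_eq.mp hj with hj | rfl
      · rw [hold i hi, hold j hj] at hij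
        exact hinj i hi j hj hij
      · rw [hold i hi, hnew] at hij
        exact absurd hij (hne i hi)
      · rw [hold j hj, hnew] at hij
        exact absurd hij.symm (hne j hj)
      · rfl
    · intro B
      rw [Set.mem_insert_iff, hmem]
      constructor
      · rintro (rfl | ⟨i, hi, h⟩)
        · exact ⟨m, by omega, hnew⟩
        · exact ⟨i, by omega, by rwa [hold i hi]⟩
      · rintro ⟨i, hi, h⟩
        rcases Nat.lt_succ_iff_lt_or_eq.mp hi with hi | rfl
        · exact Or.inr ⟨i, hi, by rwa [hold i hi] at h⟩
        · exact Or.inl (h.symm.trans hnew)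
    · intro j hj
      rw [hset j (by omega)]
      rcases Nat.lt_succ_iff_lt_or_eq.mp hj with hj | rfl
      · rw [hold j hj]
        exact hb j hj
      · rw [hnew]
        convert hleaf using 1
        ext B
        exact (hmem B).symm

end

section
variable {α V : Type} {F : SimpleGraph α} {ρ : α → ℕ} {Φ : Set (α → V)}

/-- The edges of `F`, oriented by `ρ`. -/
def orderedEdges (F : SimpleGraph α) (ρ : α → ℕ) : Set (Fin 2 → α) :=
  {f | ρ (f 0) < ρ (f 1) ∧ F.Adj (f 0) (f 1)}

lemma exists_orderedEdge (hρ : Function.Injective ρ) {a b : α} (h : F.Adj a b) :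
    ∃ t ∈ orderedEdges F ρ, (t 0 = a ∧ t 1 = b) ∨ (t 0 = b ∧ t 1 = a) := by
  rcases lt_or_gt_of_ne fun e => h.ne (hρ e) with hab | hab
  · exact ⟨![a, b], ⟨hab, h⟩, Or.inl ⟨rfl, rfl⟩⟩
  · exact ⟨![b, a], ⟨hab, h.symm⟩, Or.inr ⟨rfl, rfl⟩⟩

lemma mem_range_two {W : Type} {f : Fin 2 → W} {x : W} :
    x ∈ Set.range f ↔ x = f 0 ∨ x = f 1 := by
  rw [Set.mem_range, Fin.exists_fin_two, eq_comm, @eq_comm _ (f 1)]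

lemma lin_orderedEdges : Lin (orderedEdges F ρ) := by
  intro f hf g hg x y hxy hx hy hx' hy'
  have h1 := hf.1
  have h2 := hg.1
  rw [mem_range_two] at hx hy hx' hy'
  have key : f 0 = g 0 ∧ f 1 = g 1 := by
    rcases hx with hx | hx <;> rcases hy with hy | hy <;> rcases hx' with hx' | hx' <;>
      rcases hy' with hy' | hy' <;> grind
  funext i
  fin_cases i
  · exact key.1
  · exact key.2

/-- The union of the copies of `F` in `Φ`. -/
def unionGraph (F : SimpleGraph α) (Φ : Set (α → V)) : SimpleGraph V where
  Adj x y := x ≠ y ∧ ∃ φ ∈ Φ, ∃ a b, F.Adj a b ∧ φ a = x ∧ φ b = y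
  symm := ⟨fun _ _ ⟨h, φ, hφ, a, b, hab, ha, hb⟩ => ⟨h.symm, φ, hφ, b, a, hab.symm, hb, ha⟩⟩
  loopless := ⟨fun _ h => h.1 rfl⟩

lemma unionGraph_adj (hρ : Function.Injective ρ) (h : Sys (orderedEdges F ρ) Φ) {φ : α → V}
    (hφ : φ ∈ Φ) {a b : α} : (unionGraph F Φ).Adj (φ a) (φ b) ↔ F.Adj a b := by
  constructor
  · rintro ⟨hne, ψ, hψ, a', b', hab, ha, hb⟩
    obtain ⟨t, ht, htab⟩ := exists_orderedEdge hρ hab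
    have hra : φ a ∈ Set.range (ψ ∘ t) := by
      rw [mem_range_two, ← ha]
      rcases htab with ⟨h0, h1⟩ | ⟨h0, h1⟩
      · exact Or.inl (congrArg ψ h0.symm)
      · exact Or.inr (congrArg ψ h1.symm)
    have hrb : φ b ∈ Set.range (ψ ∘ t) := by
      rw [mem_range_two, ← hb]
      rcases htab with ⟨h0, h1⟩ | ⟨h0, h1⟩
      · exact Or.inr (congrArg ψ h1.symm)
      · exact Or.inl (congrArg ψ h0.symm)
    obtain ⟨t', ht', htt⟩ := h.strong φ hφ (ψ ∘ t) ⟨ψ, hψ, t, ht, rfl⟩ _ _ hne ⟨a, rfl⟩ ⟨b, rfl⟩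
      hra hrb
    rw [htt, mem_range_two] at hra hrb
    rcases hra with hra | hra <;> rcases hrb with hrb | hrb
    · exact absurd (hra.trans hrb.symm) hne
    · rw [h.inj φ hφ hra, h.inj φ hφ hrb]
      exact ht'.2
    · rw [h.inj φ hφ hra, h.inj φ hφ hrb]
      exact ht'.2.symm
    · exact absurd (hra.trans hrb.symm) hne
  · intro hab
    exact ⟨fun e => hab.ne (h.inj φ hφ e), φ, hφ, a, b, hab, rfl, rfl⟩

lemma nonempty_iso_induce (hρ : Function.Injective ρ) (h : Sys (orderedEdges F ρ) Φ) {φ : α → V}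
    (hφ : φ ∈ Φ) :
    Nonempty (((⊤ : (unionGraph F Φ).Subgraph).induce (Set.range φ)).coe ≃g F) := by
  refine ⟨RelIso.symm ⟨Equiv.ofInjective φ (h.inj φ hφ), ?_⟩⟩
  intro a b
  rw [← unionGraph_adj hρ h hφ]
  exact ⟨fun hab => hab.2.2, fun hab => ⟨⟨a, rfl⟩, ⟨b, rfl⟩, hab⟩⟩

lemma Sys.edge_of_inter (h : Sys (orderedEdges F ρ) Φ) {φ ψ : α → V} (hφ : φ ∈ Φ) (hψ : ψ ∈ Φ)
    (hne : Set.range φ ≠ Set.range ψ) {I : Set V} (hI : I ⊆ Set.range φ ∩ Set.range ψ)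
    (hI2 : ¬ I.Subsingleton) : ∃ p q, (unionGraph F Φ).Adj p q ∧ p ∈ Set.range φ ∧
      p ∈ Set.range ψ ∧ q ∈ Set.range φ ∧ q ∈ Set.range ψ ∧ I = {p, q} := by
  obtain ⟨x, hx, y, hy, hxy⟩ := Set.not_subsingleton_iff.mp hI2
  obtain ⟨t, ht, t', ht', htt, hxt, hyt, hsub⟩ := h.link φ hφ ψ hψ (fun e => hne (by rw [e]))
    x y hxy (hI hx).1 (hI hy).1 (hI hx).2 (hI hy).2
  have h0 : φ (t 0) = ψ (t' 0) := congrFun htt 0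
  have h1 : φ (t 1) = ψ (t' 1) := congrFun htt 1
  refine ⟨φ (t 0), φ (t 1), ⟨fun e => ht.2.ne (h.inj φ hφ e), φ, hφ, _, _, ht.2, rfl, rfl⟩,
    ⟨_, rfl⟩, ⟨_, h0.symm⟩, ⟨_, rfl⟩, ⟨_, h1.symm⟩, ?_⟩
  ext v
  constructor
  · exact fun hv => mem_range_two.mp (hsub (hI hv))
  · intro hv
    rcases mem_range_two.mp hxt with e | e <;> rcases mem_range_two.mp hyt with e' | e'
    · exact absurd (e.trans e'.symm) hxy
    · rcases hv with hv | hv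
      · exact (hv.trans e.symm).symm ▸ hx
      · exact (hv.trans e'.symm).symm ▸ hy
    · rcases hv with hv | hv
      · exact (hv.trans e'.symm).symm ▸ hy
      · exact (hv.trans e.symm).symm ▸ hx
    · exact absurd (e.trans e'.symm) hxy

lemma Sys.almostDisjoint (h : Sys (orderedEdges F ρ) Φ) : AlmostDisjoint (eb Φ) := by
  rintro _ ⟨φ, hφ, rfl⟩ _ ⟨ψ, hψ, rfl⟩ hne x hx y hy hxy
  obtain ⟨p, q, -, -, -, -, -, hpq⟩ := h.edge_of_inter hφ hψ hne subset_rfl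
    (Set.not_subsingleton_iff.mpr ⟨x, hx, y, hy, hxy⟩)
  rw [hpq] at hx hy ⊢
  rcases hx with rfl | rfl <;> rcases hy with rfl | rfl
  · exact absurd rfl hxy
  · exact subset_rfl
  · exact (Set.pair_comm _ _).le
  · exact absurd rfl hxy

lemma BlockForest.isForestOfCopies (h : Sys (orderedEdges F ρ) Φ) {𝒯 : Set (Set V)}
    (h𝒯 : BlockForest 𝒯) (hsub : 𝒯 ⊆ eb Φ) :
    IsForestOfCopies ((fun B => (⊤ : (unionGraph F Φ).Subgraph).induce B) '' 𝒯) := by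
  obtain ⟨m, b, hinj, hmem, hleaf⟩ := h𝒯.exists_enum
  refine ⟨m, fun i => (⊤ : (unionGraph F Φ).Subgraph).induce (b i), ?_, ?_, ?_⟩
  · intro i j hij
    exact Fin.ext (hinj i i.2 j j.2 (congrArg SimpleGraph.Subgraph.verts hij))
  · intro H
    constructor
    · rintro ⟨B, hB, rfl⟩
      obtain ⟨i, hi, rfl⟩ := (hmem B).mp hB
      exact ⟨⟨i, hi⟩, rfl⟩
    · rintro ⟨i, rfl⟩
      exact ⟨b i, (hmem _).mpr ⟨i, i.2, rfl⟩, rfl⟩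
  · intro j _
    simp only [SimpleGraph.Subgraph.induce_verts]
    have hU : (⋃ (i : Fin m) (_ : i < j), b i) = ⋃₀ {B | ∃ i < (j : ℕ), b i = B} := by
      ext v
      simp only [Set.mem_iUnion]
      constructor
      · rintro ⟨i, hi, hv⟩
        exact ⟨b i, ⟨i, hi, rfl⟩, hv⟩
      · rintro ⟨_, ⟨i, hi, rfl⟩, hv⟩
        exact ⟨⟨i, hi.trans j.2⟩, hi, hv⟩
    rw [hU]
    set I := b j ∩ ⋃₀ {B | ∃ i < (j : ℕ), b i = B} with hI
    by_cases hI2 : I.Subsingleton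
    · rcases hI2.eq_empty_or_singleton with h0 | h1
      · exact Or.inl h0
      · exact Or.inr (Or.inl h1)
    rcases hleaf j j.2 with hl | ⟨_, ⟨i, hi, rfl⟩, hl⟩
    · exact absurd hl hI2
    obtain ⟨φ, hφ, hφj⟩ := hsub ((hmem (b j)).mpr ⟨j, j.2, rfl⟩)
    obtain ⟨ψ, hψ, hψi⟩ := hsub ((hmem (b i)).mpr ⟨i, hi.trans j.2, rfl⟩)
    have hne : Set.range φ ≠ Set.range ψ := fun e =>
      absurd (hinj j j.2 i (hi.trans j.2) (hφj.symm.trans (e.trans hψi))) hi.ne'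
    obtain ⟨p, q, hpq, h1, h2, h3, h4, hIpq⟩ := h.edge_of_inter hφ hψ hne
      (fun v hv => ⟨hφj ▸ hv.1, hψi ▸ hl hv⟩) hI2
    rw [hφj] at h1 h3
    rw [hψi] at h2 h4
    exact Or.inr (Or.inr ⟨p, q, ⟨h1, h3, hpq⟩, ⟨⟨i, hi.trans j.2⟩, hi, h2, h4, hpq⟩, hIpq⟩)

end

section
variable {ι U V W : Type} {F : Set (ι → U)} {Φ : Set (U → V)}

lemma Sys.comp_equiv (h : Sys F Φ) (e : V ≃ W) : Sys F ((fun φ => e ∘ φ) '' Φ) where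
  inj := by
    rintro _ ⟨φ, hφ, rfl⟩
    exact e.injective.comp (h.inj φ hφ)
  strong := by
    rintro _ ⟨φ, hφ, rfl⟩ _ ⟨_, ⟨ψ, hψ, rfl⟩, t, ht, rfl⟩ _ _ hxy ⟨u, rfl⟩ ⟨v, rfl⟩ ⟨i, hi⟩ ⟨j, hj⟩
    obtain ⟨t', ht', htt⟩ := h.strong φ hφ (ψ ∘ t) ⟨ψ, hψ, t, ht, rfl⟩ (φ u) (φ v)
      (fun e' => hxy (congrArg e e')) ⟨u, rfl⟩ ⟨v, rfl⟩ ⟨i, e.injective hi⟩ ⟨j, e.injective hj⟩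
    exact ⟨t', ht', congrArg (fun f => e ∘ f) htt⟩
  link := by
    rintro _ ⟨φ, hφ, rfl⟩ _ ⟨ψ, hψ, rfl⟩ hne _ _ hxy ⟨u, rfl⟩ ⟨v, rfl⟩ ⟨i, hi⟩ ⟨j, hj⟩
    obtain ⟨t, ht, t', ht', htt, ⟨a, ha⟩, ⟨b, hb⟩, hsub⟩ := h.link φ hφ ψ hψ
      (fun e' => hne (by rw [e'])) (φ u) (φ v)
      (fun e' => hxy (congrArg e e')) ⟨u, rfl⟩ ⟨v, rfl⟩ ⟨i, e.injective hi⟩ ⟨j, e.injective hj⟩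
    refine ⟨t, ht, t', ht', congrArg (fun f => e ∘ f) htt, ⟨a, congrArg e ha⟩, ⟨b, congrArg e hb⟩,
      ?_⟩
    rintro _ ⟨⟨u', rfl⟩, v', hv'⟩
    obtain ⟨c, hc⟩ := hsub ⟨⟨u', rfl⟩, v', e.injective hv'⟩
    exact ⟨c, congrArg e hc⟩

lemma range_comp_mem_eb (e : V ≃ W) {B : Set V} (hB : B ∈ eb Φ) :
    e '' B ∈ eb ((fun φ => e ∘ φ) '' Φ) := by
  obtain ⟨φ, hφ, rfl⟩ := hB
  exact ⟨e ∘ φ, ⟨φ, hφ, rfl⟩, Set.range_comp _ _⟩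

lemma Co2.of_comp_equiv (e : V ≃ W) {x y : W} (h : Co2 (eb ((fun φ => e ∘ φ) '' Φ)) x y) :
    Co2 (eb Φ) (e.symm x) (e.symm y) := by
  obtain ⟨_, ⟨_, ⟨φ, hφ, rfl⟩, rfl⟩, ⟨u, rfl⟩, v, rfl⟩ := h
  exact ⟨_, ⟨φ, hφ, rfl⟩, ⟨u, (e.symm_apply_apply _).symm⟩, v, (e.symm_apply_apply _).symm⟩

lemma pathEar_comp_equiv {M : ℕ} (h : PathEar (eb Φ) M) (e : V ≃ W) :
    PathEar (eb ((fun φ => e ∘ φ) '' Φ)) M := by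
  intro n x hn hM hs hc
  obtain ⟨i, hi, B, hB, h0, h1, h2⟩ := h n (fun i => e.symm (x i)) hn hM
    (fun i hi => (hs i hi).of_comp_equiv) hc.of_comp_equiv
  exact ⟨i, hi, _, range_comp_mem_eb e hB, ⟨_, h0, e.apply_symm_apply _⟩,
    ⟨_, h1, e.apply_symm_apply _⟩, ⟨_, h2, e.apply_symm_apply _⟩⟩

lemma conf_comp_equiv (h : Conf (eb Φ)) (e : V ≃ W) : Conf (eb ((fun φ => e ∘ φ) '' Φ)) := by
  intro K hK hKc
  obtain ⟨B, hB, hKB⟩ := h (e.symm '' K) (hK.image _) (by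
    rintro _ ⟨x, hx, rfl⟩ _ ⟨y, hy, rfl⟩
    exact (hKc x hx y hy).of_comp_equiv)
  exact ⟨_, range_comp_mem_eb e hB, fun x hx => ⟨_, hKB ⟨x, hx, rfl⟩, e.apply_symm_apply _⟩⟩

end

end GirthRamsey

/-- **Girth Ramsey theorem.**  Given a graph `F` and integers `r, ℓ ≥ 1`, there exist a
graph `G` together with a system `𝒢` of induced copies of `F` in `G` such that (i) for
every `r`-colouring of the edges of `G` some copy in `𝒢` is monochromatic, and (ii) for
every subset `𝒻 ⊆ 𝒢` with `2 ≤ |𝒻| ≤ ℓ` there exists `𝒳 ⊆ 𝒢` with `|𝒳| ≤ |𝒻| − 2`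
such that `𝒻 ∪ 𝒳` is a forest of copies. -/
theorem girth_ramsey_theorem {α : Type} [Fintype α] (F : SimpleGraph α) (r ℓ : ℕ)
    (hr : 1 ≤ r) (hℓ : 1 ≤ ℓ) :
    ∃ (n : ℕ) (G : SimpleGraph (Fin n)) (𝒢 : Set G.Subgraph),
      (∀ H ∈ 𝒢, H.IsInduced ∧ Nonempty (H.coe ≃g F)) ∧
      (∀ c : Sym2 (Fin n) → Fin r, ∃ H ∈ 𝒢, ∃ k : Fin r,
        ∀ x y, H.Adj x y → c s(x, y) = k) ∧
      (∀ 𝒻 ⊆ 𝒢, 2 ≤ 𝒻.ncard → 𝒻.ncard ≤ ℓ →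
        ∃ 𝒳 ⊆ 𝒢, 𝒳.ncard ≤ 𝒻.ncard - 2 ∧ IsForestOfCopies (𝒻 ∪ 𝒳)) := by
  classical
  have : Nonempty (Fin r) := ⟨⟨0, hr⟩⟩
  let ρ : α → ℕ := fun a => Fintype.equivFin α a
  have hρ : Function.Injective ρ := Fin.val_injective.comp (Fintype.equivFin α).injective
  obtain ⟨V, _, Ψ, -, hΨ, hearΨ, hconfΨ, -, hramΨ⟩ := GirthRamsey.ramConf
    (Fintype.card α * (2 * ℓ)) (Fin 2) α (Fin r) Fin.val (GirthRamsey.orderedEdges F ρ) ρ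
    Fin.val_injective GirthRamsey.lin_orderedEdges (by
      intro f hf i j hij
      obtain ⟨rfl, rfl⟩ : i = 0 ∧ j = 1 := by omega
      exact hf.1)
  obtain ⟨n, ⟨e⟩⟩ := Finite.exists_equiv_fin V
  set Φ : Set (α → Fin n) := (fun φ => e ∘ φ) '' Ψ with hΦdef
  have hΦ := hΨ.comp_equiv e
  have hear := GirthRamsey.pathEar_comp_equiv hearΨ e
  have hconf := GirthRamsey.conf_comp_equiv hconfΨ e
  rw [← hΦdef] at hΦ hear hconf
  refine ⟨n, GirthRamsey.unionGraph F Φ, (fun B => (⊤ : Subgraph _).induce B) '' GirthRamsey.eb Φ,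
    ?_, ?_, ?_⟩
  · rintro _ ⟨_, ⟨φ, hφ, rfl⟩, rfl⟩
    exact ⟨fun x hx y hy h => ⟨hx, hy, h⟩, GirthRamsey.nonempty_iso_induce hρ hΦ hφ⟩
  · intro c
    obtain ⟨φ, hφ, k, hk⟩ := hramΨ fun f => c s(e (f 0), e (f 1))
    refine ⟨_, ⟨_, ⟨e ∘ φ, ⟨φ, hφ, rfl⟩, rfl⟩, rfl⟩, k, ?_⟩
    rintro _ _ ⟨⟨a, rfl⟩, ⟨b, rfl⟩, hab⟩
    have hF : F.Adj a b := (GirthRamsey.unionGraph_adj hρ hΦ ⟨φ, hφ, rfl⟩).mp hab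
    obtain ⟨t, ht, ⟨h0, h1⟩ | ⟨h0, h1⟩⟩ := GirthRamsey.exists_orderedEdge hρ hF
    · rw [← h0, ← h1]
      exact hk t ht
    · rw [← h0, ← h1, Sym2.eq_swap]
      exact hk t ht
  · intro 𝒻 h𝒻 _ h𝒻l
    let ind : Set (Fin n) → (GirthRamsey.unionGraph F Φ).Subgraph := fun B =>
      (⊤ : Subgraph _).induce B
    have himg : ind '' (Subgraph.verts '' 𝒻) = 𝒻 := by
      rw [Set.image_image]
      refine (Set.image_congr fun H hH => ?_).trans (Set.image_id' 𝒻)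
      obtain ⟨B, -, rfl⟩ := h𝒻 hH
      rfl
    have hsub : Subgraph.verts '' 𝒻 ⊆ GirthRamsey.eb Φ := by
      rintro _ ⟨H, hH, rfl⟩
      obtain ⟨B, hB, rfl⟩ := h𝒻 hH
      exact hB
    have hcard : (Subgraph.verts '' 𝒻).ncard ≤ 𝒻.ncard := Set.ncard_image_le (Set.toFinite _)
    obtain ⟨𝒳, h𝒳, h𝒳c, hfor⟩ := GirthRamsey.exists_forest_of_small hΦ.almostDisjoint hear hconf
      (k := Fintype.card α) (l := ℓ) (by
        rintro _ ⟨φ, -, rfl⟩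
        rw [← Set.image_univ, ← Nat.card_eq_fintype_card, ← Set.ncard_univ]
        exact Set.ncard_image_le (Set.toFinite _)) le_rfl hsub (hcard.trans h𝒻l)
    refine ⟨ind '' 𝒳, Set.image_mono h𝒳, ?_, ?_⟩
    · have := Set.ncard_image_le (f := ind) (Set.toFinite 𝒳)
      omega
    · have := hfor.isForestOfCopies hΦ (Set.union_subset hsub h𝒳)
      rw [Set.image_union] at this
      change IsForestOfCopies (ind '' (Subgraph.verts '' 𝒻) ∪ ind '' 𝒳) at this
      rwa [himg] at this
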